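/- Let X be a finite Bruck loop with enveloping group G. Then G = O(G) × O^{2'}(G); that is, O(G) ∩ O^{2'}(G) = 1 and O(G)·O^{2'}(G) = G. -/

import Mathlib

/-- A Bruck loop: a loop (with two-sided identity and bijective translations) satisfying
the right Bol identity `((x∘y)∘z)∘y = x∘((y∘z)∘y)` and the automorphic inverse property
`(x∘y)⁻¹ = x⁻¹∘y⁻¹`, where `x⁻¹` is the (well-defined) inverse of `x`. -/
structure BruckLoop (X : Type*) where
  mul : X → X → X
  one : X
  inv : X → X
  one_mul : ∀ x, mul one x = x
  mul_one : ∀ x, mul x one = x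
  mulLeft_bijective : ∀ x, Function.Bijective (mul x)
  mulRight_bijective : ∀ x, Function.Bijective fun y => mul y x
  rightBol : ∀ x y z, mul (mul (mul x y) z) y = mul x (mul (mul y z) y)
  mul_inv : ∀ x, mul x (inv x) = one
  inv_mul : ∀ x, mul (inv x) x = one
  aip : ∀ x y, inv (mul x y) = mul (inv x) (inv y)

namespace BruckLoop

variable {X : Type*}

/-- Powers of an element of a Bruck loop (powers are well defined in Bol loops). -/
def pow (L : BruckLoop X) (x : X) : ℕ → X
  | 0 => L.one
  | n + 1 => L.mul (L.pow x n) x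

/-- An element has order a power of `2`. -/
def OrderTwoPow (L : BruckLoop X) (x : X) : Prop := ∃ n : ℕ, L.pow x (2 ^ n) = L.one

/-- A subloop: a nonempty subset closed under the loop operation. -/
def IsSubloop (L : BruckLoop X) (S : Set X) : Prop :=
  S.Nonempty ∧ ∀ a ∈ S, ∀ b ∈ S, L.mul a b ∈ S

/-- The right translation `ρ_x : y ↦ y ∘ x` as a permutation of `X`. -/
noncomputable def rho (L : BruckLoop X) (x : X) : Equiv.Perm X :=
  Equiv.ofBijective _ (L.mulRight_bijective x)

/-- The enveloping group `G = ⟨ρ_x : x ∈ X⟩` of a Bruck loop. -/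
noncomputable def envGroup (L : BruckLoop X) : Subgroup (Equiv.Perm X) :=
  Subgroup.closure (Set.range L.rho)

/-- `H = Stab_G(1)`, the stabilizer of `1` in the enveloping group. -/
noncomputable def innerGroup (L : BruckLoop X) : Subgroup (Equiv.Perm X) :=
  L.envGroup ⊓ MulAction.stabilizer (Equiv.Perm X) L.one

end BruckLoop

/-- `O(G)`: the largest normal subgroup of odd order of `G`. -/
def oddCore (G : Type*) [Group G] : Subgroup G :=
  ⨆ N : {N : Subgroup G // N.Normal ∧ Odd (Nat.card N)}, (N : Subgroup G)

/-- `O₂(G)`: the largest normal 2-subgroup of `G`. -/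
def O2 (G : Type*) [Group G] : Subgroup G :=
  ⨆ N : {N : Subgroup G // N.Normal ∧ IsPGroup 2 N}, (N : Subgroup G)

/-- `O^{2'}(G)`: the smallest normal subgroup of odd index of `G`. -/
def oddResidual (G : Type*) [Group G] : Subgroup G :=
  ⨅ N : {N : Subgroup G // N.Normal ∧ Odd N.index}, (N : Subgroup G)

universe u

/-- Every permutation has a two-colouring that it swaps on all cycles of even length. -/
theorem Equiv.Perm.exists_swapped_coloring {α : Type*} (π : Equiv.Perm α) :
    ∃ c : α → Prop, ∀ v, (∀ k : ℤ, (π ^ k) v = v → Even k) → (c (π v) ↔ ¬ c v) := by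
  classical
  let s := Equiv.Perm.SameCycle.setoid π
  have key : ∀ v : α, ∃ k : ℤ, (π ^ k) (Quotient.out (Quotient.mk s v)) = v := fun v =>
    Quotient.exact (Quotient.out_eq (Quotient.mk s v))
  choose k hk using key
  refine ⟨fun v => Even (k v), fun v h => ?_⟩
  have hq : Quotient.mk s (π v) = Quotient.mk s v :=
    Quotient.sound (Equiv.Perm.sameCycle_apply_left.2 (Equiv.Perm.SameCycle.refl π v))
  have h1 := hk (π v)
  rw [hq] at h1
  have h2 := hk v
  have h3 : (π ^ (k (π v) - k v - 1)) v = v := by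
    calc (π ^ (k (π v) - k v - 1)) v
        = (π ^ (k (π v) - k v - 1)) ((π ^ k v) (Quotient.mk s v).out) := by rw [h2]
      _ = (π ^ (-1 : ℤ)) ((π ^ k (π v)) (Quotient.mk s v).out) := by
        rw [← Equiv.Perm.mul_apply, ← Equiv.Perm.mul_apply, ← zpow_add, ← zpow_add]
        congr 2
        ring
      _ = v := by rw [h1]; simp
  have h4 := h _ h3
  change Even (k (π v)) ↔ ¬ Even (k v)
  grind

/-- If `γ` swaps two elements `a` and `b` under conjugation, and `a + b` commutes with `a`, then
a trace form cannot distinguish `γ (a + b) ^ m` from `2 ^ m γ a ^ m`. -/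
theorem trace_mul_add_pow {A K : Type*} [Ring A] [CommRing K] (T : A →+ K)
    (hT : ∀ u v, T (u * v) = T (v * u)) {γ a b : A} (hγ : γ * a = b * γ) (hab : Commute a b)
    (m : ℕ) : T (γ * (a + b) ^ m) = 2 ^ m * T (γ * a ^ m) := by
  have step : ∀ Y, Commute a Y → Commute b Y → T (γ * (b * Y)) = T (γ * (a * Y)) := by
    intro Y h1 h2
    have e : γ * (a * Y) = b * (γ * Y) := by rw [← mul_assoc, hγ, mul_assoc]
    rw [e, hT b, mul_assoc, h2.eq]
  have gen : ∀ m : ℕ, ∀ Y, Commute a Y → Commute b Y →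
      T (γ * ((a + b) ^ m * Y)) = 2 ^ m * T (γ * (a ^ m * Y)) := by
    intro m
    induction m with
    | zero => intro Y _ _; simp
    | succ m ih =>
      intro Y h1 h2
      have c1 : Commute a ((a + b) ^ m) := ((Commute.refl a).add_right hab).pow_right m
      have c2 : Commute b ((a + b) ^ m) := (hab.symm.add_right (Commute.refl b)).pow_right m
      have e1 : (a + b) ^ (m + 1) * Y = a * ((a + b) ^ m * Y) + b * ((a + b) ^ m * Y) := by
        rw [pow_succ', mul_assoc, add_mul]
      rw [e1, mul_add, map_add, step _ (c1.mul_right h1) (c2.mul_right h2)]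
      have e2 : a * ((a + b) ^ m * Y) = (a + b) ^ m * (a * Y) := by
        rw [← mul_assoc, c1.eq, mul_assoc]
      rw [e2, ih (a * Y) ((Commute.refl a).mul_right h1) (hab.symm.mul_right h2),
        ← mul_assoc (a ^ m), ← pow_succ]
      ring
  simpa using gen m 1 (Commute.one_right a) (Commute.one_right b)

/-- A complex number `α` such that, for some odd integer `c`, each `c ^ m * α` is `2 ^ m` times an
algebraic integer vanishes. -/
theorem eq_zero_of_forall_two_pow_dvd {α : ℂ} {c : ℤ} (hc : Odd c)
    (h : ∀ m : ℕ, ∃ β : ℂ, IsIntegral ℤ β ∧ (c : ℂ) ^ m * α = 2 ^ m * β) : α = 0 := by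
  have h1 : ∀ m : ℕ, IsIntegral ℤ (α / 2 ^ m) := by
    intro m
    obtain ⟨β, hβ, e⟩ := h m
    obtain ⟨β0, hβ0, e0⟩ := h 0
    have hα : IsIntegral ℤ α := by
      have : α = β0 := by simpa using e0
      exact this ▸ hβ0
    have hcop : IsCoprime (c ^ m) ((2 : ℤ) ^ m) := by
      apply IsCoprime.pow
      rw [Int.isCoprime_iff_gcd_eq_one, Int.gcd_comm]
      exact Int.isCoprime_iff_gcd_eq_one.1 (by simpa using hc)
    obtain ⟨u, v, huv⟩ := hcop
    have e2 : α / 2 ^ m = (u : ℂ) * β + (v : ℂ) * α := by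
      have huv' : (u : ℂ) * (c : ℂ) ^ m + (v : ℂ) * 2 ^ m = 1 := by exact_mod_cast huv
      rw [div_eq_iff (pow_ne_zero _ two_ne_zero)]
      calc α = (u * (c : ℂ) ^ m + v * 2 ^ m) * α := by rw [huv', one_mul]
        _ = u * ((c : ℂ) ^ m * α) + v * α * 2 ^ m := by ring
        _ = _ := by rw [e]; ring
    rw [e2]
    have hi : ∀ n : ℤ, IsIntegral ℤ (n : ℂ) := fun n => isIntegral_algebraMap (A := ℂ) (x := n)
    exact ((hi u).mul hβ).add ((hi v).mul hα)
  by_contra hα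
  have hαi : IsIntegral ℤ α := by simpa using h1 0
  have hαQ : IsIntegral ℚ α := hαi.tower_top
  let K := IntermediateField.adjoin ℚ {α}
  have : FiniteDimensional ℚ K := IntermediateField.adjoin.finiteDimensional hαQ
  let a : K := IntermediateField.AdjoinSimple.gen ℚ α
  have haα : (a : ℂ) = α := IntermediateField.AdjoinSimple.coe_gen ℚ α
  have h2 : ∀ m : ℕ, IsIntegral ℤ (a / 2 ^ m) := by
    intro m
    have := h1 m
    rw [← isIntegral_algebraMap_iff (A := K) (B := ℂ) (algebraMap K ℂ).injective]
    have e : algebraMap K ℂ (a / 2 ^ m) = α / 2 ^ m := by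
      rw [map_div₀, map_pow, map_ofNat, ← haα]; rfl
    rwa [e]
  have h3 : ∀ m : ℕ, ∃ n : ℤ, Algebra.norm ℚ a = n * (2 ^ m) ^ Module.finrank ℚ K := by
    intro m
    have := Algebra.isIntegral_norm ℚ (h2 m)
    obtain ⟨n, hn⟩ := IsIntegrallyClosed.isIntegral_iff.1 this
    refine ⟨n, ?_⟩
    have e : a = a / 2 ^ m * algebraMap ℚ K (2 ^ m) := by
      simp
    nth_rewrite 1 [e]
    rw [map_mul, Algebra.norm_algebraMap, ← hn]
    simp
  have hne : Algebra.norm ℚ a ≠ 0 := by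
    rw [Ne, Algebra.norm_eq_zero_iff]
    intro h0
    apply hα
    rw [← haα, h0]; rfl
  obtain ⟨n0, hn0⟩ := h3 0
  have hn0' : Algebra.norm ℚ a = n0 := by simpa using hn0
  have hpos : 0 < Module.finrank ℚ K := Module.finrank_pos
  have hn0ne : n0 ≠ 0 := by rintro rfl; exact hne (by simpa using hn0')
  obtain ⟨n, hn⟩ := h3 n0.natAbs
  have h5 : n0 = n * (2 ^ n0.natAbs) ^ Module.finrank ℚ K := by
    rw [hn0'] at hn
    exact_mod_cast hn
  have h6 : (2 ^ n0.natAbs : ℤ) ∣ n0 := by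
    exact (Dvd.dvd.mul_left (dvd_pow_self _ hpos.ne') n).trans (dvd_of_eq h5.symm)
  have h7 := Int.le_of_dvd (abs_pos.2 hn0ne) ((dvd_abs _ _).2 h6)
  have h8 : n0.natAbs < 2 ^ n0.natAbs := Nat.lt_two_pow_self
  have h9 : |n0| = (n0.natAbs : ℤ) := Int.abs_eq_natAbs n0
  rw [h9] at h7
  have : 2 ^ n0.natAbs ≤ n0.natAbs := by exact_mod_cast h7
  omega

/-- Integers can be separated by parity with an integer polynomial, up to an odd scalar. -/
theorem exists_polynomial_separating_parity {ι : Type*} [Fintype ι] (ω : ι → ℤ) :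
    ∃ (q : Polynomial ℤ) (D : ℤ), Odd D ∧
      ∀ i, (Odd (ω i) → q.eval (ω i) = D) ∧ (Even (ω i) → q.eval (ω i) = 0) := by
  classical
  let E : Polynomial ℤ := ∏ j with Even (ω j), (Polynomial.X - Polynomial.C (ω j))
  have hE : ∀ k : ℤ, E.eval k = ∏ j with Even (ω j), (k - ω j) := by
    intro k
    simp [E, Polynomial.eval_prod]
  let D : ℤ := ∏ i with Odd (ω i), E.eval (ω i)
  let q : Polynomial ℤ := Polynomial.C D - ∏ i with Odd (ω i), (Polynomial.C (E.eval (ω i)) - E)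
  have prod_odd : ∀ (s : Finset ι) (f : ι → ℤ), (∀ i ∈ s, Odd (f i)) → Odd (∏ i ∈ s, f i) := by
    intro s f hf
    exact Finset.prod_induction f Odd (fun a b ha hb => ha.mul hb) odd_one hf
  refine ⟨q, D, prod_odd _ _ fun i hi => ?_, fun i => ⟨fun hi => ?_, fun hi => ?_⟩⟩
  · rw [hE]
    refine prod_odd _ _ fun j hj => ?_
    exact (Finset.mem_filter.1 hi).2.sub_even (Finset.mem_filter.1 hj).2
  · have : (∏ i with Odd (ω i), (Polynomial.C (E.eval (ω i)) - E)).eval (ω i) = 0 := by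
      rw [Polynomial.eval_prod]
      exact Finset.prod_eq_zero (Finset.mem_filter.2 ⟨Finset.mem_univ i, hi⟩) (by simp)
    rw [Polynomial.eval_sub, this, Polynomial.eval_C, sub_zero]
  · have h0 : E.eval (ω i) = 0 := by
      rw [hE]
      exact Finset.prod_eq_zero (Finset.mem_filter.2 ⟨Finset.mem_univ i, hi⟩) (by simp)
    simp [q, Polynomial.eval_prod, h0, D]

namespace GroupChar

open MonoidAlgebra

variable {G : Type*} [Group G] {ι : Type*} {d : ι → ℕ}
  (Ψ : MonoidAlgebra ℂ G ≃ₐ[ℂ] ((i : ι) → Matrix (Fin (d i)) (Fin (d i)) ℂ))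

/-- The trace of the `i`-th Wedderburn component. -/
noncomputable def tr (i : ι) : MonoidAlgebra ℂ G →ₗ[ℂ] ℂ :=
  Matrix.traceLinearMap (Fin (d i)) ℂ ℂ ∘ₗ LinearMap.proj i ∘ₗ Ψ.toLinearMap

theorem tr_apply (i : ι) (a : MonoidAlgebra ℂ G) : tr Ψ i a = (Ψ a i).trace := rfl

theorem tr_mul_comm (i : ι) (a b : MonoidAlgebra ℂ G) : tr Ψ i (a * b) = tr Ψ i (b * a) := by
  simp only [tr_apply, map_mul, Pi.mul_apply]
  exact Matrix.trace_mul_comm _ _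

theorem tr_one (i : ι) : tr Ψ i 1 = d i := by simp [tr_apply]

/-- The character of the `i`-th Wedderburn component. -/
noncomputable def chr (i : ι) (g : G) : ℂ := tr Ψ i (single g 1)

theorem chr_mul_comm (i : ι) (g h : G) : chr Ψ i (g * h) = chr Ψ i (h * g) := by
  have := tr_mul_comm Ψ i (single g 1) (single h 1)
  rwa [single_mul_single, single_mul_single, one_mul] at this

theorem chr_conj (i : ι) (g h : G) : chr Ψ i (h * g * h⁻¹) = chr Ψ i g := by
  rw [chr_mul_comm]; group

section Central

theorem commute_of_forall_single {a : MonoidAlgebra ℂ G}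
    (ha : ∀ g : G, Commute (single g 1) a) (b : MonoidAlgebra ℂ G) : Commute b a := by
  induction b using MonoidAlgebra.induction_linear with
  | zero => exact Commute.zero_left a
  | add f g hf hg => exact hf.add_left hg
  | single g r =>
    have : (single g r : MonoidAlgebra ℂ G) = r • single g 1 := by simp
    rw [this]
    exact (ha g).smul_left r

theorem exists_scalar_of_central {a : MonoidAlgebra ℂ G}
    (ha : ∀ b : MonoidAlgebra ℂ G, Commute b a) (i : ι) :
    ∃ ω : ℂ, Ψ a i = ω • (1 : Matrix (Fin (d i)) (Fin (d i)) ℂ) := by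
  classical
  have h : Ψ a i ∈ Set.range (Matrix.scalar (Fin (d i))) := by
    apply Matrix.mem_range_scalar_of_commute_single
    intro j k _
    obtain ⟨b, hb⟩ := Ψ.surjective (Pi.single i (Matrix.single j k 1))
    have := congrFun (congrArg Ψ (ha b).eq) i
    rw [map_mul, map_mul, hb] at this
    simpa [Commute, SemiconjBy] using this
  obtain ⟨ω, hω⟩ := h
  refine ⟨ω, ?_⟩
  rw [← hω, Matrix.smul_one_eq_diagonal]
  rfl

theorem tr_central_mul {a : MonoidAlgebra ℂ G} (ha : ∀ b : MonoidAlgebra ℂ G, Commute b a)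
    (i : ι) (b : MonoidAlgebra ℂ G) : d i * tr Ψ i (a * b) = tr Ψ i a * tr Ψ i b := by
  obtain ⟨ω, hω⟩ := exists_scalar_of_central Ψ ha i
  simp only [tr_apply, map_mul, Pi.mul_apply, hω, smul_mul_assoc, one_mul, Matrix.trace_smul,
    Matrix.trace_one, Fintype.card_fin, smul_eq_mul]
  ring

variable [Fintype G]

theorem commute_sum_conj_invariant {f : G → ℂ} (hf : ∀ g h : G, f (h * g * h⁻¹) = f g)
    (b : MonoidAlgebra ℂ G) : Commute b (∑ g, single g (f g)) := by
  refine commute_of_forall_single (fun h => ?_) b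
  rw [Commute, SemiconjBy, Finset.mul_sum, Finset.sum_mul]
  simp only [single_mul_single, one_mul, mul_one]
  refine Fintype.sum_equiv (MulAut.conj h).toEquiv _ _ fun g => ?_
  simp [hf]

theorem sum_chr_conj_mul (i : ι) (x y : G) :
    d i * ∑ h, chr Ψ i (h * x * h⁻¹ * y) = Fintype.card G * (chr Ψ i x * chr Ψ i y) := by
  have hc : ∀ b : MonoidAlgebra ℂ G, Commute b (∑ h : G, single (h * x * h⁻¹) 1) := by
    refine commute_of_forall_single fun k => ?_
    rw [Commute, SemiconjBy, Finset.mul_sum, Finset.sum_mul]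
    simp only [single_mul_single, one_mul]
    refine Fintype.sum_equiv (Equiv.mulLeft k) _ _ fun g => ?_
    simp [mul_assoc]
  have h1 := tr_central_mul Ψ hc i (single y 1)
  have h2 : tr Ψ i (∑ h : G, single (h * x * h⁻¹) 1) = Fintype.card G * chr Ψ i x := by
    rw [map_sum, Finset.sum_congr rfl fun h _ =>
      show tr Ψ i (single (h * x * h⁻¹) 1) = chr Ψ i x from chr_conj Ψ i x h]
    simp
  rw [h2, Finset.sum_mul, map_sum] at h1
  simp only [single_mul_single, one_mul] at h1
  simp only [chr] at h1 ⊢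
  rw [h1]; ring

end Central

section Idempotent

theorem exists_nat_trace {m : ℕ} {A : Matrix (Fin m) (Fin m) ℂ} (hA : IsIdempotentElem A) :
    ∃ k : ℕ, A.trace = k := by
  have h1 : IsIdempotentElem (Matrix.toLin' A) := by
    rw [IsIdempotentElem, Module.End.mul_eq_comp, ← Matrix.toLin'_mul, hA.eq]
  obtain ⟨p, hp⟩ := (LinearMap.isProj_iff_isIdempotentElem _).2 h1
  exact ⟨_, by rw [← Matrix.trace_toLin'_eq]; exact hp.trace⟩

theorem eq_zero_of_trace_eq_zero {m : ℕ} {A : Matrix (Fin m) (Fin m) ℂ}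
    (hA : IsIdempotentElem A) (h0 : A.trace = 0) : A = 0 := by
  have h1 : IsIdempotentElem (Matrix.toLin' A) := by
    rw [IsIdempotentElem, Module.End.mul_eq_comp, ← Matrix.toLin'_mul, hA.eq]
  rw [← Matrix.trace_toLin'_eq, LinearMap.IsIdempotentElem.trace_eq_zero_iff h1] at h0
  exact (map_eq_zero_iff _ Matrix.toLin'.injective).1 h0

theorem exists_nat_tr_eq {a : MonoidAlgebra ℂ G} (ha : a * a = a) (i : ι) :
    ∃ k : ℕ, tr Ψ i a = k :=
  exists_nat_trace (A := Ψ a i) (by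
    rw [IsIdempotentElem, ← Pi.mul_apply, ← map_mul, ha])

theorem apply_eq_zero_of_tr_eq_zero {a : MonoidAlgebra ℂ G} (ha : a * a = a) {i : ι}
    (h0 : tr Ψ i a = 0) : Ψ a i = 0 :=
  eq_zero_of_trace_eq_zero (by
    rw [IsIdempotentElem, ← Pi.mul_apply, ← map_mul, ha]) h0

end Idempotent

section TraceFormula

theorem trace_mulLeft_mulRight_matrix [Fintype ι]
    (A B : (i : ι) → Matrix (Fin (d i)) (Fin (d i)) ℂ) :
    LinearMap.trace ℂ _ (LinearMap.mulLeft ℂ A ∘ₗ LinearMap.mulRight ℂ B) =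
      ∑ i, (A i).trace * (B i).trace := by
  classical
  rw [LinearMap.trace_eq_matrix_trace ℂ
    (Pi.basis fun i => Matrix.stdBasis ℂ (Fin (d i)) (Fin (d i))), Matrix.trace, Fintype.sum_sigma]
  refine Finset.sum_congr rfl fun i _ => ?_
  rw [Fintype.sum_prod_type, Matrix.trace, Matrix.trace, Finset.sum_mul_sum]
  refine Finset.sum_congr rfl fun j _ => Finset.sum_congr rfl fun k _ => ?_
  rw [Matrix.diag_apply, LinearMap.toMatrix_apply, Pi.basis_repr, Pi.basis_apply]
  simp only [LinearMap.coe_comp, Function.comp_apply, LinearMap.mulLeft_apply,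
    LinearMap.mulRight_apply, Pi.mul_apply, Pi.single_eq_same, Matrix.stdBasis_eq_single]
  change (A i * (Matrix.single j k 1 * B i) : Matrix _ _ ℂ) j k = _
  simp [Matrix.mul_apply, Matrix.single_apply, ite_and]

theorem trace_mulLeft_mulRight [Fintype ι] (a b : MonoidAlgebra ℂ G) :
    LinearMap.trace ℂ _ (LinearMap.mulLeft ℂ a ∘ₗ LinearMap.mulRight ℂ b) =
      ∑ i, tr Ψ i a * tr Ψ i b := by
  simp only [tr_apply]
  rw [← trace_mulLeft_mulRight_matrix, ← LinearMap.trace_conj' _ Ψ.toLinearEquiv]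
  congr 1
  ext1 v
  simp [LinearEquiv.conj_apply]

end TraceFormula

section Integral

variable (G) in
/-- The integral group ring, inside the complex group algebra. -/
noncomputable def intRing : Subring (MonoidAlgebra ℂ G) :=
  (MonoidAlgebra.mapRingHom G (Int.castRingHom ℂ)).range

theorem single_mem_intRing (g : G) : single g 1 ∈ intRing G := ⟨single g 1, by simp⟩

theorem coeff_mem_intRing {a : MonoidAlgebra ℂ G} (ha : a ∈ intRing G) (g : G) :
    ∃ n : ℤ, a.coeff g = n := by
  obtain ⟨b, rfl⟩ := ha
  exact ⟨b.coeff g, by simp⟩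

theorem isIntegral_of_mem_intRing [Finite G] {a : MonoidAlgebra ℂ G} (ha : a ∈ intRing G) :
    IsIntegral ℤ a := by
  obtain ⟨b, rfl⟩ := ha
  have : IsIntegral ℤ b := IsIntegral.of_finite ℤ b
  exact this.map (MonoidAlgebra.mapRingHom G (Int.castRingHom ℂ)).toIntAlgHom

theorem isIntegral_apply [Finite G] {a : MonoidAlgebra ℂ G} (ha : a ∈ intRing G) (i : ι) :
    IsIntegral ℤ (Ψ a i) :=
  (isIntegral_of_mem_intRing ha).map
    ((Pi.evalAlgHom ℂ (fun i => Matrix (Fin (d i)) (Fin (d i)) ℂ) i).comp Ψ.toAlgHom)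

theorem isIntegral_trace_of_isIntegral {m : ℕ} {A : Matrix (Fin m) (Fin m) ℂ}
    (hA : IsIntegral ℤ A) : IsIntegral ℤ A.trace := by
  rw [Matrix.trace_eq_sum_roots_charpoly]
  refine Multiset.sum_induction (IsIntegral ℤ) _ (fun a b ha hb => ha.add hb) isIntegral_zero
    fun μ hμ => ?_
  obtain ⟨p, hp, hp0⟩ := hA
  have h1 : (Matrix.toLin' A).charpoly.IsRoot μ := by
    rw [Matrix.charpoly_toLin']
    exact Polynomial.isRoot_of_mem_roots hμ
  obtain ⟨v, hv⟩ := ((Module.End.hasEigenvalue_iff_isRoot_charpoly _ μ).2 h1).exists_hasEigenvector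
  have h2 := Module.End.aeval_apply_of_hasEigenvector (p := p.map (algebraMap ℤ ℂ)) hv
  rw [Polynomial.aeval_map_algebraMap] at h2
  have h3 : Polynomial.aeval (Matrix.toLin' A) p = 0 := by
    have e := Polynomial.aeval_algHom_apply
      ((Matrix.toLinAlgEquiv' (R := ℂ) (n := Fin m)).toAlgHom.restrictScalars ℤ) A p
    rw [Polynomial.aeval_def A p, hp0, map_zero] at e
    exact e
  rw [h3, LinearMap.zero_apply] at h2
  refine ⟨p, hp, ?_⟩
  rw [← Polynomial.eval_map]
  exact (smul_eq_zero.1 h2.symm).resolve_right hv.2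

theorem isIntegral_tr [Finite G] {a : MonoidAlgebra ℂ G} (ha : a ∈ intRing G) (i : ι) :
    IsIntegral ℤ (tr Ψ i a) :=
  isIntegral_trace_of_isIntegral (isIntegral_apply Ψ ha i)

end Integral

end GroupChar

namespace GroupChar

open MonoidAlgebra

variable {G : Type*} [Group G] {ι : Type*} {d : ι → ℕ}
  (Ψ : MonoidAlgebra ℂ G ≃ₐ[ℂ] ((i : ι) → Matrix (Fin (d i)) (Fin (d i)) ℂ))

section Average

variable [Finite G]

open Classical in
/-- The averaging idempotent of a subgroup. -/
noncomputable def avg (N : Subgroup G) : MonoidAlgebra ℂ G :=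
  (Nat.card N : ℂ)⁻¹ • ∑ᶠ n : N, single (n : G) 1

theorem card_smul_avg [Fintype G] (N : Subgroup G) :
    (Nat.card N : ℂ) • avg N = ∑ᶠ n : N, single (n : G) (1 : ℂ) := by
  rw [avg, smul_inv_smul₀]
  exact_mod_cast Nat.card_pos.ne'

theorem single_mul_avg (N : Subgroup G) {c : G} (hc : c ∈ N) : single c 1 * avg N = avg N := by
  cases nonempty_fintype N
  rw [avg, mul_smul_comm, finsum_eq_sum_of_fintype, Finset.mul_sum]
  congr 1
  simp only [single_mul_single, one_mul]
  exact Fintype.sum_equiv (Equiv.mulLeft (⟨c, hc⟩ : N)) _ _ fun n => rfl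

theorem avg_mul_of_forall (N : Subgroup G) {a : MonoidAlgebra ℂ G}
    (ha : ∀ n ∈ N, single n 1 * a = a) : avg N * a = a := by
  cases nonempty_fintype N
  rw [avg, smul_mul_assoc, finsum_eq_sum_of_fintype, Finset.sum_mul,
    Finset.sum_congr rfl fun (n : N) _ => ha n n.2, Finset.sum_const, Finset.card_univ,
    ← Nat.card_eq_fintype_card, ← Nat.cast_smul_eq_nsmul ℂ, inv_smul_smul₀]
  exact_mod_cast Nat.card_pos.ne'

theorem avg_mul_avg (N : Subgroup G) : avg N * avg N = avg N :=
  avg_mul_of_forall N fun _ hn => single_mul_avg N hn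

theorem commute_avg (N : Subgroup G) {g : G} (hg : ∀ n, n ∈ N → g * n * g⁻¹ ∈ N) :
    Commute (single g 1) (avg N) := by
  cases nonempty_fintype N
  have hb : Function.Bijective (fun n : N => (⟨g * n * g⁻¹, hg n n.2⟩ : N)) := by
    rw [← Finite.injective_iff_bijective]
    intro a b hab
    simpa using hab
  rw [Commute, SemiconjBy, avg, mul_smul_comm, smul_mul_assoc, finsum_eq_sum_of_fintype,
    Finset.mul_sum, Finset.sum_mul]
  congr 1
  simp only [single_mul_single, one_mul]
  exact Fintype.sum_equiv (Equiv.ofBijective _ hb) _ _ fun n => by simp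

theorem card_smul_avg_mem_intRing (N : Subgroup G) : (Nat.card N : ℂ) • avg N ∈ intRing G := by
  cases nonempty_fintype G
  cases nonempty_fintype N
  rw [card_smul_avg, finsum_eq_sum_of_fintype]
  exact sum_mem fun n _ => single_mem_intRing _

theorem card_mul_tr_mul_avg (i : ι) (N : Subgroup G) (g : G) :
    (Nat.card N : ℂ) * tr Ψ i (single g 1 * avg N) = ∑ᶠ n : N, chr Ψ i (g * n) := by
  cases nonempty_fintype G
  cases nonempty_fintype N
  rw [← smul_eq_mul, ← map_smul, ← mul_smul_comm, card_smul_avg, finsum_eq_sum_of_fintype,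
    finsum_eq_sum_of_fintype, Finset.mul_sum, map_sum]
  simp [single_mul_single, chr]

theorem card_mul_tr_avg (i : ι) (N : Subgroup G) :
    (Nat.card N : ℂ) * tr Ψ i (avg N) = ∑ᶠ n : N, chr Ψ i n := by
  have := card_mul_tr_mul_avg Ψ i N 1
  rw [show (single (1 : G) (1 : ℂ)) = 1 from rfl, one_mul] at this
  simpa using this

end Average

section OddSum

variable [Fintype G]

open Classical in
/-- The sum of the values of a character over the generators of a cyclic subgroup is an integer. -/
theorem exists_int_sum_chr_generators (i : ι) (C : Subgroup G) :
    ∃ n : ℤ, ∑ g with Subgroup.zpowers g = C, chr Ψ i g = n := by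
  induction hk : Nat.card C using Nat.strong_induction_on generalizing C with
  | _ k ih =>
    have h1 : ∑ g with g ∈ C, chr Ψ i g =
        ∑ C' with C' ≤ C, ∑ g with Subgroup.zpowers g = C', chr Ψ i g := by
      rw [← Finset.sum_fiberwise_of_maps_to (t := Finset.univ.filter fun C' => C' ≤ C)
        (g := Subgroup.zpowers)]
      · refine Finset.sum_congr rfl fun C' hC' => Finset.sum_congr ?_ fun _ _ => rfl
        ext g
        simp only [Finset.mem_filter, Finset.mem_univ, true_and] at hC' ⊢
        refine ⟨fun h => h.2, fun h => ⟨?_, h⟩⟩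
        rw [← h] at hC'
        exact hC' (Subgroup.mem_zpowers g)
      · intro g hg
        simpa using hg
    have h2 : ∃ n : ℤ, ∑ g with g ∈ C, chr Ψ i g = n := by
      obtain ⟨k, hk⟩ := exists_nat_tr_eq Ψ (avg_mul_avg C) i
      refine ⟨Nat.card C * k, ?_⟩
      have := card_mul_tr_avg Ψ i C
      rw [hk, finsum_eq_sum_of_fintype] at this
      push_cast
      rw [this]
      exact (Finset.sum_subtype _ (by simp) _)
    have h3 : ∀ C' : Subgroup G, C' < C →
        ∃ n : ℤ, ∑ g with Subgroup.zpowers g = C', chr Ψ i g = n := by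
      intro C' hC'
      refine ih _ ?_ C' rfl
      rw [← hk]
      exact Set.ncard_lt_ncard hC'
    choose! n hn using h3
    obtain ⟨m, hm⟩ := h2
    refine ⟨m - ∑ C' with C' < C, n C', ?_⟩
    have h4 : (Finset.univ.filter fun C' => C' ≤ C) =
        insert C (Finset.univ.filter fun C' => C' < C) := by
      ext C'
      simp [le_iff_eq_or_lt]
    rw [h1, h4, Finset.sum_insert (by simp), Finset.sum_congr rfl (g := fun C' => (n C' : ℂ))
      fun C' hC' => hn C' (by simpa using hC')] at hm
    push_cast
    rw [← hm]
    ring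

open Classical in
/-- The sum of the values of a character over the elements of odd order is an integer. -/
theorem exists_int_sum_chr_odd (i : ι) :
    ∃ n : ℤ, ∑ g with Odd (orderOf g), chr Ψ i g = n := by
  choose n hn using exists_int_sum_chr_generators Ψ i
  refine ⟨∑ C ∈ Finset.univ.filter fun C : Subgroup G => Odd (Nat.card C), n C, ?_⟩
  push_cast
  rw [← Finset.sum_fiberwise_of_maps_to
    (t := Finset.univ.filter fun C : Subgroup G => Odd (Nat.card C)) (g := Subgroup.zpowers)]
  · refine Finset.sum_congr rfl fun C hC => ?_
    rw [← hn]
    refine Finset.sum_congr ?_ fun _ _ => rfl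
    ext g
    simp only [Finset.mem_filter, Finset.mem_univ, true_and] at hC ⊢
    refine ⟨fun h => h.2, fun h => ⟨?_, h⟩⟩
    rwa [← Nat.card_zpowers, h]
  · intro g hg
    simpa [Nat.card_zpowers, -Nat.card_eq_fintype_card] using hg

open Classical in
variable (G) in
/-- The sum of the elements of odd order. -/
noncomputable def oddSum : MonoidAlgebra ℂ G := ∑ g : G with Odd (orderOf g), single g 1

theorem oddSum_mem_intRing : oddSum G ∈ intRing G := sum_mem fun g _ => single_mem_intRing g

theorem commute_oddSum (b : MonoidAlgebra ℂ G) : Commute b (oddSum G) := by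
  classical
  have : oddSum G = ∑ g, single g (if Odd (orderOf g) then 1 else 0) := by
    rw [oddSum, Finset.sum_filter]
    refine Finset.sum_congr rfl fun g _ => ?_
    split_ifs <;> simp
  rw [this]
  refine commute_sum_conj_invariant (fun g h => ?_) b
  have : orderOf (h * g * h⁻¹) = orderOf g := by
    simpa using (MulEquiv.orderOf_eq (MulAut.conj h) g)
  rw [this]

theorem exists_int_apply_oddSum (hd : ∀ i, NeZero (d i)) (i : ι) :
    ∃ ω : ℤ, Ψ (oddSum G) i = (ω : ℂ) • (1 : Matrix (Fin (d i)) (Fin (d i)) ℂ) := by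
  classical
  obtain ⟨ω, hω⟩ := exists_scalar_of_central Ψ commute_oddSum i
  have hd0 : (d i : ℂ) ≠ 0 := by exact_mod_cast (hd i).out
  have h1 : IsIntegral ℤ ω := by
    have := isIntegral_apply Ψ oddSum_mem_intRing i
    rw [hω, ← Algebra.algebraMap_eq_smul_one] at this
    have : Nonempty (Fin (d i)) := ⟨⟨0, Nat.pos_of_ne_zero (hd i).out⟩⟩
    exact (isIntegral_algHom_iff
      ((Algebra.ofId ℂ (Matrix (Fin (d i)) (Fin (d i)) ℂ)).restrictScalars ℤ)
      (algebraMap ℂ (Matrix (Fin (d i)) (Fin (d i)) ℂ)).injective).1 (by assumption)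
  have h2 : ∃ q : ℚ, (q : ℂ) = ω := by
    obtain ⟨n, hn⟩ := exists_int_sum_chr_odd Ψ i
    have h3 : tr Ψ i (oddSum G) = n := by rw [← hn, oddSum, map_sum]; rfl
    rw [tr_apply, hω, Matrix.trace_smul, Matrix.trace_one, Fintype.card_fin, smul_eq_mul] at h3
    refine ⟨n / d i, ?_⟩
    push_cast
    rw [← h3, mul_div_cancel_right₀ _ hd0]
  obtain ⟨q, rfl⟩ := h2
  have h3 : IsIntegral ℤ q :=
    (isIntegral_algebraMap_iff (B := ℂ) (algebraMap ℚ ℂ).injective).1 h1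
  obtain ⟨n, rfl⟩ := IsIntegrallyClosed.isIntegral_iff.1 h3
  exact ⟨n, by simpa using hω⟩

/-- The number of elements of odd order in a finite group is odd. -/
theorem odd_card_odd_order [DecidablePred fun g : G => Odd (orderOf g)] :
    Odd (Finset.univ.filter fun g : G => Odd (orderOf g)).card := by
  classical
  set S := Finset.univ.filter fun g : G => Odd (orderOf g)
  have h1 : (1 : G) ∈ S := by simp [S]
  rw [← Finset.insert_erase h1, Finset.card_insert_of_notMem (by simp), Nat.odd_add_one,
    Nat.not_odd_iff_even, ← ZMod.natCast_eq_zero_iff_even, ← nsmul_one, ← Finset.sum_const]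
  refine Finset.sum_involution (fun g _ => g⁻¹) (fun _ _ => by decide) ?_ ?_ ?_
  · intro g hg _ h
    simp only [S, Finset.mem_erase, Finset.mem_filter, Finset.mem_univ, true_and] at hg
    have h2 : orderOf g ∣ 2 := by
      rw [orderOf_dvd_iff_pow_eq_one, pow_two]
      nth_rewrite 1 [← h]
      simp
    have h3 := (Nat.dvd_prime Nat.prime_two).1 h2
    rcases h3 with h3 | h3
    · exact hg.1 (orderOf_eq_one_iff.1 h3)
    · rw [h3] at hg
      exact absurd hg.2 (by decide)
  · intro g hg
    simpa [S] using hg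
  · intro g _
    simp

end OddSum

end GroupChar

namespace GroupChar

open MonoidAlgebra

variable {G : Type*} [Group G] {ι : Type*} {d : ι → ℕ}
  (Ψ : MonoidAlgebra ℂ G ≃ₐ[ℂ] ((i : ι) → Matrix (Fin (d i)) (Fin (d i)) ℂ))

theorem exists_principal [Finite G] (hd : ∀ i, NeZero (d i)) :
    ∃ i₀, d i₀ = 1 ∧ (∀ g, Ψ (single g 1) i₀ = 1) ∧
      ∀ i, i ≠ i₀ → Ψ (avg (⊤ : Subgroup G)) i = 0 := by
  classical
  set e := avg (⊤ : Subgroup G) with he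
  have h1 : ∀ g : G, single g 1 * e = e := fun g => single_mul_avg _ (Subgroup.mem_top g)
  have hc : ∀ b : MonoidAlgebra ℂ G, Commute b e :=
    commute_of_forall_single fun g => commute_avg _ fun _ _ => Subgroup.mem_top _
  have h2 : ∀ a : MonoidAlgebra ℂ G, ∃ c : ℂ, a * e = c • e := by
    intro a
    induction a using MonoidAlgebra.induction_linear with
    | zero => exact ⟨0, by simp⟩
    | add f g hf hg =>
      obtain ⟨c, hc⟩ := hf
      obtain ⟨c', hc'⟩ := hg
      exact ⟨c + c', by rw [add_mul, hc, hc', add_smul]⟩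
    | single g r =>
      refine ⟨r, ?_⟩
      have : (single g r : MonoidAlgebra ℂ G) = r • single g 1 := by simp
      rw [this, smul_mul_assoc, h1]
  have hne : e ≠ 0 := by
    intro h0
    have h3 : MonoidAlgebra.lift ℂ ℂ G (1 : G →* ℂ) e = 1 := by
      cases nonempty_fintype G
      have : (Nat.card (⊤ : Subgroup G) : ℂ) ≠ 0 := by exact_mod_cast Nat.card_pos.ne'
      rw [he, avg, map_smul, finsum_eq_sum_of_fintype, map_sum]
      simp only [lift_single, MonoidHom.one_apply, smul_eq_mul, mul_one, Finset.sum_const,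
        Finset.card_univ, nsmul_eq_mul]
      rw [← Nat.card_eq_fintype_card, inv_mul_cancel₀ this]
    rw [h0, map_zero] at h3
    exact zero_ne_one h3
  obtain ⟨i₀, hi₀⟩ : ∃ i₀, Ψ e i₀ ≠ 0 := by
    by_contra! hall
    exact hne (Ψ.injective (by rw [map_zero]; exact funext hall))
  obtain ⟨ω, hω⟩ := exists_scalar_of_central Ψ hc i₀
  have hω0 : ω ≠ 0 := by
    rintro rfl
    exact hi₀ (by rw [hω, zero_smul])
  have h4 : ∀ g, Ψ (single g 1) i₀ = 1 := by
    intro g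
    have := congrFun (congrArg Ψ (h1 g)) i₀
    rw [map_mul, Pi.mul_apply, hω, mul_smul_comm, mul_one] at this
    exact smul_right_injective _ hω0 this
  have h5 : ∀ a, ∃ c : ℂ, Ψ a i₀ = c • 1 := by
    intro a
    induction a using MonoidAlgebra.induction_linear with
    | zero => exact ⟨0, by simp⟩
    | add f g hf hg =>
      obtain ⟨c, hc⟩ := hf
      obtain ⟨c', hc'⟩ := hg
      exact ⟨c + c', by rw [map_add, Pi.add_apply, hc, hc', add_smul]⟩
    | single g r =>
      refine ⟨r, ?_⟩
      have : (single g r : MonoidAlgebra ℂ G) = r • single g 1 := by simp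
      rw [this, map_smul, Pi.smul_apply, h4]
  refine ⟨i₀, ?_, h4, fun i hi => ?_⟩
  · by_contra hd1
    have h6 : 1 < d i₀ := by
      have := (hd i₀).out
      omega
    obtain ⟨a, ha⟩ := Ψ.surjective
      (Pi.single i₀ (Matrix.single (⟨0, by omega⟩ : Fin (d i₀)) ⟨1, h6⟩ 1))
    obtain ⟨c, hc⟩ := h5 a
    rw [ha, Pi.single_eq_same] at hc
    have := congrFun (congrFun hc ⟨0, by omega⟩) ⟨1, h6⟩
    simp at this
  · obtain ⟨a, ha⟩ := Ψ.surjective (Pi.single i 1)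
    obtain ⟨c, hc⟩ := h2 a
    have h7 := congrArg Ψ hc
    rw [map_mul, map_smul, ha] at h7
    have h8 := congrFun h7 i₀
    rw [Pi.mul_apply, Pi.single_eq_of_ne hi.symm, zero_mul, Pi.smul_apply] at h8
    have hc0 : c = 0 := (smul_eq_zero.1 h8.symm).resolve_right hi₀
    have h9 := congrFun h7 i
    rwa [Pi.mul_apply, Pi.single_eq_same, one_mul, hc0, Pi.smul_apply, zero_smul] at h9

theorem exists_translation_coloring (g h : G) :
    ∃ c : G → Prop, ∀ v, (∀ k : ℤ, g ^ k * v * h ^ k = v → Even k) →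
      (c (g * v * h) ↔ ¬ c v) := by
  have hc : Commute (Equiv.mulRight h) (Equiv.mulLeft g) := by
    ext v
    simp [mul_assoc]
  obtain ⟨c, hc'⟩ := Equiv.Perm.exists_swapped_coloring (Equiv.mulRight h * Equiv.mulLeft g)
  refine ⟨c, fun v hv => hc' v fun k hk => hv k ?_⟩
  rw [hc.mul_zpow] at hk
  simpa using hk

theorem int_smul_mem_intRing (c : ℤ) {a : MonoidAlgebra ℂ G} (ha : a ∈ intRing G) :
    (c : ℂ) • a ∈ intRing G := by
  rw [Int.cast_smul_eq_zsmul]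
  exact zsmul_mem ha c

section Congruence

variable [Fintype G]

open Classical in
/-- Averaging over a subgroup of odd order does not change the values of the characters lying in
the blocks on which `oddSum G` acts as an odd integer. -/
theorem card_mul_chr_eq_sum {i : ι} {ω : ℤ} (hωo : Odd ω)
    (hω : Ψ (oddSum G) i = (ω : ℂ) • (1 : Matrix (Fin (d i)) (Fin (d i)) ℂ))
    (z : G) (N : Subgroup G) (hN : Odd (Nat.card N)) (hNz : ∀ n ∈ N, n * z = z * n)
    (hnorm : ∀ c, c * z = z * c → ∀ n ∈ N, c * n * c⁻¹ ∈ N)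
    (g : G) (hg : g * z = z * g) (hk : ∀ k : ℤ, Odd k → z ∈ Subgroup.zpowers (g ^ k)) :
    (Nat.card N : ℂ) * chr Ψ i g = ∑ᶠ n : N, chr Ψ i (g * n) := by
  obtain ⟨col, hcol⟩ := exists_translation_coloring g g⁻¹
  have hgz : ∀ v, g * v * g⁻¹ * z = z * (g * v * g⁻¹) ↔ v * z = z * v := by
    intro v
    have e1 : g * v * g⁻¹ * z = g * (v * z) * g⁻¹ := by
      rw [mul_assoc _ g⁻¹ z, (show Commute g z from hg).inv_left.eq]; group
    have e2 : z * (g * v * g⁻¹) = g * (z * v) * g⁻¹ := by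
      rw [← mul_assoc, ← mul_assoc, ← hg]; group
    rw [e1, e2]
    simp
  have hord : ∀ v, orderOf (g * v * g⁻¹) = orderOf v := fun v => by
    simpa using (MulEquiv.orderOf_eq (MulAut.conj g) v)
  have hcol' : ∀ v, ¬ v * z = z * v → (col (g * v * g⁻¹) ↔ ¬ col v) := by
    intro v hv
    refine hcol v fun k h => ?_
    rw [← Int.not_odd_iff_even]
    intro hko
    apply hv
    obtain ⟨l, hl⟩ := Subgroup.mem_zpowers_iff.1 (hk k hko)
    have : Commute v (g ^ k) := by
      rw [inv_zpow, mul_inv_eq_iff_eq_mul] at h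
      exact h.symm
    have := this.zpow_right l
    rw [hl] at this
    exact this
  set γ : MonoidAlgebra ℂ G := single g 1
  set σC : MonoidAlgebra ℂ G := ∑ v : G with Odd (orderOf v) ∧ v * z = z * v, single v 1
  set β : MonoidAlgebra ℂ G :=
    ∑ v : G with Odd (orderOf v) ∧ ¬ v * z = z * v ∧ col v, single v 1
  set β' : MonoidAlgebra ℂ G :=
    ∑ v : G with Odd (orderOf v) ∧ ¬ v * z = z * v ∧ ¬ col v, single v 1
  have hσ : oddSum G = σC + β + β' := by
    simp only [σC, β, β', oddSum, Finset.sum_filter, ← Finset.sum_add_distrib]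
    refine Finset.sum_congr rfl fun v _ => ?_
    by_cases h1 : Odd (orderOf v) <;> by_cases h2 : v * z = z * v <;> by_cases h3 : col v <;>
      simp [h1, h2, h3]
  have hγβ : γ * β = β' * γ := by
    simp only [γ, β, β', Finset.mul_sum, Finset.sum_mul, single_mul_single, one_mul]
    refine Finset.sum_nbij' (fun v => g * v * g⁻¹) (fun v => g⁻¹ * v * g) ?_ ?_ ?_ ?_ ?_
    · intro v hv
      simp only [Finset.mem_filter, Finset.mem_univ, true_and] at hv ⊢
      rw [hord, hgz, hcol' v hv.2.1, not_not]
      exact hv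
    · intro v hv
      obtain ⟨w, rfl⟩ : ∃ w, v = g * w * g⁻¹ := ⟨g⁻¹ * v * g, by group⟩
      have e : g⁻¹ * (g * w * g⁻¹) * g = w := by group
      simp only [Finset.mem_filter, Finset.mem_univ, true_and] at hv ⊢
      rw [hord, hgz] at hv
      rw [hcol' w hv.2.1, not_not] at hv
      rwa [e]
    · intro v _; group
    · intro v _; group
    · intro v _; simp
  set e := avg N with he
  have hee : e * e = e := avg_mul_avg N
  have hγe : Commute γ e := commute_avg N (hnorm g hg)
  have heσ : e * σC = σC := by
    refine avg_mul_of_forall N fun n hn => ?_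
    have hodd : ∀ m ∈ N, ∀ v, Odd (orderOf v) → v * z = z * v → Odd (orderOf (m * v)) := by
      intro m hm v hv hvz
      have h1 : ∀ k : ℕ, ∃ m' ∈ N, (m * v) ^ k = m' * v ^ k := by
        intro k
        induction k with
        | zero => exact ⟨1, N.one_mem, by simp⟩
        | succ k ih =>
          obtain ⟨m', hm', e⟩ := ih
          have hvk : v ^ k * z = z * v ^ k := (show Commute v z from hvz).pow_left k
          refine ⟨m' * (v ^ k * m * (v ^ k)⁻¹), N.mul_mem hm' (hnorm _ hvk m hm), ?_⟩
          rw [pow_succ, e, pow_succ]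
          group
      obtain ⟨m', hm', e⟩ := h1 (orderOf v)
      rw [pow_orderOf_eq_one, mul_one] at e
      have h2 : (m * v) ^ (orderOf v * Nat.card N) = 1 := by
        rw [pow_mul, e]
        exact congrArg Subtype.val (pow_card_eq_one' (x := (⟨m', hm'⟩ : N)))
      exact (hv.mul hN).of_dvd_nat (orderOf_dvd_of_pow_eq_one h2)
    simp only [σC, Finset.mul_sum, single_mul_single, one_mul]
    refine Finset.sum_nbij' (fun v => n * v) (fun v => n⁻¹ * v) ?_ ?_ ?_ ?_ ?_
    · intro v hv
      simp only [Finset.mem_filter, Finset.mem_univ, true_and] at hv ⊢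
      exact ⟨hodd n hn v hv.1 hv.2, (show Commute n z from hNz n hn).mul_left hv.2⟩
    · intro v hv
      simp only [Finset.mem_filter, Finset.mem_univ, true_and] at hv ⊢
      exact ⟨hodd _ (N.inv_mem hn) v hv.1 hv.2,
        (show Commute n⁻¹ z from hNz _ (N.inv_mem hn)).mul_left hv.2⟩
    · intro v _; group
    · intro v _; group
    · intro v _; rfl
  set f := 1 - e with hf
  have hff : f * f = f := by rw [hf, sub_mul, one_mul, mul_sub, hee]; simp
  have hfσ : f * σC = 0 := by rw [hf, sub_mul, heσ, one_mul, sub_self]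
  have hγf : γ * f = f * γ := by rw [hf, mul_sub, sub_mul, hγe.eq, mul_one, one_mul]
  have hσc : ∀ b, b * oddSum G = oddSum G * b := fun b => commute_oddSum b
  have hs : f * β * f + f * β' * f = oddSum G * f := by
    have : f * oddSum G * f = f * β * f + f * β' * f := by
      rw [hσ, mul_add, mul_add, hfσ, zero_add, add_mul]
    rw [← this, hσc f, mul_assoc, hff]
  have hγa : γ * (f * β * f) = f * β' * f * γ := by
    calc γ * (f * β * f) = γ * f * β * f := by simp only [mul_assoc]
      _ = f * (γ * β) * f := by rw [hγf]; simp only [mul_assoc]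
      _ = f * β' * (γ * f) := by rw [hγβ]; simp only [mul_assoc]
      _ = f * β' * f * γ := by rw [hγf]; simp only [mul_assoc]
  have hab : Commute (f * β * f) (f * β' * f) := by
    have h1 : Commute (f * β * f) (oddSum G * f) := by
      rw [Commute, SemiconjBy, ← mul_assoc, hσc, mul_assoc, mul_assoc, hff, mul_assoc (oddSum G),
        ← mul_assoc f, ← mul_assoc f, hff]
    rw [← hs] at h1
    have := h1.sub_right (Commute.refl _)
    rwa [add_sub_cancel_left] at this
  have hT := trace_mul_add_pow (tr Ψ i).toAddMonoidHom (fun u v => tr_mul_comm Ψ i u v) hγa hab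
  have hTσ : ∀ (m : ℕ) b, tr Ψ i (oddSum G ^ m * b) = ω ^ m * tr Ψ i b := by
    intro m b
    rw [tr_apply, tr_apply, map_mul, map_pow, Pi.mul_apply, Pi.pow_apply, hω, smul_pow, one_pow,
      smul_mul_assoc, one_mul, Matrix.trace_smul, smul_eq_mul]
  set c := (Nat.card N : ℤ)
  have hFmem : (c : ℂ) • f ∈ intRing G := by
    have h1 := card_smul_avg_mem_intRing N
    rw [hf, smul_sub]
    refine sub_mem (int_smul_mem_intRing c (one_mem _)) ?_
    simpa [c] using h1
  have key : tr Ψ i (γ * ((c : ℂ) • f)) = 0 := by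
    refine eq_zero_of_forall_two_pow_dvd (c := ω * c ^ 2)
      (hωo.mul (((Int.odd_coe_nat _).2 hN : Odd c).pow)) fun m => ?_
    rcases Nat.eq_zero_or_pos m with rfl | hm
    · exact ⟨_, isIntegral_tr Ψ (mul_mem (single_mem_intRing g) hFmem) i, by simp [γ]⟩
    · refine ⟨tr Ψ i ((c : ℂ) • (γ * ((c : ℂ) ^ 2 • (f * β * f)) ^ m)), ?_, ?_⟩
      · refine isIntegral_tr Ψ (int_smul_mem_intRing c (mul_mem (single_mem_intRing g)
          (pow_mem ?_ m))) i
        have : (c : ℂ) ^ 2 • (f * β * f) = (c : ℂ) • f * β * ((c : ℂ) • f) := by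
          rw [smul_mul_assoc, smul_mul_assoc, mul_smul_comm, smul_smul, pow_two]
        rw [this]
        exact mul_mem (mul_mem hFmem (sum_mem fun v _ => single_mem_intRing v)) hFmem
      · have h1 := hT m
        rw [hs, (show Commute (oddSum G) f from (hσc f).symm).mul_pow,
          (show IsIdempotentElem f from hff).pow_eq hm.ne', ← mul_assoc,
          ((commute_oddSum γ).pow_right m).eq, mul_assoc] at h1
        simp only [LinearMap.toAddMonoidHom_coe] at h1
        rw [hTσ] at h1
        rw [smul_pow, mul_smul_comm, mul_smul_comm]
        simp only [map_smul, smul_eq_mul]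
        push_cast
        linear_combination (c : ℂ) ^ (2 * m) * c * h1
  rw [hf, mul_smul_comm, mul_sub, mul_one, map_smul, map_sub, smul_eq_mul, mul_sub, sub_eq_zero]
    at key
  have := card_mul_tr_mul_avg Ψ i N g
  rw [← this]
  exact key

end Congruence

end GroupChar

namespace GroupChar

open MonoidAlgebra

variable {G : Type*} [Group G] {ι : Type*} {d : ι → ℕ}
  (Ψ : MonoidAlgebra ℂ G ≃ₐ[ℂ] ((i : ι) → Matrix (Fin (d i)) (Fin (d i)) ℂ))

/-- The endomorphisms of the group algebra that preserve the integral group ring. -/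
noncomputable def intEnd (G : Type*) [Group G] : Subring (Module.End ℂ (MonoidAlgebra ℂ G)) where
  carrier := {φ | ∀ a ∈ intRing G, φ a ∈ intRing G}
  mul_mem' hφ hψ a ha := hφ _ (hψ a ha)
  one_mem' _ ha := ha
  add_mem' hφ hψ a ha := add_mem (hφ a ha) (hψ a ha)
  zero_mem' _ _ := zero_mem _
  neg_mem' hφ a ha := neg_mem (hφ a ha)

theorem exists_int_trace_of_mem_intEnd [Fintype G] {φ : Module.End ℂ (MonoidAlgebra ℂ G)}
    (hφ : φ ∈ intEnd G) : ∃ n : ℤ, LinearMap.trace ℂ _ φ = n := by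
  classical
  have h1 : ∀ g : G, ∃ n : ℤ, (φ (single g 1)).coeff g = n := fun g =>
    coeff_mem_intRing (hφ _ (single_mem_intRing g)) g
  choose n hn using h1
  refine ⟨∑ g, n g, ?_⟩
  rw [LinearMap.trace_eq_matrix_trace ℂ (MonoidAlgebra.basis G ℂ), Matrix.trace]
  push_cast
  refine Finset.sum_congr rfl fun g _ => ?_
  rw [← hn, Matrix.diag_apply, LinearMap.toMatrix_apply]
  rfl

theorem mulLeft_mem_intEnd {a : MonoidAlgebra ℂ G} (ha : a ∈ intRing G) :
    LinearMap.mulLeft ℂ a ∈ intEnd G := fun _ hb => mul_mem ha hb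

theorem mulRight_mem_intEnd {a : MonoidAlgebra ℂ G} (ha : a ∈ intRing G) :
    LinearMap.mulRight ℂ a ∈ intEnd G := fun _ hb => mul_mem hb ha

/-- The coordinate projection of the group algebra onto the span of a subset of the group. -/
noncomputable def coordProj (c : G → Prop) [DecidablePred c] :
    Module.End ℂ (MonoidAlgebra ℂ G) :=
  (MonoidAlgebra.basis G ℂ).constr ℂ fun v => if c v then single v 1 else 0

theorem coordProj_single (c : G → Prop) [DecidablePred c] (v : G) :
    coordProj c (single v 1) = if c v then single v 1 else 0 :=
  (MonoidAlgebra.basis G ℂ).constr_basis ℂ _ v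

theorem coordProj_mem_intEnd (c : G → Prop) [DecidablePred c] : coordProj c ∈ intEnd G := by
  rintro _ ⟨b, rfl⟩
  induction b using MonoidAlgebra.induction_linear with
  | zero => simp [zero_mem]
  | add f g hf hg =>
    rw [map_add, map_add]
    exact add_mem hf hg
  | single g r =>
    have : (MonoidAlgebra.mapRingHom G (Int.castRingHom ℂ)) (single g r) =
        (r : ℂ) • single g 1 := by simp
    rw [this, map_smul, coordProj_single]
    refine int_smul_mem_intRing r ?_
    split_ifs
    · exact single_mem_intRing g
    · exact zero_mem _

theorem moduleEnd_ext {M : Type*} {φ ψ : Module.End ℂ (MonoidAlgebra ℂ M)}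
    (h : ∀ g, φ (single g 1) = ψ (single g 1)) : φ = ψ :=
  (MonoidAlgebra.basis M ℂ).ext h

variable [Fintype G] [Fintype ι]

open Classical in
/-- Block orthogonality: if no odd power of `v ↦ g v h` has a fixed point, then the characters in
the blocks on which `oddSum G` acts as an odd integer satisfy `∑ χ(g) χ(h) = 0`. -/
theorem sum_chr_mul_chr_eq_zero {ω : ι → ℤ}
    (hω : ∀ i, Ψ (oddSum G) i = (ω i : ℂ) • (1 : Matrix (Fin (d i)) (Fin (d i)) ℂ))
    (g h : G) (hgh : ∀ v (k : ℤ), g ^ k * v * h ^ k = v → Even k) :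
    ∑ i with Odd (ω i), chr Ψ i g * chr Ψ i h = 0 := by
  obtain ⟨col, hcol⟩ := exists_translation_coloring g h
  obtain ⟨q, D, hD, hq⟩ := exists_polynomial_separating_parity ω
  set e : MonoidAlgebra ℂ G := Ψ.symm fun i => if Odd (ω i) then 1 else 0 with he
  have hΨe : ∀ i, Ψ e i = if Odd (ω i) then 1 else 0 := fun i => by rw [he, Ψ.apply_symm_apply]
  have hee : e * e = e := by
    apply Ψ.injective
    ext1 i
    rw [map_mul, Pi.mul_apply, hΨe]
    split_ifs <;> simp
  have hec : ∀ b, b * e = e * b := by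
    intro b
    apply Ψ.injective
    ext1 i
    rw [map_mul, map_mul, Pi.mul_apply, Pi.mul_apply, hΨe]
    split_ifs <;> simp
  have hDe : (D : ℂ) • e ∈ intRing G := by
    have h1 : Polynomial.aeval (oddSum G) q = (D : ℂ) • e := by
      apply Ψ.injective
      ext1 i
      rw [map_smul, Pi.smul_apply, hΨe]
      have h2 := Polynomial.aeval_algHom_apply
        (((Pi.evalAlgHom ℂ (fun i => Matrix (Fin (d i)) (Fin (d i)) ℂ) i).comp
          Ψ.toAlgHom).restrictScalars ℤ) (oddSum G) q
      change Polynomial.aeval (Ψ (oddSum G) i) q = Ψ (Polynomial.aeval (oddSum G) q) i at h2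
      rw [← h2, hω, ← Algebra.algebraMap_eq_smul_one, Polynomial.aeval_algebraMap_apply]
      have h3 : Polynomial.aeval (ω i : ℂ) q = ((q.eval (ω i) : ℤ) : ℂ) := by
        have := Polynomial.aeval_algebraMap_apply ℂ (ω i) q
        simpa using this
      rw [h3]
      split_ifs with ho
      · rw [(hq i).1 ho, Algebra.algebraMap_eq_smul_one]
      · rw [(hq i).2 (Int.not_odd_iff_even.1 ho)]
        simp
    rw [← h1]
    have h4 := Polynomial.aeval_algHom_apply (intRing G).subtype.toIntAlgHom
      (⟨oddSum G, oddSum_mem_intRing⟩ : intRing G) q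
    change Polynomial.aeval (oddSum G) q = _ at h4
    rw [h4]
    exact Subtype.property _
  set γ : Module.End ℂ (MonoidAlgebra ℂ G) :=
    LinearMap.mulLeft ℂ (single g 1) * LinearMap.mulRight ℂ (single h 1) with hγ
  set E : Module.End ℂ (MonoidAlgebra ℂ G) := LinearMap.mulLeft ℂ e with hE
  set P : Module.End ℂ (MonoidAlgebra ℂ G) := coordProj col with hP
  have hγv : ∀ v : G, γ (single v 1) = single (g * v * h) 1 := by
    intro v
    simp [hγ, single_mul_single, mul_assoc]
  have hγP : γ * P = (1 - P) * γ := by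
    refine moduleEnd_ext fun v => ?_
    change γ (P (single v 1)) = γ (single v 1) - P (γ (single v 1))
    rw [hγv, hP, coordProj_single, coordProj_single]
    have := hcol v (hgh v)
    by_cases hv : col v
    · simp [hv, this, hγv]
    · simp [hv, this]
  have hEE : E * E = E := by
    refine LinearMap.ext fun v => ?_
    simp only [hE, Module.End.mul_apply, LinearMap.mulLeft_apply]
    rw [← mul_assoc, hee]
  have hγE : γ * E = E * γ := by
    refine LinearMap.ext fun v => ?_
    simp only [hE, hγ, Module.End.mul_apply, LinearMap.mulLeft_apply, LinearMap.mulRight_apply]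
    rw [← mul_assoc (single g 1), ← mul_assoc (single g 1), ← mul_assoc, hec, mul_assoc,
      mul_assoc]
  have hsum : E * P * E + E * (1 - P) * E = E := by
    rw [← add_mul, ← mul_add, add_sub_cancel, mul_one, hEE]
  have hγa : γ * (E * P * E) = E * (1 - P) * E * γ := by
    calc γ * (E * P * E) = γ * E * P * E := by simp only [mul_assoc]
      _ = E * (γ * P) * E := by rw [hγE]; simp only [mul_assoc]
      _ = E * (1 - P) * (γ * E) := by rw [hγP]; simp only [mul_assoc]
      _ = E * (1 - P) * E * γ := by rw [hγE]; simp only [mul_assoc]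
  have hab : Commute (E * P * E) (E * (1 - P) * E) := by
    have h1 : Commute (E * P * E) E := by
      rw [Commute, SemiconjBy, mul_assoc, hEE, ← mul_assoc, ← mul_assoc, hEE]
    have h2 : Commute (E * P * E) (E * P * E + E * (1 - P) * E) := by rwa [hsum]
    have := h2.sub_right (Commute.refl _)
    rwa [add_sub_cancel_left] at this
  have hT := trace_mul_add_pow (LinearMap.trace ℂ (MonoidAlgebra ℂ G)).toAddMonoidHom
    (fun u v => LinearMap.trace_mul_comm ℂ u v) hγa hab
  have hTγ : LinearMap.trace ℂ _ (γ * E) = ∑ i with Odd (ω i), chr Ψ i g * chr Ψ i h := by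
    have h1 : γ * E = LinearMap.mulLeft ℂ (single g 1 * e) ∘ₗ LinearMap.mulRight ℂ (single h 1) := by
      refine LinearMap.ext fun v => ?_
      simp only [hE, hγ, Module.End.mul_apply, LinearMap.mulLeft_apply, LinearMap.mulRight_apply,
        LinearMap.comp_apply, mul_assoc]
    rw [h1, trace_mulLeft_mulRight Ψ, Finset.sum_filter]
    refine Finset.sum_congr rfl fun i _ => ?_
    rw [tr_apply, map_mul, Pi.mul_apply, hΨe]
    split_ifs
    · rw [mul_one]; rfl
    · simp
  rw [← hTγ]
  refine eq_zero_of_forall_two_pow_dvd (c := D ^ 2) hD.pow fun m => ?_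
  rcases Nat.eq_zero_or_pos m with rfl | hm
  · refine ⟨_, ?_, by simp only [pow_zero, one_mul]; rfl⟩
    rw [hTγ]
    exact IsIntegral.sum _ fun i _ => (isIntegral_tr Ψ (single_mem_intRing g) i).mul
      (isIntegral_tr Ψ (single_mem_intRing h) i)
  · have hDE : (D : ℂ) • E ∈ intEnd G := by
      have : (D : ℂ) • E = LinearMap.mulLeft ℂ ((D : ℂ) • e) := by
        refine LinearMap.ext fun v => ?_
        simp [hE]
      rw [this]
      exact mulLeft_mem_intEnd hDe
    have h1 : (D : ℂ) ^ 2 • (E * P * E) ∈ intEnd G := by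
      have : (D : ℂ) ^ 2 • (E * P * E) = (D : ℂ) • E * P * ((D : ℂ) • E) := by
        rw [smul_mul_assoc, smul_mul_assoc, mul_smul_comm, smul_smul, pow_two]
      rw [this]
      exact mul_mem (mul_mem hDE (coordProj_mem_intEnd col)) hDE
    obtain ⟨n, hn⟩ := exists_int_trace_of_mem_intEnd
      (mul_mem (mul_mem (mulLeft_mem_intEnd (single_mem_intRing g))
        (mulRight_mem_intEnd (single_mem_intRing h))) (pow_mem h1 m))
    refine ⟨n, isIntegral_algebraMap (A := ℂ) (x := n), ?_⟩
    rw [← hn, smul_pow, mul_smul_comm, map_smul]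
    have h2 := hT m
    rw [hsum, (show IsIdempotentElem E from hEE).pow_eq hm.ne'] at h2
    simp only [LinearMap.toAddMonoidHom_coe] at h2
    rw [smul_eq_mul, h2]
    push_cast
    ring

/-- The character-theoretic data of a finite group, restricted to a set of irreducible characters
containing the principal one and closed under `2`-block linkage. -/
structure CharTable (G : Type*) [Group G] [Fintype G] where
  /-- The irreducible characters. -/
  ι : Type
  /-- The chosen set of characters. -/
  B : Finset ι
  /-- The character degrees. -/
  d : ι → ℕ
  /-- The characters, extended linearly to the group algebra. -/
  T : ι → MonoidAlgebra ℂ G →ₗ[ℂ] ℂ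
  /-- The principal character. -/
  i₀ : ι
  d_pos : ∀ i, 0 < d i
  T_mul_comm : ∀ i a b, T i (a * b) = T i (b * a)
  T_one : ∀ i, T i 1 = d i
  T_idem : ∀ i a, a * a = a → ∃ k : ℕ, T i a = k
  sum_conj : ∀ i x y, d i * ∑ h, T i (single (h * x * h⁻¹ * y) 1) =
    Fintype.card G * (T i (single x 1) * T i (single y 1))
  T_principal : ∀ g, T i₀ (single g 1) = 1
  sum_eq_zero : ∀ i, i ≠ i₀ → ∑ h, T i (single h 1) = 0
  eq_principal : ∀ i x, x * x = 1 → Subgroup.normalClosure {x} = ⊤ →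
    T i (single x 1) = d i → i = i₀
  principal_mem : i₀ ∈ B
  card_mul_eq_sum : ∀ i ∈ B, ∀ (z : G) (N : Subgroup G), Odd (Nat.card N) →
    (∀ n ∈ N, n * z = z * n) → (∀ c, c * z = z * c → ∀ n ∈ N, c * n * c⁻¹ ∈ N) →
    ∀ g, g * z = z * g → (∀ k : ℤ, Odd k → z ∈ Subgroup.zpowers (g ^ k)) →
    (Nat.card N : ℂ) * T i (single g 1) = ∑ᶠ n : N, T i (single (g * n) 1)
  sum_mul_eq_zero : ∀ g h : G, (∀ v (k : ℤ), g ^ k * v * h ^ k = v → Even k) →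
    ∑ i ∈ B, T i (single g 1) * T i (single h 1) = 0

theorem nonempty_charTable (G : Type*) [Group G] [Fintype G] : Nonempty (CharTable G) := by
  classical
  obtain ⟨n, d, hd, ⟨Ψ⟩⟩ :=
    IsSemisimpleRing.exists_algEquiv_pi_matrix_of_isAlgClosed ℂ (MonoidAlgebra ℂ G)
  obtain ⟨i₀, hd₀, h1, h0⟩ := exists_principal Ψ hd
  choose ω hω using exists_int_apply_oddSum Ψ hd
  refine ⟨⟨Fin n, Finset.univ.filter fun i => Odd (ω i), d, tr Ψ, i₀,
    fun i => Nat.pos_of_ne_zero (hd i).out, tr_mul_comm Ψ, tr_one Ψ,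
    fun i a ha => exists_nat_tr_eq Ψ ha i, sum_chr_conj_mul Ψ, fun g => ?_, fun i hi => ?_,
    fun i x hx hcl hxi => ?_, ?_, fun i hi => ?_, sum_chr_mul_chr_eq_zero Ψ hω⟩⟩
  · rw [tr_apply, h1, Matrix.trace_one, Fintype.card_fin, hd₀, Nat.cast_one]
  · have h2 : tr Ψ i (avg (⊤ : Subgroup G)) = 0 := by
      rw [tr_apply, h0 i hi, Matrix.trace_zero]
    have h3 := card_mul_tr_avg Ψ i (⊤ : Subgroup G)
    rw [h2, mul_zero, finsum_eq_sum_of_fintype] at h3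
    rw [h3]
    exact (Fintype.sum_equiv Subgroup.topEquiv.toEquiv _ _ fun _ => rfl).symm
  · by_contra hne
    set p : MonoidAlgebra ℂ G := (2 : ℂ)⁻¹ • (1 - single x 1) with hp
    have hxx : (single x 1 : MonoidAlgebra ℂ G) * single x 1 = 1 := by
      rw [single_mul_single, hx, one_mul]; rfl
    have hpp : p * p = p := by
      rw [hp, smul_mul_assoc, mul_smul_comm,
        show (1 - single x 1 : MonoidAlgebra ℂ G) * (1 - single x 1) =
          (2 : ℂ) • (1 - single x 1) by
            rw [sub_mul, one_mul, mul_sub, mul_one, hxx, two_smul]; abel, smul_smul, smul_smul]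
      norm_num
    have htr : tr Ψ i p = 0 := by
      rw [hp, map_smul, map_sub, tr_one, hxi, sub_self, smul_zero]
    have h2 := apply_eq_zero_of_tr_eq_zero Ψ hpp htr
    have h3 : Ψ (single x 1) i = 1 := by
      rw [hp, map_smul, map_sub, map_one, Pi.smul_apply] at h2
      have := (smul_eq_zero.1 h2).resolve_left (by norm_num : (2 : ℂ)⁻¹ ≠ 0)
      rw [Pi.sub_apply, Pi.one_apply] at this
      exact (sub_eq_zero.1 this).symm
    let K : Subgroup G := ((((Pi.evalAlgHom ℂ (fun i => Matrix (Fin (d i)) (Fin (d i)) ℂ) i).comp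
      Ψ.toAlgHom) : MonoidAlgebra ℂ G →*
      Matrix (Fin (d i)) (Fin (d i)) ℂ).comp (MonoidAlgebra.of ℂ G)).ker
    have hK : K = ⊤ := by
      rw [← top_le_iff, ← hcl]
      exact Subgroup.normalClosure_le_normal (Set.singleton_subset_iff.2 h3)
    have h4 : ∀ g, Ψ (single g 1) i = 1 := by
      intro g
      have : g ∈ K := hK ▸ Subgroup.mem_top g
      exact this
    have h5 : ∀ g, tr Ψ i (single g 1) = d i := by
      intro g
      rw [tr_apply, h4, Matrix.trace_one, Fintype.card_fin]
    have h6 := card_mul_tr_avg Ψ i (⊤ : Subgroup G)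
    rw [tr_apply, h0 i hne, Matrix.trace_zero, mul_zero, finsum_eq_sum_of_fintype] at h6
    simp only [chr, h5, Finset.sum_const, nsmul_eq_mul] at h6
    have := (hd i).out
    simp [this] at h6
  · rw [Finset.mem_filter]
    refine ⟨Finset.mem_univ _, ?_⟩
    have h2 : tr Ψ i₀ (oddSum G) = (Finset.univ.filter fun g : G => Odd (orderOf g)).card := by
      rw [oddSum, map_sum, Finset.sum_congr rfl (g := fun _ => (1 : ℂ))]
      · simp
      · intro g _
        rw [tr_apply, h1, Matrix.trace_one, Fintype.card_fin, hd₀, Nat.cast_one]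
    rw [tr_apply, hω, Matrix.trace_smul, Matrix.trace_one, Fintype.card_fin, hd₀, Nat.cast_one,
      smul_eq_mul, mul_one] at h2
    have h3 : ω i₀ = ((Finset.univ.filter fun g : G => Odd (orderOf g)).card : ℤ) := by
      exact_mod_cast h2
    rw [h3, Int.odd_coe_nat]
    exact odd_card_odd_order
  · exact fun z N hN hNz hnorm g hg hk =>
      card_mul_chr_eq_sum Ψ (Finset.mem_filter.1 hi).2 (hω i) z N hN hNz hnorm g hg hk

end GroupChar

/-- If `E` is conjugation invariant and a subset `Θ` of `E ∩ P` is not all of `E ∩ P`, where `P` is a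
`2`-subgroup, then some element of `E ∩ P` outside `Θ` normalizes the subgroup generated by `Θ`. -/
theorem exists_conj_mem_normalizer_not_mem {G : Type*} [Group G] [Finite G] (E : Set G)
    (hE : ∀ g x : G, x ∈ E → g * x * g⁻¹ ∈ E) (P : Subgroup G) (hP : IsPGroup 2 P)
    (Θ : Set G) (hΘ : Θ ⊆ E ∩ P)
    (hne : ∃ x ∈ E, x ∈ P ∧ x ∉ Θ) :
    ∃ x ∈ E, x ∈ P ∧ x ∈ Subgroup.normalizer (Subgroup.closure Θ : Set G) ∧ x ∉ Θ := by
  by_contra! hcon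
  set D := Subgroup.closure Θ with hDdef
  have hDP : D ≤ P := (Subgroup.closure_le _).2 fun x hx => (hΘ hx).2
  have : Group.IsNilpotent P := hP.isNilpotent
  set M : Subgroup P := (Subgroup.normalizer (D : Set G)).subgroupOf P with hM
  have hMtop : M = ⊤ := by
    by_contra hMt
    have hlt := Group.normalizerCondition_of_isNilpotent M (lt_top_iff_ne_top.2 hMt)
    obtain ⟨g, hg, hgM⟩ := SetLike.exists_of_lt hlt
    apply hgM
    have key : ∀ g : P, g ∈ Subgroup.normalizer (M : Set P) → ∀ d ∈ Θ,
        (g : G) * d * (g : G)⁻¹ ∈ Θ := by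
      intro g hg d hd
      have hdM : (⟨d, (hΘ hd).2⟩ : P) ∈ M := by
        rw [hM, Subgroup.mem_subgroupOf]
        exact Subgroup.le_normalizer (Subgroup.subset_closure hd)
      have h1 := (Subgroup.mem_normalizer_iff.1 hg _).1 hdM
      rw [hM, Subgroup.mem_subgroupOf] at h1
      have h2 := hcon ((g : G) * d * (g : G)⁻¹) (hE _ _ (hΘ hd).1)
        (P.mul_mem (P.mul_mem g.2 (hΘ hd).2) (P.inv_mem g.2)) h1
      exact h2
    have key2 : ∀ g : P, g ∈ Subgroup.normalizer (M : Set P) → ∀ d ∈ D,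
        (g : G) * d * (g : G)⁻¹ ∈ D := by
      intro g hg d hd
      have : D ≤ D.comap (MulAut.conj (g : G)).toMonoidHom := by
        rw [hDdef, Subgroup.closure_le]
        intro y hy
        exact Subgroup.subset_closure (key g hg y hy)
      exact this hd
    rw [hM, Subgroup.mem_subgroupOf, Subgroup.mem_normalizer_iff]
    intro h
    refine ⟨key2 g hg h, fun hh => ?_⟩
    have := key2 g⁻¹ (inv_mem hg) _ hh
    simpa [mul_assoc] using this
  obtain ⟨x, hxE, hxP, hx⟩ := hne
  refine hx (hcon x hxE hxP ?_)
  have : (⟨x, hxP⟩ : P) ∈ M := hMtop ▸ Subgroup.mem_top _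
  exact this

/-- Two elements of square one with a product of `2`-power order lie in a common `2`-subgroup. -/
theorem isPGroup_closure_pair {G : Type*} [Group G] (x y : G) (hx : x * x = 1)
    (hy : y * y = 1) (n : ℕ) (hxy : (x * y) ^ 2 ^ n = 1) :
    IsPGroup 2 (Subgroup.closure {x, y} : Subgroup G) := by
  have hpz : ∀ (z : G) (n : ℕ), z ^ 2 ^ n = 1 → IsPGroup 2 (Subgroup.zpowers z) := by
    intro z n hz
    rintro ⟨_, k, rfl⟩
    refine ⟨n, Subtype.ext ?_⟩
    simp only [SubmonoidClass.coe_pow, OneMemClass.coe_one]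
    rw [← zpow_natCast, zpow_comm, zpow_natCast, hz, one_zpow]
  have hxi : x⁻¹ = x := inv_eq_of_mul_eq_one_left hx
  have hyi : y⁻¹ = y := inv_eq_of_mul_eq_one_left hy
  have hnorm : Subgroup.zpowers x ≤ Subgroup.normalizer (Subgroup.zpowers (x * y) : Set G) := by
    rw [Subgroup.zpowers_le]
    have hc : ∀ h ∈ Subgroup.zpowers (x * y), x * h * x⁻¹ ∈ Subgroup.zpowers (x * y) := by
      rintro _ ⟨k, rfl⟩
      refine ⟨-k, ?_⟩
      have : x * (x * y) * x⁻¹ = (x * y)⁻¹ := by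
        rw [mul_inv_rev, hxi, hyi, ← mul_assoc, hx, one_mul]
      simp only
      rw [← conj_zpow, this, inv_zpow, zpow_neg]
    rw [Subgroup.mem_normalizer_iff]
    intro h
    refine ⟨hc h, fun hh => ?_⟩
    have := hc _ hh
    rw [hxi] at this
    have e : x * (x * h * x) * x = h := by
      rw [show x * (x * h * x) * x = (x * x) * h * (x * x) by group, hx]; simp
    rwa [e] at this
  have := (hpz x 1 (by rw [pow_one, pow_two, hx])).to_sup_of_normal_right' (hpz _ n hxy) hnorm
  refine this.to_le ?_
  rw [Subgroup.closure_le]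
  rintro z (rfl | rfl)
  · exact (le_sup_left : Subgroup.zpowers z ≤ _) (Subgroup.mem_zpowers z)
  · have h1 := (le_sup_left : Subgroup.zpowers x ≤ Subgroup.zpowers x ⊔ Subgroup.zpowers (x * z))
      (Subgroup.mem_zpowers x)
    have h2 := (le_sup_right : _ ≤ Subgroup.zpowers x ⊔ Subgroup.zpowers (x * z))
      (Subgroup.mem_zpowers (x * z))
    have := mul_mem h1 h2
    rwa [← mul_assoc, hx, one_mul] at this

/-- **Baer–Suzuki theorem for involutions.** -/
theorem exists_normal_two_subgroup_of_conj {G : Type*} [Group G] [Finite G] (t : G)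
    (ht : t * t = 1) (h : ∀ g : G, ∃ n : ℕ, (t * (g * t * g⁻¹)) ^ 2 ^ n = 1) :
    ∃ N : Subgroup G, N.Normal ∧ IsPGroup 2 N ∧ t ∈ N := by
  set E : Set G := {x | ∃ g, x = g * t * g⁻¹} with hEdef
  have hE : ∀ g x : G, x ∈ E → g * x * g⁻¹ ∈ E := by
    rintro g _ ⟨a, rfl⟩
    exact ⟨g * a, by group⟩
  have hEE : ∀ x ∈ E, ∀ y ∈ E, ∃ n : ℕ, (x * y) ^ 2 ^ n = 1 := by
    rintro _ ⟨a, rfl⟩ _ ⟨b, rfl⟩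
    obtain ⟨n, hn⟩ := h (a⁻¹ * b)
    refine ⟨n, ?_⟩
    have : a * t * a⁻¹ * (b * t * b⁻¹) = a * (t * (a⁻¹ * b * t * (a⁻¹ * b)⁻¹)) * a⁻¹ := by group
    rw [this, conj_pow, hn]; simp
  have hE2 : ∀ x ∈ E, x * x = 1 := by
    rintro _ ⟨a, rfl⟩
    rw [show a * t * a⁻¹ * (a * t * a⁻¹) = a * (t * t) * a⁻¹ by group, ht]; simp
  have key : ∀ m : ℕ, ∀ P Q : Sylow 2 G, Nat.card G - (E ∩ P ∩ Q).ncard = m →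
      E ∩ P = E ∩ Q := by
    intro m
    induction m using Nat.strong_induction_on with
    | _ m ih =>
    intro P Q hm
    by_contra hPQ
    set Θ := E ∩ P ∩ Q with hΘ
    have hle : ∀ P' : Sylow 2 G, Θ ⊆ P' → Subgroup.closure Θ ≤ P' := fun P' hh =>
      (Subgroup.closure_le _).2 hh
    have hΘP : Θ ⊆ E ∩ P := fun x hx => hx.1
    have hΘQ : Θ ⊆ E ∩ Q := fun x hx => ⟨hx.1.1, hx.2⟩
    have hcard : (E ∩ P).ncard = (E ∩ Q).ncard := by
      obtain ⟨g, rfl⟩ := MulAction.exists_smul_eq G P Q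
      refine Set.ncard_congr (fun a _ => g * a * g⁻¹) ?_ ?_ ?_
      · rintro a ⟨ha, haP⟩
        refine ⟨hE _ _ ha, ?_⟩
        exact ⟨a, haP, rfl⟩
      · intro a b _ _ hab
        simpa using hab
      · rintro b ⟨hb, a, haP, rfl⟩
        refine ⟨a, ⟨?_, haP⟩, rfl⟩
        have := hE g⁻¹ _ hb
        simpa [mul_assoc] using this
    have hneP : ∃ x ∈ E, x ∈ (P : Subgroup G) ∧ x ∉ Θ := by
      by_contra! hc
      refine hPQ (Set.eq_of_subset_of_ncard_le (fun x hx => ⟨hx.1, (hc x hx.1 hx.2).2⟩)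
        hcard.ge)
    have hneQ : ∃ x ∈ E, x ∈ (Q : Subgroup G) ∧ x ∉ Θ := by
      by_contra! hc
      refine Ne.symm hPQ (Set.eq_of_subset_of_ncard_le (fun x hx => ?_) hcard.le)
      exact ⟨hx.1, (hc x hx.1 hx.2).1.2⟩
    obtain ⟨x, hxE, hxP, hxN, hxΘ⟩ :=
      exists_conj_mem_normalizer_not_mem E hE P P.isPGroup' Θ hΘP hneP
    obtain ⟨y, hyE, hyQ, hyN, hyΘ⟩ :=
      exists_conj_mem_normalizer_not_mem E hE Q Q.isPGroup' Θ hΘQ hneQ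
    obtain ⟨n, hn⟩ := hEE x hxE y hyE
    have hS := isPGroup_closure_pair x y (hE2 x hxE) (hE2 y hyE) n hn
    have hDp : IsPGroup 2 (Subgroup.closure Θ) := P.isPGroup'.to_le (hle P fun y hy => (hΘP hy).2)
    have hR := hS.to_sup_of_normal_right' hDp (by
      rw [Subgroup.closure_le]
      rintro z (rfl | rfl)
      · exact hxN
      · exact hyN)
    obtain ⟨R, hRle⟩ := hR.exists_le_sylow
    have hxR : x ∈ (R : Subgroup G) :=
      hRle ((le_sup_left : _ ≤ Subgroup.closure {x, y} ⊔ _) (Subgroup.subset_closure (by simp)))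
    have hyR : y ∈ (R : Subgroup G) :=
      hRle ((le_sup_left : _ ≤ Subgroup.closure {x, y} ⊔ _) (Subgroup.subset_closure (by simp)))
    have hΘR : Θ ⊆ R := fun z hz =>
      hRle ((le_sup_right : _ ≤ _ ⊔ Subgroup.closure Θ) (Subgroup.subset_closure hz))
    have hlt : ∀ (A : Set G) (z : G), Θ ⊆ A → z ∈ A → z ∉ Θ → Nat.card G - A.ncard < m := by
      intro A z hA hz hzΘ
      have h1 : Θ.ncard < A.ncard :=
        Set.ncard_lt_ncard (ssubset_of_subset_of_ne hA fun hh => hzΘ (hh ▸ hz))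
      have h2 : A.ncard ≤ Nat.card G := Set.ncard_le_card A
      omega
    have e1 := ih _ (hlt (E ∩ P ∩ R) x (fun z hz => ⟨hz.1, hΘR hz⟩) ⟨⟨hxE, hxP⟩, hxR⟩ hxΘ) P R rfl
    have e2 := ih _ (hlt (E ∩ Q ∩ R) y (fun z hz => ⟨⟨hz.1.1, hz.2⟩, hΘR hz⟩)
      ⟨⟨hyE, hyQ⟩, hyR⟩ hyΘ) Q R rfl
    exact hPQ (e1.trans e2.symm)
  have htp : IsPGroup 2 (Subgroup.closure {t, t}) :=
    isPGroup_closure_pair t t ht ht 0 (by simp [ht])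
  obtain ⟨P, hP⟩ := htp.exists_le_sylow
  have htP : t ∈ (P : Subgroup G) := hP (Subgroup.subset_closure (by simp))
  refine ⟨Subgroup.normalClosure {t}, inferInstance, P.isPGroup'.to_le ?_,
    Subgroup.subset_normalClosure rfl⟩
  rw [Subgroup.normalClosure, Subgroup.closure_le]
  intro x hx
  rw [Group.mem_conjugatesOfSet_iff] at hx
  obtain ⟨t', rfl, hx⟩ := hx
  obtain ⟨g, rfl⟩ := isConj_iff.1 hx
  have hmem : g * t' * g⁻¹ ∈ E ∩ (g • P : Sylow 2 G) := ⟨⟨g, rfl⟩, ⟨t', htP, rfl⟩⟩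
  rw [key _ (g • P) P rfl] at hmem
  exact hmem.2

theorem exists_two_part_odd_part {G : Type*} [Group G] [Finite G] (g : G) :
    ∃ i j : ℕ, g ^ i * g ^ j = g ∧ (∃ n : ℕ, (g ^ i) ^ 2 ^ n = 1) ∧ Odd (orderOf (g ^ j)) := by
  obtain ⟨n, m, hm, hnm⟩ := Nat.exists_eq_two_pow_mul_odd (orderOf_pos g).ne'
  have hcop : (2 ^ n).Coprime m := (Nat.coprime_two_left.2 hm).pow_left n
  obtain ⟨i, hi1, hi2⟩ := Nat.chineseRemainder hcop 1 0
  obtain ⟨j, hj1, hj2⟩ := Nat.chineseRemainder hcop 0 1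
  refine ⟨i, j, ?_, ⟨n, ?_⟩, ?_⟩
  · rw [← pow_add]
    conv_rhs => rw [← pow_one g]
    rw [pow_inj_mod, hnm]
    exact (Nat.modEq_and_modEq_iff_modEq_mul hcop).1 ⟨hi1.add hj1, by simpa using hi2.add hj2⟩
  · rw [← pow_mul, ← orderOf_dvd_iff_pow_eq_one, hnm, mul_comm]
    exact mul_dvd_mul_right ((Nat.modEq_zero_iff_dvd).1 hi2) _
  · refine hm.of_dvd_nat ?_
    rw [orderOf_dvd_iff_pow_eq_one, ← pow_mul, ← orderOf_dvd_iff_pow_eq_one, hnm]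
    exact mul_dvd_mul_right ((Nat.modEq_zero_iff_dvd).1 hj1) _

theorem mem_of_odd_index {G : Type*} [Group G] [Finite G] (M : Subgroup G) [M.Normal]
    (hM : Odd M.index) (a : G) (n : ℕ) (ha : a ^ 2 ^ n = 1) : a ∈ M := by
  rw [← QuotientGroup.eq_one_iff]
  have h1 : orderOf (a : G ⧸ M) ∣ 2 ^ n := by
    rw [orderOf_dvd_iff_pow_eq_one, ← QuotientGroup.mk_pow, ha, QuotientGroup.mk_one]
  have h2 : orderOf (a : G ⧸ M) ∣ M.index := by
    rw [Subgroup.index_eq_card]; exact orderOf_dvd_natCard _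
  have h3 : (2 ^ n).Coprime M.index := (Nat.coprime_two_left.2 hM).pow_left n
  exact orderOf_eq_one_iff.1 (Nat.eq_one_of_dvd_coprimes h3 h1 h2)

/-- If `closure S` is generated by elements of order prime to `p` and has a central subgroup of
index prime to `p`, then it has order prime to `p`. -/
theorem not_dvd_card_closure {G : Type*} [Group G] [Finite G] {p : ℕ} (hp : p.Prime) (S : Set G)
    (C : Subgroup G) (hC : ∀ c ∈ C, ∀ s ∈ S, c * s = s * c)
    (hidx : ¬ p ∣ C.relIndex (Subgroup.closure S)) (hS : ∀ s ∈ S, ¬ p ∣ orderOf s) :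
    ¬ p ∣ Nat.card (Subgroup.closure S) := by
  set M := Subgroup.closure S with hM
  have hcent : C.subgroupOf M ≤ Subgroup.center M := by
    rintro ⟨c, hcM⟩ hc
    rw [Subgroup.mem_subgroupOf] at hc
    rw [Subgroup.mem_center_iff]
    rintro ⟨m, hm⟩
    refine Subtype.ext ?_
    change m * c = c * m
    have : M ≤ Subgroup.centralizer {c} := by
      rw [hM, Subgroup.closure_le]
      intro s hs
      rw [SetLike.mem_coe, Subgroup.mem_centralizer_singleton_iff]
      exact (hC c hc s hs).symm
    exact Subgroup.mem_centralizer_singleton_iff.1 (this hm)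
  have h1 : ¬ p ∣ (Subgroup.center M).index := fun h =>
    hidx (h.trans (Subgroup.index_dvd_of_le hcent))
  have h2 : ¬ p ∣ Nat.card (commutator M) := fun h =>
    h1 (hp.dvd_of_dvd_pow (h.trans (Subgroup.card_commutator_dvd_index_center_pow M)))
  have h3 : ¬ p ∣ Nat.card (M ⧸ commutator M) := by
    intro h
    have : Fact p.Prime := ⟨hp⟩
    obtain ⟨x, hx⟩ := exists_prime_orderOf_dvd_card' (G := Abelianization M) p h
    have hall : ∀ m (hm : m ∈ M), ¬ p ∣ orderOf (Abelianization.of (⟨m, hm⟩ : M)) := by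
      intro m hm
      induction hm using Subgroup.closure_induction with
      | mem s hs =>
        intro hd
        refine hS s hs (hd.trans ((orderOf_map_dvd _ _).trans ?_))
        rw [Subgroup.orderOf_mk]
      | one =>
        have : (⟨1, one_mem _⟩ : M) = 1 := rfl
        rw [this, map_one, orderOf_one]
        exact hp.one_lt.not_ge ∘ Nat.le_of_dvd one_pos
      | mul a b ha hb iha ihb =>
        have : (⟨a * b, mul_mem ha hb⟩ : M) = ⟨a, ha⟩ * ⟨b, hb⟩ := rfl
        rw [this, map_mul]
        intro hd
        rcases (hp.dvd_mul).1 (hd.trans (Commute.orderOf_mul_dvd_mul_orderOf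
          (Commute.all (Abelianization.of (⟨a, ha⟩ : M)) (Abelianization.of ⟨b, hb⟩)))) with h | h
        · exact iha h
        · exact ihb h
      | inv a ha iha =>
        have : (⟨a⁻¹, inv_mem ha⟩ : M) = ⟨a, ha⟩⁻¹ := rfl
        rwa [this, map_inv, orderOf_inv]
    obtain ⟨⟨m, hm⟩, rfl⟩ := QuotientGroup.mk_surjective x
    exact hall m hm (dvd_of_eq hx.symm)
  intro h
  rw [Subgroup.card_eq_card_quotient_mul_card_subgroup (commutator M)] at h
  rcases hp.dvd_mul.1 h with h | h
  · exact h3 h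
  · exact h2 h

theorem odd_card_oddCore (G : Type*) [Group G] [Finite G] :
    (oddCore G).Normal ∧ Odd (Nat.card (oddCore G)) := by
  have := Fintype.ofFinite {N : Subgroup G // N.Normal ∧ Odd (Nat.card N)}
  rw [oddCore, ← Finset.sup_univ_eq_iSup]
  refine Finset.sup_induction (p := fun N : Subgroup G => N.Normal ∧ Odd (Nat.card N))
    ⟨inferInstance, by simp⟩ ?_ (fun N _ => N.2)
  rintro M ⟨hM, hM2⟩ N ⟨hN, hN2⟩
  refine ⟨inferInstance, ?_⟩
  have := Subgroup.card_mul_index (N.subgroupOf (M ⊔ N))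
  refine (hM2.mul hN2).of_dvd_nat ?_
  have h1 : N.relIndex (M ⊔ N) = N.relIndex M := Subgroup.relIndex_sup_right ..
  have h2 : Nat.card N * N.relIndex (M ⊔ N) = Nat.card (M ⊔ N : Subgroup G) :=
    by simpa using Subgroup.relIndex_mul_relIndex ⊥ N (M ⊔ N) bot_le le_sup_right
  rw [← h2, h1, mul_comm]
  exact mul_dvd_mul_right (Subgroup.relIndex_dvd_card _ _) _

theorem le_oddCore {G : Type*} [Group G] (N : Subgroup G) (hN : N.Normal)
    (h : Odd (Nat.card N)) : N ≤ oddCore G :=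
  le_iSup (fun N : {N : Subgroup G // N.Normal ∧ Odd (Nat.card N)} => (N : Subgroup G)) ⟨N, hN, h⟩

theorem oddResidual_le {G : Type*} [Group G] (N : Subgroup G) (hN : N.Normal)
    (h : Odd N.index) : oddResidual G ≤ N :=
  iInf_le (fun N : {N : Subgroup G // N.Normal ∧ Odd N.index} => (N : Subgroup G)) ⟨N, hN, h⟩

instance normal_oddResidual (G : Type*) [Group G] : (oddResidual G).Normal :=
  Subgroup.normal_iInf_normal fun N => N.2.1

section Involutions

variable {G : Type*} [Group G]

theorem mul_pow_mul_eq_inv_pow {a b : G} (ha : a * a = 1) (hb : b * b = 1) (k : ℤ) :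
    a * (a * b) ^ k * a = (a * b) ^ (-k) := by
  have ha' : a⁻¹ = a := inv_eq_of_mul_eq_one_right ha
  have hb' : b⁻¹ = b := inv_eq_of_mul_eq_one_right hb
  have h1 : a * (a * b) * a⁻¹ = (a * b)⁻¹ := by
    rw [mul_inv_rev, ha', hb', ← mul_assoc, ha, one_mul]
  calc a * (a * b) ^ k * a = a * (a * b) ^ k * a⁻¹ := by rw [ha']
    _ = (a * (a * b) * a⁻¹) ^ k := by rw [conj_zpow]
    _ = (a * b) ^ (-k) := by rw [h1, inv_zpow, zpow_neg]

theorem zpow_conj_eq {a b : G} (ha : a * a = 1) (hb : b * b = 1) (k : ℤ) :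
    (a * b) ^ k * b * ((a * b) ^ k)⁻¹ = a * (a * b) ^ (1 - 2 * k) := by
  have h := mul_pow_mul_eq_inv_pow ha hb k
  have h1 : (a * b) ^ k * a = a * (a * b) ^ (-k) := by
    rw [← h, ← mul_assoc, ← mul_assoc, ha, one_mul]
  calc (a * b) ^ k * b * ((a * b) ^ k)⁻¹
      = (a * b) ^ k * a * (a * b) * ((a * b) ^ k)⁻¹ := by
        rw [mul_assoc ((a * b) ^ k) a, ← mul_assoc a a b, ha, one_mul]
    _ = a * ((a * b) ^ (-k) * (a * b) ^ (1 : ℤ) * (a * b) ^ (-k)) := by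
        rw [h1, zpow_one, zpow_neg]; simp only [mul_assoc]
    _ = _ := by
        rw [← zpow_add, ← zpow_add]; congr 2; ring

/-- Two involutions with product of odd order are conjugate in the dihedral group they generate. -/
theorem exists_conj_of_odd_orderOf {a b : G} (ha : a * a = 1) (hb : b * b = 1)
    (h : Odd (orderOf (a * b))) : ∃ k : ℤ, (a * b) ^ k * b * ((a * b) ^ k)⁻¹ = a := by
  obtain ⟨m, hm⟩ := h
  refine ⟨m + 1, ?_⟩
  rw [zpow_conj_eq ha hb, show (1 - 2 * ((m : ℤ) + 1)) = -((2 * m + 1 : ℕ) : ℤ) by push_cast; ring,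
    ← hm, zpow_neg, zpow_natCast, pow_orderOf_eq_one, inv_one, mul_one]

theorem mem_of_sq_mem_of_odd_orderOf {K : Subgroup G} {a : G} (h2 : a * a ∈ K)
    (h : Odd (orderOf a)) : a ∈ K := by
  obtain ⟨m, hm⟩ := h
  have h1 : a * (a * a) ^ m = 1 := by
    rw [← pow_two, ← pow_mul, ← pow_succ', ← hm, pow_orderOf_eq_one]
  rw [eq_inv_of_mul_eq_one_left h1]
  exact inv_mem (pow_mem h2 m)

end Involutions

section Reductions

variable {G : Type*} [Group G]

/-- An element all of whose products with its own conjugates have odd order. -/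
def IsOddlyIsolated (x : G) : Prop := ∀ g : G, Odd (orderOf (x * (g * x * g⁻¹)))

/-- The conclusion of the Z*-theorem: `x` is central modulo a normal subgroup of odd order. -/
def IsCentralModOdd (x : G) : Prop :=
  ∃ N : Subgroup G, N.Normal ∧ Odd (Nat.card N) ∧ ∀ g : G, x * (g * x * g⁻¹) ∈ N

theorem IsOddlyIsolated.map {x : G} (h : IsOddlyIsolated x) {K : Type*} [Group K] (f : G →* K)
    (hf : Function.Surjective f) : IsOddlyIsolated (f x) := by
  intro k
  obtain ⟨g, rfl⟩ := hf k
  rw [← map_inv, ← map_mul, ← map_mul, ← map_mul]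
  exact (h g).of_dvd_nat (orderOf_map_dvd f _)

theorem IsOddlyIsolated.conj {x : G} (h : IsOddlyIsolated x) (g : G) :
    IsOddlyIsolated (g * x * g⁻¹) := h.map (MulAut.conj g).toMonoidHom (MulAut.conj g).surjective

theorem IsOddlyIsolated.subtype {x : G} (h : IsOddlyIsolated x) {H : Subgroup G} (hx : x ∈ H) :
    IsOddlyIsolated (⟨x, hx⟩ : H) := by
  intro g
  have := h g
  rwa [← Subgroup.orderOf_coe]

theorem IsCentralModOdd.of_subtype {x : G} {H : Subgroup G} {hx : x ∈ H}
    (h : IsCentralModOdd (⟨x, hx⟩ : H)) :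
    ∃ N : Subgroup G, N ≤ H ∧ Odd (Nat.card N) ∧ (∀ c ∈ H, ∀ n ∈ N, c * n * c⁻¹ ∈ N) ∧
      ∀ c ∈ H, x * (c * x * c⁻¹) ∈ N := by
  obtain ⟨N, hN, hodd, hx'⟩ := h
  refine ⟨N.map H.subtype, Subgroup.map_subtype_le N, ?_, ?_, ?_⟩
  · rwa [Subgroup.card_map_of_injective H.subtype_injective]
  · rintro c hc _ ⟨n, hn, rfl⟩
    exact ⟨⟨c, hc⟩ * n * ⟨c, hc⟩⁻¹, hN.conj_mem n hn _, rfl⟩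
  · intro c hc
    exact ⟨_, hx' ⟨c, hc⟩, rfl⟩

instance characteristic_oddCore [Finite G] : (oddCore G).Characteristic := by
  rw [Subgroup.characteristic_iff_comap_le]
  intro φ
  have := (odd_card_oddCore G).1
  refine le_oddCore _ inferInstance ?_
  rw [show (oddCore G).comap φ.toMonoidHom = _ from Subgroup.comap_equiv_eq_map_symm φ _,
    Subgroup.card_map_of_injective φ.symm.injective]
  exact (odd_card_oddCore G).2

theorem isCentralModOdd_of_normal [Finite G] {x : G} (hx2 : x * x = 1) (h : IsOddlyIsolated x)
    (M : Subgroup G) [hM : M.Normal] (hx : x ∈ M) (hMx : IsCentralModOdd (⟨x, hx⟩ : M)) :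
    IsCentralModOdd x := by
  obtain ⟨N, hN, hodd, hNx⟩ := hMx
  refine ⟨(oddCore M).map M.subtype, ConjAct.normal_of_characteristic_of_normal, ?_, ?_⟩
  · rw [Subgroup.card_map_of_injective M.subtype_injective]
    exact (odd_card_oddCore M).2
  · intro g
    have hy : g * x * g⁻¹ ∈ M := hM.conj_mem x hx g
    refine mem_of_sq_mem_of_odd_orderOf ?_ (h g)
    have hyy : (g * x * g⁻¹)⁻¹ = g * x * g⁻¹ := by
      rw [mul_inv_rev, mul_inv_rev, inv_inv, inv_eq_of_mul_eq_one_right hx2, mul_assoc]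
    refine ⟨_, le_oddCore N hN hodd (hNx ⟨_, hy⟩), ?_⟩
    change x * ((g * x * g⁻¹) * x * (g * x * g⁻¹)⁻¹) = _
    rw [hyy]
    simp only [mul_assoc]

theorem isCentralModOdd_of_quotient [Finite G] {x z : G} (h : IsOddlyIsolated x)
    (hz2 : z * z = 1) (hz1 : z ≠ 1) [hZ : (Subgroup.zpowers z).Normal]
    (hq : IsCentralModOdd (x : G ⧸ Subgroup.zpowers z)) : IsCentralModOdd x := by
  obtain ⟨N, hN, hodd, hNx⟩ := hq
  set L : Subgroup G := N.comap (QuotientGroup.mk' (Subgroup.zpowers z)) with hL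
  have hcz : Nat.card (Subgroup.zpowers z) = 2 := by
    rw [Nat.card_zpowers]
    exact orderOf_eq_prime (by rw [pow_two, hz2]) hz1
  have hzL : Subgroup.zpowers z ≤ L := by
    have := MonoidHom.ker_le_comap (QuotientGroup.mk' (Subgroup.zpowers z)) N
    rwa [QuotientGroup.ker_mk'] at this
  have hcZ : Nat.card ((Subgroup.zpowers z).subgroupOf L) = 2 := by
    rw [Nat.card_congr (Subgroup.subgroupOfEquivOfLe hzL).toEquiv, hcz]
  have hind : ((Subgroup.zpowers z).subgroupOf L).index = Nat.card N := by
    have h1 := Subgroup.relIndex_ker L (QuotientGroup.mk' (Subgroup.zpowers z))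
    rw [QuotientGroup.ker_mk', Subgroup.map_comap_eq_self_of_surjective
      (QuotientGroup.mk'_surjective _)] at h1
    exact h1
  obtain ⟨Q, hQ⟩ := Subgroup.exists_right_complement'_of_coprime
    (N := (Subgroup.zpowers z).subgroupOf L)
    (by rw [hcZ, hind]; exact Nat.coprime_two_left.2 hodd)
  have hQi : Q.index = 2 := by rw [hQ.index_eq_card, hcZ]
  have hQn : Q.Normal := Subgroup.normal_of_index_eq_two hQi
  have hQo : Odd (Nat.card Q) := by rw [← hQ.symm.index_eq_card, hind]; exact hodd
  refine ⟨(oddCore L).map L.subtype, ConjAct.normal_of_characteristic_of_normal, ?_, ?_⟩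
  · rw [Subgroup.card_map_of_injective L.subtype_injective]
    exact (odd_card_oddCore L).2
  · intro g
    have hm : x * (g * x * g⁻¹) ∈ L := hNx (QuotientGroup.mk g)
    have h2 := mem_of_sq_mem_of_odd_orderOf (K := Q) (a := ⟨_, hm⟩)
      (Subgroup.mul_self_mem_of_index_two hQi _) (by rw [← Subgroup.orderOf_coe]; exact h g)
    exact ⟨_, le_oddCore Q hQn hQo h2, rfl⟩

/-- It suffices to treat groups in which the involution normally generates, no involution is
central, and the theorem holds for all proper subgroups. -/
theorem isCentralModOdd_of_forall
    (key : ∀ (G : Type u) [Group G] [Finite G] (x : G), x * x = 1 → x ≠ 1 → IsOddlyIsolated x →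
      Subgroup.normalClosure {x} = ⊤ →
      (∀ z : G, z * z = 1 → z ≠ 1 → ∃ g : G, g * z ≠ z * g) →
      (∀ (H : Subgroup G) (y : G) (hy : y ∈ H), H ≠ ⊤ → y * y = 1 → IsOddlyIsolated y →
        IsCentralModOdd (⟨y, hy⟩ : H)) → IsCentralModOdd x)
    (G : Type u) [Group G] [Finite G] (x : G) (hx : x * x = 1) (h : IsOddlyIsolated x) :
    IsCentralModOdd x := by
  induction hn : Nat.card G using Nat.strong_induction_on generalizing G with
  | _ n ih =>
    subst hn
    have hsub : ∀ (H : Subgroup G) (y : G) (hy : y ∈ H), H ≠ ⊤ → y * y = 1 →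
        IsOddlyIsolated y → IsCentralModOdd (⟨y, hy⟩ : H) := fun H y hy hH hy2 hiso =>
      ih (Nat.card H) (lt_of_le_of_ne (Subgroup.card_le_card_group H)
        fun he => hH (Subgroup.eq_top_of_card_eq H he)) H _ (Subtype.ext hy2) (hiso.subtype hy) rfl
    by_cases hx1 : x = 1
    · exact ⟨⊥, inferInstance, by simp, by simp [hx1]⟩
    by_cases hcl : Subgroup.normalClosure {x} = ⊤
    · by_cases hz : ∀ z : G, z * z = 1 → z ≠ 1 → ∃ g : G, g * z ≠ z * g
      · exact key G x hx hx1 h hcl hz hsub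
      · push Not at hz
        obtain ⟨z, hz2, hz1, hzc⟩ := hz
        have hZ : (Subgroup.zpowers z).Normal := by
          refine ⟨?_⟩
          rintro _ ⟨k, rfl⟩ g
          refine ⟨k, ?_⟩
          change z ^ k = g * z ^ k * g⁻¹
          rw [← conj_zpow, hzc, mul_inv_cancel_right]
        refine isCentralModOdd_of_quotient h hz2 hz1 (ih _ ?_ (G ⧸ Subgroup.zpowers z) _ ?_
          (h.map (QuotientGroup.mk' _) (QuotientGroup.mk'_surjective _)) rfl)
        · have h1 := Subgroup.card_eq_card_quotient_mul_card_subgroup (Subgroup.zpowers z)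
          rw [Nat.card_zpowers, orderOf_eq_prime (p := 2) (by rw [pow_two, hz2]) hz1] at h1
          have : 0 < Nat.card (G ⧸ Subgroup.zpowers z) := Nat.card_pos
          omega
        · rw [← QuotientGroup.mk_mul, hx, QuotientGroup.mk_one]
    · have hmem : x ∈ Subgroup.normalClosure {x} :=
        Subgroup.subset_normalClosure (Set.mem_singleton x)
      exact isCentralModOdd_of_normal hx h _ hmem (hsub _ x hmem hcl hx h)

end Reductions

namespace GroupChar

open MonoidAlgebra

variable {G : Type u} [Group G] [Fintype G]

namespace CharTable

variable (X : CharTable G)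

/-- The value of a character at a group element. -/
noncomputable def χ (i : X.ι) (g : G) : ℂ := X.T i (single g 1)

theorem χ_conj (i : X.ι) (g x : G) : X.χ i (g * x * g⁻¹) = X.χ i x := by
  have h := X.T_mul_comm i (single (g * x) 1) (single g⁻¹ 1)
  rw [single_mul_single, single_mul_single, one_mul, ← mul_assoc, inv_mul_cancel, one_mul] at h
  exact h

theorem χ_one (i : X.ι) : X.χ i 1 = X.d i := X.T_one i

theorem χ_principal (g : G) : X.χ X.i₀ g = 1 := X.T_principal g

theorem d_principal : X.d X.i₀ = 1 := by
  have := X.χ_one X.i₀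
  rw [χ_principal] at this
  exact_mod_cast this.symm

theorem d_ne_zero (i : X.ι) : (X.d i : ℂ) ≠ 0 := by
  exact_mod_cast (X.d_pos i).ne'

theorem χ_eq_of_mul_mem {i : X.ι} (hi : i ∈ X.B) {z : G} {N : Subgroup G} (hN : Odd (Nat.card N))
    (hNz : ∀ n ∈ N, n * z = z * n) (hnorm : ∀ c, c * z = z * c → ∀ n ∈ N, c * n * c⁻¹ ∈ N)
    {g : G} (hg : ∀ k : ℤ, Odd k → z ∈ Subgroup.zpowers (g ^ k)) {n : G} (hn : n ∈ N)
    (hgz : g = z * n) (hz : ∀ k : ℤ, Odd k → z ∈ Subgroup.zpowers (z ^ k)) :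
    X.χ i g = X.χ i z := by
  have h1 := X.card_mul_eq_sum i hi z N hN hNz hnorm g
    (by rw [hgz, mul_assoc, hNz n hn]) hg
  have h2 := X.card_mul_eq_sum i hi z N hN hNz hnorm z rfl hz
  have h3 : ∑ᶠ m : N, X.T i (single (g * m) 1) = ∑ᶠ m : N, X.T i (single (z * m) 1) := by
    rw [← finsum_comp_equiv (Equiv.mulLeft (⟨n, hn⟩ : N)) (f := fun m : N =>
      X.T i (single (z * m) 1))]
    refine finsum_congr fun m => ?_
    rw [hgz, mul_assoc]
    rfl
  rw [h3, ← h2] at h1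
  exact mul_left_cancel₀ (by exact_mod_cast hN.pos.ne') h1

theorem sum_principal_block_one {y : G} (hy : ∀ k : ℤ, y ^ k = 1 → Even k) :
    ∑ i ∈ X.B, X.d i * X.χ i y = 0 := by
  have h := X.sum_mul_eq_zero y 1 fun v k hk => hy k (by simpa using hk)
  rw [← h]
  refine Finset.sum_congr rfl fun i _ => ?_
  rw [show (single (1 : G) (1 : ℂ)) = 1 from rfl, X.T_one, mul_comm]
  rfl

end CharTable

theorem even_of_zpow_eq_one {G : Type*} [Group G] {y : G} (hy : y * y = 1) (hy1 : y ≠ 1)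
    (k : ℤ) (h : y ^ k = 1) : Even k := by
  by_contra hk
  obtain ⟨m, rfl⟩ := Int.not_even_iff_odd.1 hk
  rw [zpow_add, zpow_mul, zpow_one, show y ^ (2 : ℤ) = 1 by rw [zpow_two, hy], one_zpow,
    one_mul] at h
  exact hy1 h

theorem zpow_odd_of_involution {G : Type*} [Group G] {z : G} (hz : z * z = 1) {k : ℤ} (hk : Odd k) :
    z ^ k = z := by
  obtain ⟨m, rfl⟩ := hk
  rw [zpow_add, zpow_mul, zpow_one, show z ^ (2 : ℤ) = 1 by rw [zpow_two, hz], one_zpow, one_mul]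

theorem χ_conj_mul_eq (X : CharTable G) {x y : G} (hx : x * x = 1)
    (h : IsOddlyIsolated x)
    (hz : ∀ z : G, z * z = 1 → z ≠ 1 → ∃ g : G, g * z ≠ z * g)
    (hsub : ∀ (H : Subgroup G) (y : G) (hy : y ∈ H), H ≠ ⊤ → y * y = 1 → IsOddlyIsolated y →
        IsCentralModOdd (⟨y, hy⟩ : H))
    (hy : y * y = 1) (hxy : x * y = y * x) (hnc : ∀ g, g * x * g⁻¹ ≠ y)
    (c : G) {i : X.ι} (hi : i ∈ X.B) : X.χ i (c * x * c⁻¹ * y) = X.χ i (x * y) := by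
  set a := c * x * c⁻¹ with ha
  have haa : a * a = 1 := by
    rw [ha]; simp only [mul_assoc, inv_mul_cancel_left]
    rw [← mul_assoc x x, hx, one_mul, mul_inv_cancel]
  set g := a * y with hg
  have heven : ¬ Odd (orderOf g) := by
    intro hodd
    obtain ⟨k, hk⟩ := exists_conj_of_odd_orderOf haa hy hodd
    apply hnc (((a * y) ^ k)⁻¹ * c)
    rw [mul_inv_rev, inv_inv]
    rw [ha] at hk ⊢
    have := congrArg (fun u => ((c * x * c⁻¹ * y) ^ k)⁻¹ * u * (c * x * c⁻¹ * y) ^ k) hk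
    simp only [mul_assoc, inv_mul_cancel, inv_mul_cancel_left, mul_one] at this ⊢
    exact this.symm
  obtain ⟨m, hm⟩ := Nat.not_odd_iff_even.1 heven
  set z := g ^ m with hzdef
  have hm0 : 0 < m := by
    have := orderOf_pos g
    omega
  have hz2 : z * z = 1 := by rw [hzdef, ← pow_add, ← hm, pow_orderOf_eq_one]
  have hz1 : z ≠ 1 := pow_ne_one_of_lt_orderOf hm0.ne' (by omega)
  have hzinv : z⁻¹ = z := inv_eq_of_mul_eq_one_right hz2
  have hgz : g * z = z * g := (pow_mul_comm' g m).symm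
  have haz : a * z = z * a := by
    have h1 := mul_pow_mul_eq_inv_pow haa hy (m : ℤ)
    rw [← hg, zpow_neg, zpow_natCast, ← hzdef, hzinv] at h1
    calc a * z = a * z * a * a := by rw [mul_assoc _ a a, haa, mul_one]
      _ = z * a := by rw [h1]
  have hyz : y * z = z * y := by
    have : y = a * g := by rw [hg, ← mul_assoc, haa, one_mul]
    rw [this, mul_assoc, hgz, ← mul_assoc, haz, mul_assoc]
  have hcent : ∀ c, c ∈ Subgroup.centralizer {z} ↔ c * z = z * c := by
    intro c
    exact Subgroup.mem_centralizer_singleton_iff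
  obtain ⟨N, hNle, hNodd, hNn, hNx⟩ := (hsub (Subgroup.centralizer {z}) a ((hcent a).2 haz)
    (fun ht => by
      obtain ⟨b, hb⟩ := hz z hz2 hz1
      exact hb ((hcent b).1 (ht ▸ Subgroup.mem_top b))) haa (h.conj c)).of_subtype
  have hg2 : g ^ 2 ∈ N := by
    have h1 := hNx y ((hcent y).2 hyz)
    rw [inv_eq_of_mul_eq_one_right hy] at h1
    rw [pow_two, hg]
    simpa only [mul_assoc] using h1
  have hmodd : Odd m := by
    by_contra hme
    obtain ⟨l, hl⟩ := Nat.not_odd_iff_even.1 hme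
    have hzN : z ∈ N := by
      rw [hzdef, hl, ← two_mul, pow_mul]
      exact pow_mem hg2 l
    have h1 := Subgroup.orderOf_dvd_natCard N hzN
    rw [orderOf_eq_prime (p := 2) (by rw [pow_two, hz2]) hz1] at h1
    exact Nat.not_even_iff_odd.2 hNodd (even_iff_two_dvd.2 h1)
  obtain ⟨l, hl⟩ := hmodd
  have hχ : X.χ i g = X.χ i z := by
    refine X.χ_eq_of_mul_mem hi hNodd (fun n hn => (hcent n).1 (hNle hn))
      (fun c hc => hNn c ((hcent c).2 hc)) (n := ((g ^ 2) ^ l)⁻¹) ?_ (inv_mem (pow_mem hg2 l)) ?_ ?_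
    · intro k hk
      refine ⟨m, ?_⟩
      change (g ^ k) ^ (m : ℤ) = z
      rw [← zpow_mul, mul_comm, zpow_mul, zpow_natCast, ← hzdef, zpow_odd_of_involution hz2 hk]
    · rw [hzdef, hl, ← pow_mul, pow_succ', mul_assoc, mul_inv_cancel, mul_one]
    · intro k hk
      rw [zpow_odd_of_involution hz2 hk]
      exact Subgroup.mem_zpowers z
  rw [hχ]
  have he := zpow_conj_eq haa hy (-(l : ℤ))
  rw [← hg, show (1 - 2 * -(l : ℤ)) = (m : ℤ) by rw [hl]; push_cast; ring, zpow_natCast,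
    ← hzdef] at he
  set e := g ^ (-(l : ℤ)) with hedef
  have hez : e * z = z * e := (((show Commute g z from hgz).zpow_left _)).eq
  set b := e⁻¹ * a * e with hb
  have hyb : y = b * z := by
    calc y = e⁻¹ * (e * y * e⁻¹) * e := by group
      _ = e⁻¹ * a * (z * e) := by rw [he]; simp only [mul_assoc]
      _ = b * z := by rw [← hez, hb]; simp only [mul_assoc]
  have hbx : b = (e⁻¹ * c) * x * (e⁻¹ * c)⁻¹ := by
    rw [hb, ha, mul_inv_rev, inv_inv]; simp only [mul_assoc]
  have hbb : b * b = 1 := by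
    rw [hb]; simp only [mul_assoc, mul_inv_cancel_left]
    rw [← mul_assoc a a, haa, one_mul, inv_mul_cancel]
  have hzb : z = b * y := by rw [hyb, ← mul_assoc, hbb, one_mul]
  have hby : Commute b y := by
    have : b = y * z := by rw [hyb, mul_assoc, hz2, mul_one]
    rw [this]
    exact (Commute.refl y).mul_left (show Commute z y from hyz.symm)
  obtain ⟨k, hk⟩ := exists_conj_of_odd_orderOf hx hbb (by rw [hbx]; exact h _)
  have hwy : Commute ((x * b) ^ k) y :=
    ((show Commute x y from hxy).mul_left hby).zpow_left k
  rw [hzb, ← X.χ_conj i ((x * b) ^ k) (b * y)]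
  congr 1
  conv_rhs => rw [← hk]
  clear_value b
  rw [mul_assoc ((x * b) ^ k * b) _ y, hwy.inv_left.eq]
  simp only [mul_assoc]

theorem eq_of_commute_involution {x : G} (hx : x * x = 1)
    (h : IsOddlyIsolated x) (hcl : Subgroup.normalClosure {x} = ⊤)
    (hz : ∀ z : G, z * z = 1 → z ≠ 1 → ∃ g : G, g * z ≠ z * g)
    (hsub : ∀ (H : Subgroup G) (y : G) (hy : y ∈ H), H ≠ ⊤ → y * y = 1 → IsOddlyIsolated y →
        IsCentralModOdd (⟨y, hy⟩ : H))
    {y : G} (hy : y * y = 1) (hy1 : y ≠ 1) (hxy : x * y = y * x) : y = x := by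
  by_contra hne
  obtain ⟨X⟩ := nonempty_charTable G
  have hxy1 : x * y ≠ 1 := fun hh => hne (by
    rw [eq_inv_of_mul_eq_one_right hh, inv_eq_of_mul_eq_one_right hx])
  have hxyxy : x * y * (x * y) = 1 := by
    rw [mul_assoc, ← mul_assoc y x, ← hxy, mul_assoc x y y, hy, mul_one, hx]
  have hno : ∀ v : G, v * v = 1 → v ≠ 1 → ¬ Odd (orderOf v) := by
    intro v hv hv1
    rw [orderOf_eq_prime (p := 2) (by rw [pow_two, hv]) hv1]
    decide
  have hxxy : x * (x * y) = y := by rw [← mul_assoc, hx, one_mul]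
  have hn1 : ∀ g, g * x * g⁻¹ ≠ y := by
    rintro g rfl
    exact hno _ hxyxy hxy1 (h g)
  have hn2 : ∀ g, g * x * g⁻¹ ≠ x * y := by
    intro g hg
    have := h g
    rw [hg, hxxy] at this
    exact hno _ hy hy1 this
  have key : ∀ v : G, v * v = 1 → x * v = v * x → (∀ g, g * x * g⁻¹ ≠ v) → ∀ i ∈ X.B,
      X.d i * X.χ i (x * v) = X.χ i x * X.χ i v := by
    intro v hv hxv hnc i hi
    have h1 : X.d i * ∑ c, X.χ i (c * x * c⁻¹ * v) =
      Fintype.card G * (X.χ i x * X.χ i v) := X.sum_conj i x v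
    rw [Finset.sum_congr rfl (g := fun _ => X.χ i (x * v))
      fun c _ => χ_conj_mul_eq X hx h hz hsub hv hxv hnc c hi] at h1
    simp only [Finset.sum_const, Finset.card_univ, nsmul_eq_mul] at h1
    have hc : (Fintype.card G : ℂ) ≠ 0 := by exact_mod_cast Fintype.card_ne_zero
    refine mul_left_cancel₀ hc ?_
    rw [← mul_assoc, mul_comm _ (X.d i : ℂ), mul_assoc, h1]
  have hsum : ∀ i ∈ X.B, i ≠ X.i₀ → X.d i * (X.χ i y + X.χ i (x * y)) = 0 := by
    intro i hi hne
    have h1 := key y hy hxy hn1 i hi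
    have h2 := key (x * y) hxyxy (by rw [hxxy, mul_assoc, ← hxy, hxxy]) hn2 i hi
    rw [hxxy] at h2
    have h3 : (X.d i - X.χ i x) * (X.χ i y + X.χ i (x * y)) = 0 := by linear_combination h1 + h2
    rcases mul_eq_zero.1 h3 with h4 | h4
    · exact (hne (X.eq_principal i x hx hcl (sub_eq_zero.1 h4).symm)).elim
    · rw [h4, mul_zero]
  have e1 := X.sum_principal_block_one (even_of_zpow_eq_one hy hy1)
  have e2 := X.sum_principal_block_one (even_of_zpow_eq_one hxyxy hxy1)
  have e3 : ∑ i ∈ X.B, X.d i * (X.χ i y + X.χ i (x * y)) = 0 := by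
    simp only [mul_add, Finset.sum_add_distrib, e1, e2, add_zero]
  rw [Finset.sum_eq_single X.i₀ hsum (fun hh => (hh X.principal_mem).elim), X.χ_principal,
    X.χ_principal, X.d_principal] at e3
  norm_num at e3

end GroupChar

namespace GroupChar

open MonoidAlgebra

theorem exists_zpow_mul_eq {k M : ℤ} (h : IsCoprime k M) :
    ∃ l : ℤ, ∀ {G : Type u} [Group G] (g : G), g ^ M = 1 → (g ^ k) ^ l = g := by
  obtain ⟨a, b, hab⟩ := h
  refine ⟨a, fun {G} _ g hg => ?_⟩
  rw [← zpow_mul, show k * a = 1 - M * b by linear_combination hab, zpow_sub, zpow_one, zpow_mul,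
    hg, one_zpow, inv_one, mul_one]

theorem isCoprime_two_pow {k : ℤ} (hk : Odd k) (n : ℕ) : IsCoprime k ((2 ^ n : ℕ) : ℤ) := by
  push_cast
  exact (Int.isCoprime_iff_gcd_eq_one.2 (by
    have := Int.isCoprime_iff_gcd_eq_one.1 (Int.isCoprime_two_right.2 hk)
    exact this)).pow_right

variable {G : Type u} [Group G] [Fintype G]

namespace CharTable

variable (X : CharTable G)

/-- The pairing of two group elements by the characters in `B`. -/
noncomputable def form (g h : G) : ℂ := ∑ i ∈ X.B, X.χ i g * X.χ i h

theorem form_eq_zero_of_two_elements {a h : G} {n : ℕ} (ha : a ^ 2 ^ n = 1) (hh : h ^ 2 ^ n = 1)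
    (hc : ∀ y, y * h * y⁻¹ ≠ a⁻¹) : X.form a h = 0 := by
  refine X.sum_mul_eq_zero a h fun v k hk => ?_
  by_contra hodd
  obtain ⟨l, hl⟩ := exists_zpow_mul_eq.{u}
    (isCoprime_two_pow (Int.not_even_iff_odd.1 hodd) n)
  apply hc v
  have h1 : (v * h * v⁻¹) ^ k = (a⁻¹) ^ k := by
    rw [conj_zpow, inv_zpow, mul_inv_eq_iff_eq_mul, eq_inv_mul_iff_mul_eq, ← mul_assoc, hk]
  rw [← hl (v * h * v⁻¹) (by rw [zpow_natCast, conj_pow, hh]; group), h1, hl]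
  rw [zpow_natCast, inv_pow, ha, inv_one]

theorem form_eq_zero_of_odd_orderOf {a h : G} {n : ℕ} (ha : a ^ 2 ^ n = 1) (ha1 : a ≠ 1)
    (hh : Odd (orderOf h)) : X.form a h = 0 := by
  refine X.sum_mul_eq_zero a h fun v k hk => ?_
  by_contra hodd
  have hkm : Odd (k * (orderOf h : ℤ)) :=
    (Int.not_even_iff_odd.1 hodd).mul (by exact_mod_cast hh)
  obtain ⟨l, hl⟩ := exists_zpow_mul_eq.{u} (isCoprime_two_pow hkm n)
  have h1 : a ^ k = v * (h ^ k)⁻¹ * v⁻¹ := by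
    rw [eq_mul_inv_iff_mul_eq, eq_mul_inv_iff_mul_eq, hk]
  apply ha1
  rw [← hl a (by rw [zpow_natCast, ha]), zpow_mul, h1, conj_zpow, inv_zpow, ← zpow_mul, mul_comm k,
    zpow_mul, zpow_natCast, pow_orderOf_eq_one]
  simp

theorem sum_form (v : G) : ∑ h, X.form v h = Fintype.card G := by
  simp only [form]
  rw [Finset.sum_comm, Finset.sum_eq_single X.i₀]
  · simp [χ_principal]
  · intro i _ hi
    rw [← Finset.mul_sum, show ∑ h, X.χ i h = 0 from X.sum_eq_zero i hi, mul_zero]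
  · exact fun h => (h X.principal_mem).elim

open Classical in
/-- The norm of the class of a `2`-element whose centralizer has a normal `2`-complement. -/
theorem card_mul_form {z : G} {n : ℕ} (hz : z ^ 2 ^ n = 1) {N : Subgroup G}
    (hN : Odd (Nat.card N)) (hNz : ∀ n ∈ N, n * z = z * n)
    (hnorm : ∀ c, c * z = z * c → ∀ n ∈ N, c * n * c⁻¹ ∈ N)
    (hmem : ∀ c, c * z = z * c → Odd (orderOf c) → c ∈ N) :
    (Nat.card N : ℂ) * X.form z⁻¹ z = Nat.card (Subgroup.centralizer {z}) := by
  have hcent : ∀ c, c ∈ Subgroup.centralizer {z} ↔ c * z = z * c :=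
    fun c => Subgroup.mem_centralizer_singleton_iff
  -- a common exponent extracting the `2`-part of every `z * n`
  obtain ⟨M, hM⟩ : ∃ M : ℤ, ∀ m ∈ N, (z * m) ^ M = z := by
    obtain ⟨l, hl⟩ := exists_zpow_mul_eq.{u}
      (isCoprime_two_pow (k := (Nat.card N : ℤ)) (by exact_mod_cast hN) n)
    refine ⟨Nat.card N * l, fun m hm => ?_⟩
    rw [zpow_mul, (show Commute z m from (hNz m hm).symm).mul_zpow, zpow_natCast m,
      show m ^ Nat.card N = 1 by
        have := pow_card_eq_one' (x := (⟨m, hm⟩ : N))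
        exact congrArg Subtype.val this, mul_one, hl]
    rw [zpow_natCast, hz]
  have hodd : ∀ k : ℤ, Odd k → ∃ l : ℤ, (z ^ k) ^ l = z := fun k hk => by
    obtain ⟨l, hl⟩ := exists_zpow_mul_eq.{u} (isCoprime_two_pow hk n)
    exact ⟨l, hl z (by rw [zpow_natCast, hz])⟩
  have hχ : ∀ m ∈ N, X.form z⁻¹ (z * m) = X.form z⁻¹ z := by
    intro m hm
    refine Finset.sum_congr rfl fun i hi => ?_
    rw [X.χ_eq_of_mul_mem hi hN hNz hnorm (g := z * m) ?_ hm rfl ?_]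
    · intro k hk
      obtain ⟨l, hl⟩ := hodd k hk
      refine ⟨M * l, ?_⟩
      change ((z * m) ^ k) ^ (M * l) = z
      rw [← zpow_mul, ← mul_assoc, mul_comm k M, mul_assoc, zpow_mul, hM m hm, zpow_mul, hl]
    · intro k hk
      exact hodd k hk
  let F : G × N → G := fun p => p.1 * (z * p.2) * p.1⁻¹
  have hfib : ∀ h, X.form z⁻¹ h ≠ 0 →
      ((Finset.univ : Finset (G × N)).filter fun p => F p = h).card =
        Nat.card (Subgroup.centralizer {z}) := by
    intro h hh
    obtain ⟨y₀, n₀, hn₀, rfl⟩ : ∃ y₀ n₀, n₀ ∈ N ∧ y₀ * (z * n₀) * y₀⁻¹ = h := by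
      by_contra hcon
      push Not at hcon
      refine hh (X.sum_mul_eq_zero z⁻¹ h fun v k hk => ?_)
      by_contra hkodd
      rw [Int.not_even_iff_odd] at hkodd
      obtain ⟨l, hl⟩ := hodd k hkodd
      have h1 : (v * h * v⁻¹) ^ k = z ^ k := by
        rw [conj_zpow, mul_inv_eq_iff_eq_mul]
        rw [inv_zpow, mul_assoc, inv_mul_eq_iff_eq_mul] at hk
        exact hk
      have h2 : Commute (v * h * v⁻¹) z := by
        rw [← hl, ← h1]
        exact ((Commute.refl _).zpow_right k).zpow_right l
      have h3 : (z⁻¹ * (v * h * v⁻¹)) ^ k = 1 := by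
        rw [(h2.symm.inv_left).mul_zpow, h1, inv_zpow, inv_mul_cancel]
      refine hcon v⁻¹ (z⁻¹ * (v * h * v⁻¹)) (hmem _ ?_ ?_) ?_
      · exact (((Commute.refl z).inv_left).mul_left h2).eq
      · have h4 := orderOf_dvd_iff_zpow_eq_one.2 h3
        obtain ⟨j, hj⟩ := h4
        rw [hj] at hkodd
        exact_mod_cast (Int.odd_mul.1 hkodd).1
      · group
    rw [← Fintype.card_subtype, ← Nat.card_eq_fintype_card]
    refine (Nat.card_congr (Equiv.ofBijective (fun c : Subgroup.centralizer {z} =>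
      (⟨(y₀ * (c : G)⁻¹, ⟨c * n₀ * (c : G)⁻¹, hnorm c ((hcent c).1 c.2) n₀ hn₀⟩), ?_⟩ :
        {p : G × N // F p = y₀ * (z * n₀) * y₀⁻¹})) ⟨?_, ?_⟩)).symm
    · have hcz : (c : G)⁻¹ * z * c = z := by
        rw [mul_assoc, ← (hcent c).1 c.2, inv_mul_cancel_left]
      calc y₀ * (c : G)⁻¹ * (z * (c * n₀ * (c : G)⁻¹)) * (y₀ * (c : G)⁻¹)⁻¹
          = y₀ * (((c : G)⁻¹ * z * c) * n₀) * y₀⁻¹ := by group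
        _ = _ := by rw [hcz]
    · intro c c' hcc
      have h1 := congrArg (fun p => p.1.1) hcc
      exact Subtype.ext (inv_injective (mul_left_cancel h1))
    · rintro ⟨⟨y, m⟩, hp⟩
      have hp' : y * (z * m) * y⁻¹ = y₀ * (z * n₀) * y₀⁻¹ := hp
      have h1 : (y⁻¹ * y₀) * (z * n₀) * (y⁻¹ * y₀)⁻¹ = z * m := by
        calc (y⁻¹ * y₀) * (z * n₀) * (y⁻¹ * y₀)⁻¹ = y⁻¹ * (y₀ * (z * n₀) * y₀⁻¹) * y := by group
          _ = z * m := by rw [← hp']; group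
      have h2 : (y⁻¹ * y₀) * z * (y⁻¹ * y₀)⁻¹ = z := by
        have := congrArg (· ^ M) h1
        simpa only [conj_zpow, hM n₀ hn₀, hM m m.2] using this
      have h3 : (y⁻¹ * y₀) * z = z * (y⁻¹ * y₀) := mul_inv_eq_iff_eq_mul.1 h2
      refine ⟨⟨y⁻¹ * y₀, (hcent _).2 h3⟩, Subtype.ext (Prod.ext ?_ (Subtype.ext ?_))⟩
      · change y₀ * (y⁻¹ * y₀)⁻¹ = y
        group
      · change y⁻¹ * y₀ * n₀ * (y⁻¹ * y₀)⁻¹ = m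
        calc y⁻¹ * y₀ * n₀ * (y⁻¹ * y₀)⁻¹ = ((y⁻¹ * y₀) * z * (y⁻¹ * y₀)⁻¹)⁻¹ *
              ((y⁻¹ * y₀) * (z * n₀) * (y⁻¹ * y₀)⁻¹) := by group
          _ = m := by rw [h2, h1, inv_mul_cancel_left]
  have e1 : ∑ p : G × N, X.form z⁻¹ (F p) =
      Fintype.card G * (Nat.card N * X.form z⁻¹ z) := by
    rw [Finset.sum_congr rfl (g := fun _ => X.form z⁻¹ z)]
    · simp [Finset.sum_const, mul_assoc]
    · rintro ⟨y, m⟩ _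
      rw [← hχ m m.2]
      exact Finset.sum_congr rfl fun i _ => by rw [X.χ_conj]
  have e2 : ∑ p : G × N, X.form z⁻¹ (F p) =
      Nat.card (Subgroup.centralizer {z}) * Fintype.card G := by
    rw [← Finset.sum_fiberwise Finset.univ F, ← X.sum_form z⁻¹, Finset.mul_sum]
    refine Finset.sum_congr rfl fun h _ => ?_
    rw [Finset.sum_congr rfl (g := fun _ => X.form z⁻¹ h)
      fun p hp => by rw [(Finset.mem_filter.1 hp).2], Finset.sum_const, nsmul_eq_mul]
    by_cases h0 : X.form z⁻¹ h = 0
    · rw [h0, mul_zero, mul_zero]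
    · rw [hfib h h0]
  have hc : (Fintype.card G : ℂ) ≠ 0 := by exact_mod_cast Fintype.card_ne_zero
  exact mul_left_cancel₀ hc (by rw [← e1, e2, mul_comm])

end CharTable

end GroupChar

section UniqueInvolution

variable {G : Type u} [Group G]

/-- `x` is an involution, and the only involution in its centralizer. -/
structure IsLoneInvolution (x : G) : Prop where
  sq : x * x = 1
  ne_one : x ≠ 1
  eq_of_commute : ∀ y : G, y * y = 1 → y ≠ 1 → Commute x y → y = x

theorem exists_mem_zpowers_sq_ne_one {b : G} {n : ℕ} (hb : b ^ 2 ^ n = 1) (hb2 : b * b ≠ 1) :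
    ∃ s ∈ Subgroup.zpowers b, s * s ≠ 1 ∧ s * s * (s * s) = 1 := by
  induction n generalizing b with
  | zero => exact (hb2 (by simp_all)).elim
  | succ n ih =>
    by_cases h : b * b * (b * b) = 1
    · exact ⟨b, Subgroup.mem_zpowers b, hb2, h⟩
    · obtain ⟨s, hs, h1, h2⟩ := ih (b := b * b) (by rw [← pow_two, ← pow_mul, ← pow_succ', hb]) h
      refine ⟨s, ?_, h1, h2⟩
      exact Subgroup.zpowers_le.2 (mul_mem (Subgroup.mem_zpowers b) (Subgroup.mem_zpowers b)) hs

namespace IsLoneInvolution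

theorem _root_.commute_of_mul_self_eq {G : Type*} [Group G] {u x : G} (hu : u * u = x) :
    Commute x u := by
  rw [← hu]
  exact (Commute.refl u).mul_left (Commute.refl u)

variable {x : G} (hx : IsLoneInvolution x)
include hx

theorem inv_eq : x⁻¹ = x := inv_eq_of_mul_eq_one_right hx.sq

theorem inv_sqrt {u : G} (hu : u * u = x) : u⁻¹ = x * u :=
  inv_eq_of_mul_eq_one_left (by rw [mul_assoc, hu, hx.sq])

theorem eq_or_eq_of_commute {u v : G} (hu : u * u = x) (hv : v * v = x) (huv : Commute u v) :
    v = u ∨ v = u⁻¹ := by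
  have h1 : v * u⁻¹ * (v * u⁻¹) = 1 := by
    rw [mul_assoc, ← mul_assoc u⁻¹ v, huv.inv_left.eq, mul_assoc v u⁻¹ u⁻¹, ← mul_assoc v v, hv,
      ← mul_inv_rev, hu, hx.inv_eq, hx.sq]
  by_cases h2 : v * u⁻¹ = 1
  · exact Or.inl (mul_inv_eq_one.1 h2)
  · right
    have h3 := hx.eq_of_commute _ h1 h2 ((commute_of_mul_self_eq hv).mul_right
      (commute_of_mul_self_eq hu).inv_right)
    rw [hx.inv_sqrt hu, ← h3, inv_mul_cancel_right]

/-- A square root of `x` is a power of any `2`-element of order at least four commuting with it. -/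
theorem mem_zpowers_of_commute {u b : G} {n : ℕ} (hu : u * u = x) (hb : b ^ 2 ^ n = 1)
    (hb2 : b * b ≠ 1) (hub : Commute u b) : u ∈ Subgroup.zpowers b := by
  obtain ⟨s, ⟨k, rfl⟩, h1, h2⟩ := exists_mem_zpowers_sq_ne_one hb hb2
  simp only at h1 h2
  have hus : Commute u (b ^ k) := hub.zpow_right k
  have h3 : b ^ k * b ^ k = x := hx.eq_of_commute _ h2 h1 (by
    rw [← hu]
    exact (hus.mul_left hus).mul_right (hus.mul_left hus))
  rcases hx.eq_or_eq_of_commute h3 hu hus.symm with h | h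
  · exact ⟨k, h.symm⟩
  · rw [h]
    exact inv_mem ⟨k, rfl⟩

theorem eq_or_eq_mul_of_sq_eq {u v w : G} (hall : ∀ y : G, y * y = 1 → y ≠ 1 → y = x)
    (hcen : ∀ y, Commute u y) (hu : u * u = x) (hvw : v * v = w * w) {n : ℕ}
    (hn : (v * w⁻¹) ^ 2 ^ n = 1) : v = w ∨ v = x * w := by
  by_cases h1 : v * w⁻¹ * (v * w⁻¹) = 1
  · by_cases h2 : v * w⁻¹ = 1
    · exact Or.inl (mul_inv_eq_one.1 h2)
    · exact Or.inr (mul_inv_eq_iff_eq_mul.1 (hall _ h1 h2))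
  · exfalso
    obtain ⟨k, hk⟩ := hx.mem_zpowers_of_commute hu hn h1 (hcen _)
    have h2 : v * (v * w⁻¹) * v⁻¹ = (v * w⁻¹)⁻¹ := by
      rw [← mul_assoc, hvw, mul_inv_cancel_right, mul_inv_rev, inv_inv]
    have h3 : v * u * v⁻¹ = u⁻¹ := by
      rw [← hk]
      change v * (v * w⁻¹) ^ k * v⁻¹ = ((v * w⁻¹) ^ k)⁻¹
      rw [← conj_zpow, h2, inv_zpow]
    rw [← (hcen v).eq, mul_inv_cancel_right] at h3
    exact hx.ne_one (by rw [← hu]; nth_rw 2 [h3]; exact mul_inv_cancel u)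

theorem isCyclic [Finite G] (hG : IsPGroup 2 G) (hall : ∀ y : G, y * y = 1 → y ≠ 1 → y = x)
    {u : G} (hcen : ∀ y, Commute u y) (hu : u * u = x) : IsCyclic G := by
  classical
  cases nonempty_fintype G
  have hf : ∀ b : ℕ, (Finset.univ.filter fun v : G => v ^ 2 ^ b = 1).card ≤ 2 ^ b := by
    intro b
    induction b with
    | zero => exact Finset.card_le_one.2 (by simp)
    | succ b ih =>
      refine (Finset.card_le_mul_card_image_of_maps_to
        (t := Finset.univ.filter fun v : G => v ^ 2 ^ b = 1) (f := fun v => v * v) ?_ 2 ?_).trans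
        (by rw [pow_succ']; exact Nat.mul_le_mul_left 2 ih)
      · intro v hv
        simp only [Finset.mem_filter, Finset.mem_univ, true_and] at hv ⊢
        rw [← pow_two, ← pow_mul, ← pow_succ', hv]
      · intro s _
        by_cases hs : ∃ w : G, w * w = s
        · obtain ⟨w, rfl⟩ := hs
          refine (Finset.card_le_card (t := {w, x * w}) ?_).trans Finset.card_le_two
          intro v hv
          simp only [Finset.mem_filter] at hv
          obtain ⟨n, hn⟩ := hG (v * w⁻¹)
          simpa using hx.eq_or_eq_mul_of_sq_eq hall hcen hu hv.2 hn
        · rw [Finset.card_eq_zero.2]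
          · exact Nat.zero_le 2
          · rw [Finset.filter_eq_empty_iff]
            exact fun v _ hv => hs ⟨v, hv⟩
  refine isCyclic_of_card_pow_eq_one_le fun n hn => ?_
  obtain ⟨b, m, hm, rfl⟩ := Nat.exists_eq_two_pow_mul_odd hn.ne'
  refine le_trans (Finset.card_le_card ?_) ((hf b).trans (Nat.le_mul_of_pos_right _ hm.pos))
  intro v hv
  simp only [Finset.mem_filter, Finset.mem_univ, true_and] at hv ⊢
  obtain ⟨k, hk⟩ := hG v
  have h1 : orderOf (v ^ 2 ^ b) ∣ m := orderOf_dvd_of_pow_eq_one (by rw [← pow_mul, hv])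
  have h2 : orderOf (v ^ 2 ^ b) ∣ 2 ^ k :=
    orderOf_dvd_of_pow_eq_one (by rw [← pow_mul, mul_comm, pow_mul, hk, one_pow])
  exact orderOf_eq_one_iff.1 (Nat.eq_one_of_dvd_coprimes
    ((Nat.coprime_two_left.2 hm).pow_left k) h2 h1)

end IsLoneInvolution

end UniqueInvolution

section QuaternionData

variable {G : Type u} [Group G]

theorem exists_normal_complement_of_isCyclic [Finite G] (h2 : 2 ∣ Nat.card G) (S : Sylow 2 G)
    (hS : IsCyclic S) : ∃ K : Subgroup G, K.Normal ∧ Odd (Nat.card K) ∧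
      (∀ a b : G, a * b * a⁻¹ * b⁻¹ ∈ K) ∧ K.IsComplement' (S : Subgroup G) := by
  have hmin : (Nat.card G).minFac = 2 := (Nat.minFac_eq_two_iff _).2 h2
  refine ⟨_, inferInstance, ?_, ?_, IsCyclic.isComplement' hmin hS⟩
  · rw [← Nat.not_even_iff_odd, even_iff_two_dvd]
    exact MonoidHom.not_dvd_card_ker_transferSylow S _
  · intro a b
    have hcomm : ∀ s t : S, s * t = t * s := fun s t => by
      obtain ⟨g, hg⟩ := hS
      obtain ⟨i, rfl⟩ := hg s
      obtain ⟨j, rfl⟩ := hg t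
      exact (zpow_mul_comm g i j)
    rw [MonoidHom.mem_ker, map_mul, map_mul, map_mul, map_inv, map_inv,
      hcomm (MonoidHom.transferSylow S _ a), mul_inv_cancel_right, mul_inv_cancel]

theorem isCentralModOdd_of_isCyclic [Finite G] {x : G} (hx : x * x = 1) (hx1 : x ≠ 1)
    (S : Sylow 2 G) (hS : IsCyclic S) : IsCentralModOdd x := by
  have h2 : 2 ∣ Nat.card G := by
    rw [← orderOf_eq_prime (p := 2) (by rw [pow_two, hx]) hx1]
    exact orderOf_dvd_natCard x
  obtain ⟨K, hK, hodd, hcomm, -⟩ := exists_normal_complement_of_isCyclic h2 S hS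
  refine ⟨K, hK, hodd, fun g => ?_⟩
  have := hcomm x g
  have h3 := hcomm g x
  rw [inv_eq_of_mul_eq_one_right hx] at h3
  have h4 := hK.conj_mem _ h3 x
  rw [inv_eq_of_mul_eq_one_right hx] at h4
  simpa only [mul_assoc, hx, mul_one] using h4

namespace IsLoneInvolution

variable {x : G} (hx : IsLoneInvolution x)
include hx

theorem commute_of_isPGroup [Finite G] {P : Subgroup G} (hP : IsPGroup 2 P) (hxP : x ∈ P) :
    ∀ v ∈ P, Commute x v := by
  have : Nontrivial P := ⟨⟨⟨x, hxP⟩, 1, fun h => hx.ne_one (congrArg Subtype.val h)⟩⟩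
  have hc := hP.center_nontrivial
  have hcP : IsPGroup 2 (Subgroup.center P) := hP.to_subgroup _
  have hdvd : 2 ∣ Nat.card (Subgroup.center P) :=
    hcP.card_eq_or_dvd.resolve_left (Finite.one_lt_card_iff_nontrivial.2 hc).ne'
  obtain ⟨y, hy⟩ := exists_prime_orderOf_dvd_card' 2 hdvd
  have hy2 : ((y : P) : G) * y = 1 := by
    have := pow_orderOf_eq_one y
    rw [hy, pow_two] at this
    exact congrArg (fun v : Subgroup.center P => ((v : P) : G)) this
  have hy1 : ((y : P) : G) ≠ 1 := by
    intro h
    have : y = 1 := Subtype.ext (Subtype.ext h)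
    rw [this, orderOf_one] at hy
    omega
  have hcen : ∀ v ∈ P, Commute ((y : P) : G) v := fun v hv =>
    (congrArg Subtype.val (Subgroup.mem_center_iff.1 y.2 ⟨v, hv⟩)).symm
  intro v hv
  rw [← hx.eq_of_commute _ hy2 hy1 (hcen x hxP).symm]
  exact hcen v hv

theorem eq_of_isPGroup [Finite G] {P : Subgroup G} (hP : IsPGroup 2 P) (hxP : x ∈ P) {v : G}
    (hv : v ∈ P) (hv2 : v * v = 1) (hv1 : v ≠ 1) : v = x :=
  hx.eq_of_commute v hv2 hv1 (hx.commute_of_isPGroup hP hxP v hv)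

theorem isPGroup_zpowers : IsPGroup 2 (Subgroup.zpowers x) := by
  rintro ⟨_, k, rfl⟩
  refine ⟨1, Subtype.ext ?_⟩
  change (x ^ k) ^ 2 ^ 1 = 1
  rw [pow_one, pow_two, ← (Commute.refl x).mul_zpow, hx.sq, one_zpow]

/-- If `x` has no square root then it is central modulo a normal subgroup of odd order. -/
theorem isCentralModOdd_of_forall_sq_ne [Finite G] (h : ∀ u : G, u * u ≠ x) :
    IsCentralModOdd x := by
  obtain ⟨S, hS⟩ := hx.isPGroup_zpowers.exists_le_sylow
  have hxS : x ∈ S := hS (Subgroup.mem_zpowers x)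
  refine isCentralModOdd_of_isCyclic hx.sq hx.ne_one S ⟨⟨x, hxS⟩, ?_⟩
  rintro ⟨v, hv⟩
  have hv2 : v * v = 1 := by
    by_contra hv2
    obtain ⟨n, hn⟩ := S.2 ⟨v, hv⟩
    obtain ⟨s, hs, h1, h2⟩ := exists_mem_zpowers_sq_ne_one (congrArg Subtype.val hn) hv2
    have hsS : s ∈ (S : Subgroup G) := Subgroup.zpowers_le.2 hv hs
    exact h s (hx.eq_of_isPGroup S.2 hxS (mul_mem hsS hsS) h2 h1)
  by_cases hv1 : v = 1
  · subst hv1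
    exact Subgroup.one_mem (Subgroup.zpowers (⟨x, hxS⟩ : S))
  · obtain rfl := hx.eq_of_isPGroup S.2 hxS hv hv2 hv1
    exact Subgroup.mem_zpowers _

end IsLoneInvolution

end QuaternionData

section QuaternionData

variable {G : Type u} [Group G]

/-- The `2`-local structure around a square root `u` of the lone involution `x`: the centralizer
of `u` is the product of the cyclic group generated by `w` and a normal subgroup of odd order, and
`t` is a square root of `x` inverting `w`. -/
structure QuaternionData (x u : G) where
  /-- A generator of a Sylow `2`-subgroup of the centralizer of `u`. -/
  w : G
  /-- A square root of `x` inverting `w`. -/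
  t : G
  /-- The exponent with `u = w ^ 2 ^ a`. -/
  a : ℕ
  /-- The normal `2`-complement of the centralizer of `u`. -/
  K : Subgroup G
  orderOf_w : orderOf w = 4 * 2 ^ a
  w_pow : w ^ 2 ^ a = u
  t_sq : t * t = x
  t_conj : t * w * t⁻¹ = w⁻¹
  odd_card : Odd (Nat.card K)
  conj_mem : ∀ c, Commute u c → ∀ k ∈ K, c * k * c⁻¹ ∈ K
  commutator_mem : ∀ c, Commute u c → ∀ b ∈ Subgroup.zpowers w, c * b * c⁻¹ * b⁻¹ ∈ K
  exists_eq_mul : ∀ c, Commute u c → ∃ b ∈ Subgroup.zpowers w, ∃ k ∈ K, c = b * k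

namespace IsLoneInvolution

variable {x : G} (hx : IsLoneInvolution x)
include hx

theorem subtype {H : Subgroup G} (hxH : x ∈ H) : IsLoneInvolution (⟨x, hxH⟩ : H) where
  sq := Subtype.ext hx.sq
  ne_one h := hx.ne_one (congrArg Subtype.val h)
  eq_of_commute y hy hy1 hxy := Subtype.ext (hx.eq_of_commute y (congrArg Subtype.val hy)
    (fun h => hy1 (Subtype.ext h)) (congrArg Subtype.val hxy.eq))

theorem orderOf_sqrt {u : G} (hu : u * u = x) : orderOf u = 4 := by
  refine orderOf_eq_prime_pow (p := 2) (n := 1) (x := u) ?_ ?_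
  · rw [pow_one, pow_two, hu]
    exact hx.ne_one
  · rw [pow_succ, pow_one, pow_mul, pow_two, pow_two, hu, hx.sq]

theorem exists_generator_sylow_centralizer [Finite G] {u : G} (hu : u * u = x) :
    ∃ (S : Sylow 2 (Subgroup.centralizer {u})) (w : G) (a : ℕ), IsCyclic S ∧
      Subgroup.zpowers w = (S : Subgroup (Subgroup.centralizer {u})).map
        (Subgroup.centralizer {u}).subtype ∧ orderOf w = 4 * 2 ^ a ∧ w ^ 2 ^ a = u := by
  set C := Subgroup.centralizer {u} with hC
  have hcent : ∀ c, c ∈ C ↔ Commute u c :=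
    fun c => Subgroup.mem_centralizer_singleton_iff.trans eq_comm
  have huC : u ∈ C := (hcent u).2 (Commute.refl u)
  have hxC : x ∈ C := by rw [← hu]; exact mul_mem huC huC
  have hu4 : u ^ 4 = 1 := by
    rw [← hx.orderOf_sqrt hu]
    exact pow_orderOf_eq_one u
  have hzp : IsPGroup 2 (Subgroup.zpowers (⟨u, huC⟩ : C)) := by
    rintro ⟨_, k, rfl⟩
    refine ⟨2, Subtype.ext (Subtype.ext ?_)⟩
    change (u ^ k) ^ 4 = 1
    rw [← zpow_natCast, ← zpow_mul, mul_comm, zpow_mul, zpow_natCast, hu4, one_zpow]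
  obtain ⟨S, hS⟩ := hzp.exists_le_sylow
  have huS : (⟨u, huC⟩ : C) ∈ (S : Subgroup C) := hS (Subgroup.mem_zpowers _)
  have hxS : (⟨x, hxC⟩ : C) ∈ (S : Subgroup C) := by
    have : (⟨x, hxC⟩ : C) = ⟨u, huC⟩ * ⟨u, huC⟩ := Subtype.ext hu.symm
    rw [this]
    exact mul_mem huS huS
  have hcyc : IsCyclic S := by
    refine ((hx.subtype hxC).subtype hxS).isCyclic S.2 (u := ⟨⟨u, huC⟩, huS⟩) ?_ ?_ ?_
    · intro y hy hy1
      refine ((hx.subtype hxC).subtype hxS).eq_of_commute y hy hy1 (Subtype.ext (Subtype.ext ?_))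
      have h1 : Commute u (y : C) := (hcent _).1 (y : C).2
      have h2 := h1.mul_left h1
      rw [hu] at h2
      exact h2
    · intro y
      exact Subtype.ext (Subtype.ext ((hcent _).1 (y : C).2))
    · exact Subtype.ext (Subtype.ext hu)
  obtain ⟨g, hg⟩ := id hcyc
  have hmap : Subgroup.zpowers ((g : C) : G) = (S : Subgroup C).map C.subtype := by
    ext v
    constructor
    · rintro ⟨k, rfl⟩
      exact ⟨(g : C) ^ k, zpow_mem g.2 k, rfl⟩
    · rintro ⟨v, hv, rfl⟩
      obtain ⟨k, hk⟩ := hg ⟨v, hv⟩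
      exact ⟨k, congrArg (fun s : S => ((s : C) : G)) hk⟩
  obtain ⟨n, hn⟩ := S.2 g
  have hord : orderOf ((g : C) : G) ∣ 2 ^ n := orderOf_dvd_of_pow_eq_one
    (congrArg (fun s : S => ((s : C) : G)) hn)
  obtain ⟨m, -, hm⟩ := (Nat.dvd_prime_pow Nat.prime_two).1 hord
  have huz : u ∈ Subgroup.zpowers ((g : C) : G) := by
    rw [hmap]
    exact ⟨_, huS, rfl⟩
  have h4 : 4 ∣ 2 ^ m := by
    rw [← hm, ← hx.orderOf_sqrt hu]
    exact orderOf_dvd_of_mem_zpowers huz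
  obtain ⟨a, rfl⟩ : ∃ a, m = a + 2 := by
    refine ⟨m - 2, ?_⟩
    have : 2 ≤ m := (Nat.pow_dvd_pow_iff_le_right (x := 2) (by norm_num)).1 h4
    omega
  have hord' : orderOf ((g : C) : G) = 4 * 2 ^ a := by rw [hm, pow_add, mul_comm]; norm_num
  have hgu : Commute u ((g : C) : G) := (hcent _).1 (g : C).2
  set w := ((g : C) : G) with hw
  have hv : w ^ 2 ^ a * w ^ 2 ^ a = x := by
    refine hx.eq_of_commute _ ?_ ?_ ?_
    · rw [← pow_add, ← pow_add, ← pow_orderOf_eq_one w, hord']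
      congr 1
      ring
    · rw [← pow_add]
      refine pow_ne_one_of_lt_orderOf (by positivity) ?_
      have : 0 < 2 ^ a := by positivity
      omega
    · rw [← hu]
      have := hgu.pow_right (2 ^ a)
      exact (this.mul_left this).mul_right (this.mul_left this)
  rcases hx.eq_or_eq_of_commute hu hv (hgu.pow_right _) with h | h
  · exact ⟨S, w, a, hcyc, hmap, hord', h⟩
  · exact ⟨S, w⁻¹, a, hcyc, by rw [Subgroup.zpowers_inv, hmap], by rw [orderOf_inv, hord'],
      by rw [inv_pow, h, inv_inv]⟩

theorem isCentralModOdd_or_quaternionData [Finite G] {u : G} (hu : u * u = x) :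
    IsCentralModOdd x ∨ Nonempty (QuaternionData x u) := by
  obtain ⟨S, w, a, hcyc, hmap, hord, hwu⟩ := hx.exists_generator_sylow_centralizer hu
  have hcent : ∀ c, c ∈ Subgroup.centralizer {u} ↔ Commute u c :=
    fun c => Subgroup.mem_centralizer_singleton_iff.trans eq_comm
  have huC := (hcent u).2 (Commute.refl u)
  have huw : u ∈ Subgroup.zpowers w := ⟨(2 ^ a : ℕ), by rw [← hwu]; exact zpow_natCast w _⟩
  have hxw : x ∈ Subgroup.zpowers w := by rw [← hu]; exact mul_mem huw huw
  have hwp : IsPGroup 2 (Subgroup.zpowers w) := by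
    rw [hmap]
    exact S.2.map _
  have hmax : ∀ Q : Subgroup G, IsPGroup 2 Q → Subgroup.zpowers w ≤ Q → ∀ s ∈ Q, Commute u s →
      s ∈ Subgroup.zpowers w := by
    intro Q hQ hle s hs hus
    have h1 : Q.subgroupOf (Subgroup.centralizer {u}) = S := by
      refine S.3 (hQ.comap_subtype) ?_
      intro v hv
      refine Subgroup.mem_subgroupOf.2 (hle ?_)
      rw [hmap]
      exact ⟨v, hv, rfl⟩
    rw [hmap]
    refine ⟨⟨s, (hcent s).2 hus⟩, ?_, rfl⟩
    rw [SetLike.mem_coe, ← h1]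
    exact Subgroup.mem_subgroupOf.2 hs
  obtain ⟨Q, hQ⟩ := hwp.exists_le_sylow
  rcases hQ.eq_or_lt with heq | hlt
  · left
    refine isCentralModOdd_of_isCyclic hx.sq hx.ne_one Q ?_
    rw [← heq]
    infer_instance
  right
  have hinv : ∀ s ∈ Q, s ∉ Subgroup.zpowers w → (∀ b ∈ Subgroup.zpowers w,
      s * b * s⁻¹ ∈ Subgroup.zpowers w) → s * s = x := by
    intro s hs hsw hnorm
    have hsu : s * u * s⁻¹ = u⁻¹ := by
      have h1 : s * u * s⁻¹ * (s * u * s⁻¹) = x := by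
        have hxs := hx.commute_of_isPGroup Q.2 (hQ hxw) s hs
        calc s * u * s⁻¹ * (s * u * s⁻¹) = s * (u * u) * s⁻¹ := by group
          _ = x := by rw [hu, ← hxs.eq, mul_inv_cancel_right]
      have h2 : Commute u (s * u * s⁻¹) := by
        obtain ⟨j, hj⟩ := hnorm u huw
        obtain ⟨i, hi⟩ := huw
        rw [← hj, ← hi]
        exact ((Commute.refl w).zpow_left i).zpow_right j
      rcases hx.eq_or_eq_of_commute hu h1 h2 with h | h
      · exact (hsw (hmax Q Q.2 hQ s hs (mul_inv_eq_iff_eq_mul.1 h).symm)).elim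
      · exact h
    have hssu : Commute u (s * s) := by
      have h2 : s * s * u * (s * s)⁻¹ = u := by
        calc s * s * u * (s * s)⁻¹ = s * (s * u * s⁻¹) * s⁻¹ := by group
          _ = (s * u * s⁻¹)⁻¹ := by rw [hsu, ← conj_inv, hsu]
          _ = u := by rw [hsu, inv_inv]
      exact (mul_inv_eq_iff_eq_mul.1 h2).symm
    have hs4 : s * s * (s * s) = 1 := by
      by_contra h4
      obtain ⟨n, hn⟩ := Q.2 ⟨s, hs⟩
      have hn' : (s * s) ^ 2 ^ n = 1 := by
        have : s ^ 2 ^ n = 1 := congrArg Subtype.val hn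
        rw [← pow_two, ← pow_mul, mul_comm, pow_mul, this, one_pow]
      obtain ⟨k, hk⟩ := hx.mem_zpowers_of_commute hu hn' h4 hssu
      have h5 : s * u * s⁻¹ = u := by
        rw [← hk]
        have : Commute s ((s * s) ^ k) :=
          ((Commute.refl s).mul_right (Commute.refl s)).zpow_right k
        exact mul_inv_eq_iff_eq_mul.2 this.eq
      exact hsw (hmax Q Q.2 hQ s hs (mul_inv_eq_iff_eq_mul.1 h5).symm)
    refine hx.eq_of_isPGroup Q.2 (hQ hxw) (mul_mem hs hs) hs4 fun h1 => hsw ?_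
    by_cases hs1 : s = 1
    · rw [hs1]
      exact one_mem _
    · rw [hx.eq_of_isPGroup Q.2 (hQ hxw) hs h1 hs1]
      exact hxw
  obtain ⟨t, htQ, htw, htn⟩ : ∃ t ∈ Q, t ∉ Subgroup.zpowers w ∧
      ∀ b ∈ Subgroup.zpowers w, t * b * t⁻¹ ∈ Subgroup.zpowers w := by
    have hnil : Group.IsNilpotent Q := Q.2.isNilpotent
    have h1 : (Subgroup.zpowers w).subgroupOf Q < ⊤ := by
      rw [lt_top_iff_ne_top]
      intro h
      exact hlt.not_ge (Subgroup.subgroupOf_eq_top.1 h)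
    have h2 := Group.normalizerCondition_of_isNilpotent _ h1
    obtain ⟨s, hs, hs'⟩ := SetLike.exists_of_lt h2
    refine ⟨s, s.2, fun h => hs' (Subgroup.mem_subgroupOf.2 h), fun b hb => ?_⟩
    exact Subgroup.mem_subgroupOf.1 ((Subgroup.mem_normalizer_iff.1 hs ⟨b, hQ hb⟩).1
      (Subgroup.mem_subgroupOf.2 hb))
  have hww := Subgroup.mem_zpowers w
  have ht := hinv t htQ htw htn
  have htw2 := hinv (t * w) (mul_mem htQ (hQ hww))
    (fun h => htw ((Subgroup.mul_mem_cancel_right _ hww).1 h)) (fun b hb => by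
      have := htn _ (mul_mem (mul_mem hww hb) (inv_mem hww))
      simpa only [mul_inv_rev, mul_assoc] using this)
  have h2 : 2 ∣ Nat.card (Subgroup.centralizer {u}) := by
    have h4 := Subgroup.orderOf_dvd_natCard _ huC
    rw [hx.orderOf_sqrt hu] at h4
    exact dvd_trans (by norm_num) h4
  obtain ⟨K, hK, hodd, hcomm, hcompl⟩ := exists_normal_complement_of_isCyclic h2 S hcyc
  refine ⟨⟨w, t, a, K.map (Subgroup.centralizer {u}).subtype, hord, hwu, ht, ?_, ?_, ?_, ?_,
    ?_⟩⟩
  · rw [mul_inv_eq_iff_eq_mul, eq_inv_mul_iff_mul_eq, ← mul_left_cancel_iff (a := t), ht, ← htw2]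
    simp only [mul_assoc]
  · rwa [Subgroup.card_map_of_injective (Subgroup.subtype_injective _)]
  · rintro c hc _ ⟨k, hk, rfl⟩
    exact ⟨_, hK.conj_mem k hk ⟨c, (hcent c).2 hc⟩, rfl⟩
  · intro c hc b hb
    rw [hmap] at hb
    obtain ⟨b, -, rfl⟩ := hb
    exact ⟨_, hcomm ⟨c, (hcent c).2 hc⟩ b, rfl⟩
  · intro c hc
    obtain ⟨⟨b, k⟩, hbk⟩ := hcompl.symm.2 ⟨c, (hcent c).2 hc⟩
    refine ⟨b, ?_, k, ⟨k, k.2, rfl⟩, (congrArg Subtype.val hbk).symm⟩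
    rw [hmap]
    exact ⟨b, b.2, rfl⟩

end IsLoneInvolution

end QuaternionData

section QuaternionData

variable {G : Type u} [Group G] {x u : G}

namespace QuaternionData

variable (D : QuaternionData x u)
include D

theorem pow_two_pow_eq_one {b : G} (hb : b ∈ Subgroup.zpowers D.w) : b ^ 2 ^ (D.a + 2) = 1 := by
  have : orderOf b ∣ 2 ^ (D.a + 2) := by
    rw [pow_add, mul_comm, show 2 ^ 2 = 4 by norm_num, ← D.orderOf_w]
    exact orderOf_dvd_of_mem_zpowers hb
  exact orderOf_dvd_iff_pow_eq_one.1 this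

theorem mem_zpowers_w : u ∈ Subgroup.zpowers D.w := by
  have := pow_mem (Subgroup.mem_zpowers D.w) (2 ^ D.a)
  rwa [D.w_pow] at this

theorem commute_of_mem_zpowers {b c : G} (hb : b ∈ Subgroup.zpowers D.w)
    (hc : c ∈ Subgroup.zpowers D.w) : Commute b c := by
  obtain ⟨i, rfl⟩ := hb
  obtain ⟨j, rfl⟩ := hc
  exact ((Commute.refl D.w).zpow_left i).zpow_right j

theorem eq_one_of_mem_of_mem {k : G} (hk : k ∈ D.K) (hkw : k ∈ Subgroup.zpowers D.w) : k = 1 := by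
  have h1 := Subgroup.orderOf_dvd_natCard _ hk
  have h2 := orderOf_dvd_of_pow_eq_one (D.pow_two_pow_eq_one hkw)
  exact orderOf_eq_one_iff.1 (Nat.eq_one_of_dvd_coprimes
    ((Nat.coprime_two_left.2 D.odd_card).pow_left _) h2 h1)

theorem mem_K_of_odd_orderOf [Finite G] {c : G} (hc : Commute u c) (hodd : Odd (orderOf c)) :
    c ∈ D.K := by
  obtain ⟨b, hb, k, hk, rfl⟩ := D.exists_eq_mul c hc
  have hub : Commute u b := D.commute_of_mem_zpowers D.mem_zpowers_w hb
  have hpow : ∀ m : ℕ, (b ^ m)⁻¹ * (b * k) ^ m ∈ D.K := by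
    intro m
    induction m with
    | zero => simp [one_mem]
    | succ m ih =>
      have h1 := mul_mem (D.conj_mem b⁻¹ hub.inv_right _ ih) hk
      convert h1 using 1
      rw [pow_succ, pow_succ]
      group
  have h1 := hpow (orderOf (b * k))
  rw [pow_orderOf_eq_one, mul_one] at h1
  have h2 : b ^ orderOf (b * k) = 1 :=
    D.eq_one_of_mem_of_mem (by simpa using inv_mem h1) (pow_mem hb _)
  have h3 : b = 1 := orderOf_eq_one_iff.1 (Nat.eq_one_of_dvd_coprimes
    ((Nat.coprime_two_left.2 hodd).pow_left _)
    (orderOf_dvd_of_pow_eq_one (D.pow_two_pow_eq_one hb)) (orderOf_dvd_of_pow_eq_one h2))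
  rwa [h3, one_mul]

theorem conj_t {b : G} (hb : b ∈ Subgroup.zpowers D.w) : D.t * b * D.t⁻¹ = b⁻¹ := by
  obtain ⟨i, rfl⟩ := hb
  change D.t * D.w ^ i * D.t⁻¹ = (D.w ^ i)⁻¹
  rw [← conj_zpow, D.t_conj, inv_zpow]

variable (hx : IsLoneInvolution x) (hu : u * u = x)
include hx hu

theorem mem_zpowers {b : G} (hb : b ∈ Subgroup.zpowers D.w) (hb2 : b * b ≠ 1) :
    u ∈ Subgroup.zpowers b :=
  hx.mem_zpowers_of_commute hu (D.pow_two_pow_eq_one hb) hb2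
    (D.commute_of_mem_zpowers D.mem_zpowers_w hb)

theorem commute_of_commute {b c : G} (hb : b ∈ Subgroup.zpowers D.w) (hb2 : b * b ≠ 1)
    (hc : Commute b c) : Commute u c := by
  obtain ⟨k, hk⟩ := D.mem_zpowers hx hu hb hb2
  rw [← hk]
  exact hc.zpow_left k

theorem card_centralizer [Finite G] {b : G} (hb : b ∈ Subgroup.zpowers D.w) (hb2 : b * b ≠ 1) :
    Nat.card (Subgroup.centralizer {b}) =
      4 * 2 ^ D.a * Nat.card (D.K ⊓ Subgroup.centralizer {b} : Subgroup G) := by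
  have hcent : ∀ c, c ∈ Subgroup.centralizer {b} ↔ Commute b c :=
    fun c => Subgroup.mem_centralizer_singleton_iff.trans eq_comm
  rw [← D.orderOf_w, ← Nat.card_zpowers, ← Nat.card_prod]
  have hwb : ∀ v ∈ Subgroup.zpowers D.w, v ∈ Subgroup.centralizer {b} := fun v hv =>
    (hcent v).2 (D.commute_of_mem_zpowers hb hv)
  refine (Nat.card_congr (Equiv.ofBijective (fun p : Subgroup.zpowers D.w ×
    (D.K ⊓ Subgroup.centralizer {b} : Subgroup G) => (⟨p.1 * p.2, mul_mem (hwb _ p.1.2) p.2.2.2⟩ :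
      Subgroup.centralizer {b})) ⟨?_, ?_⟩)).symm
  · rintro ⟨⟨v, hv⟩, ⟨n, hn⟩⟩ ⟨⟨v', hv'⟩, ⟨n', hn'⟩⟩ h
    have h1 : v * n = v' * n' := congrArg Subtype.val h
    have h2 : v'⁻¹ * v = n' * n⁻¹ := by
      rw [inv_mul_eq_iff_eq_mul, ← mul_assoc, ← h1, mul_inv_cancel_right]
    have h3 : v'⁻¹ * v = 1 := D.eq_one_of_mem_of_mem
      (by rw [h2]; exact mul_mem hn'.1 (inv_mem hn.1)) (mul_mem (inv_mem hv') hv)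
    obtain rfl : v = v' := (inv_mul_eq_one.1 h3).symm
    obtain rfl : n = n' := mul_left_cancel h1
    rfl
  · rintro ⟨c, hc⟩
    obtain ⟨v, hv, k, hk, rfl⟩ := D.exists_eq_mul c
      (D.commute_of_commute hx hu hb hb2 ((hcent c).1 hc))
    exact ⟨⟨⟨v, hv⟩, ⟨k, hk, (Subgroup.mul_mem_cancel_left _ (hwb v hv)).1 hc⟩⟩, rfl⟩

theorem eq_or_eq_of_conj {b c y : G} (hb : b ∈ Subgroup.zpowers D.w)
    (hc : c ∈ Subgroup.zpowers D.w) (hb2 : b * b ≠ 1) (hy : y * b * y⁻¹ = c) :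
    b = c ∨ b = c⁻¹ := by
  obtain ⟨k, hk⟩ := D.mem_zpowers hx hu hb hb2
  have hconj : ∀ y, y * b * y⁻¹ ∈ Subgroup.zpowers D.w →
      y * u * y⁻¹ ∈ Subgroup.zpowers D.w := by
    intro y hy
    have h1 : y * u * y⁻¹ = (y * b * y⁻¹) ^ k := by
      rw [conj_zpow, ← hk]
    rw [h1]
    exact zpow_mem hy k
  have hfix : ∀ y, y * b * y⁻¹ ∈ Subgroup.zpowers D.w → y * u * y⁻¹ = u →
      b = y * b * y⁻¹ := by
    intro y hy hyu
    have h1 := D.commutator_mem y (mul_inv_eq_iff_eq_mul.1 hyu).symm b hb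
    have h2 := D.eq_one_of_mem_of_mem h1 (mul_mem hy (inv_mem hb))
    exact (mul_inv_eq_one.1 h2).symm
  have hyw : y * b * y⁻¹ ∈ Subgroup.zpowers D.w := by rwa [hy]
  have hsq : y * u * y⁻¹ * (y * u * y⁻¹) = x := by
    have h1 : y * u * y⁻¹ * (y * u * y⁻¹) = y * x * y⁻¹ := by rw [← hu]; group
    rw [h1]
    refine hx.eq_of_commute _ ?_ ?_ ?_
    · calc y * x * y⁻¹ * (y * x * y⁻¹) = y * (x * x) * y⁻¹ := by group
        _ = 1 := by rw [hx.sq, mul_one, mul_inv_cancel]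
    · rw [Ne, conj_eq_one_iff]
      exact hx.ne_one
    · rw [← h1, ← hu]
      have := D.commute_of_mem_zpowers D.mem_zpowers_w (hconj y hyw)
      exact (this.mul_left this).mul_right (this.mul_left this)
  rcases hx.eq_or_eq_of_commute hu hsq (D.commute_of_mem_zpowers D.mem_zpowers_w (hconj y hyw))
    with h | h
  · exact Or.inl ((hfix y hyw h).trans hy)
  · right
    have h1 : D.t * y * b * (D.t * y)⁻¹ = c⁻¹ := by
      rw [← D.conj_t hc, ← hy]
      group
    have h2 : D.t * y * u * (D.t * y)⁻¹ = u := by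
      calc D.t * y * u * (D.t * y)⁻¹ = D.t * (y * u * y⁻¹) * D.t⁻¹ := by group
        _ = u := by rw [h, D.conj_t (inv_mem D.mem_zpowers_w), inv_inv]
    rw [← h1]
    exact hfix _ (by rw [h1]; exact inv_mem hc) h2

end QuaternionData

namespace GroupChar.CharTable

variable [Fintype G] (X : CharTable G)

theorem χ_inv_eq (D : QuaternionData x u) (i : X.ι) {b : G} (hb : b ∈ Subgroup.zpowers D.w) :
    X.χ i b⁻¹ = X.χ i b := by
  rw [← D.conj_t hb, χ_conj]

theorem form_inv_left (D : QuaternionData x u) {b : G} (hb : b ∈ Subgroup.zpowers D.w) (c : G) :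
    X.form b⁻¹ c = X.form b c :=
  Finset.sum_congr rfl fun i _ => by rw [X.χ_inv_eq D i hb]

theorem form_inv_right (D : QuaternionData x u) {b : G} (hb : b ∈ Subgroup.zpowers D.w) (c : G) :
    X.form c b⁻¹ = X.form c b :=
  Finset.sum_congr rfl fun i _ => by rw [X.χ_inv_eq D i hb]

theorem form_self (hx : IsLoneInvolution x) (hu : u * u = x) (D : QuaternionData x u) {b : G}
    (hb : b ∈ Subgroup.zpowers D.w) (hb2 : b * b ≠ 1) : X.form b b = 4 * 2 ^ D.a := by
  have hcent : ∀ c, c ∈ Subgroup.centralizer {b} ↔ Commute b c :=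
    fun c => Subgroup.mem_centralizer_singleton_iff.trans eq_comm
  have hN : Odd (Nat.card (D.K ⊓ Subgroup.centralizer {b} : Subgroup G)) :=
    D.odd_card.of_dvd_nat (Subgroup.card_dvd_of_le inf_le_left)
  have h := X.card_mul_form (D.pow_two_pow_eq_one hb) hN (fun n hn => ((hcent n).1 hn.2).eq.symm)
    (fun c hc n hn => ⟨D.conj_mem c (D.commute_of_commute hx hu hb hb2 hc.symm) n hn.1,
      (Subgroup.centralizer {b}).mul_mem (mul_mem ((hcent c).2 hc.symm) hn.2)
        (inv_mem ((hcent c).2 hc.symm))⟩)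
    (fun c hc hodd => ⟨D.mem_K_of_odd_orderOf (D.commute_of_commute hx hu hb hb2 hc.symm) hodd,
      (hcent c).2 hc.symm⟩)
  rw [D.card_centralizer hx hu hb hb2, X.form_inv_left D hb] at h
  refine mul_left_cancel₀ (by exact_mod_cast hN.pos.ne') (h.trans ?_)
  push_cast
  ring

theorem form_eq_zero (hx : IsLoneInvolution x) (hu : u * u = x) (D : QuaternionData x u) {b c : G}
    (hb : b ∈ Subgroup.zpowers D.w) (hc : c ∈ Subgroup.zpowers D.w) (hb2 : b * b ≠ 1)
    (h1 : c ≠ b) (h2 : c ≠ b⁻¹) : X.form b c = 0 := by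
  refine X.form_eq_zero_of_two_elements (D.pow_two_pow_eq_one hb) (D.pow_two_pow_eq_one hc)
    fun y hy => ?_
  have hy' : y⁻¹ * b * y⁻¹⁻¹ = c⁻¹ := by
    rw [eq_inv_of_mul_eq_one_left (a := y⁻¹ * b * y⁻¹⁻¹) (b := c)]
    rw [← inv_inv b, ← hy]
    group
  rcases D.eq_or_eq_of_conj hx hu hb (inv_mem hc) hb2 hy' with h | h
  · exact h2 (by rw [h, inv_inv])
  · exact h1 (by rw [h, inv_inv])

section Orthogonality

variable {b : G} {n : ℕ} (hb : b ^ 2 ^ n = 1) (hb2 : b * b ≠ 1) (hxx : x * x = 1)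
include hb hb2

theorem sum_χ_mul_d : ∑ i ∈ X.B, X.χ i b * X.d i = 0 := by
  have h := X.form_eq_zero_of_odd_orderOf hb (h := 1) (by rintro rfl; simp at hb2) (by simp)
  rw [← h]
  exact Finset.sum_congr rfl fun i _ => by rw [χ_one]

theorem sum_χ_mul_χ_sq_div (h : IsOddlyIsolated x) :
    ∑ i ∈ X.B, X.χ i b * (X.χ i x ^ 2 / X.d i) = 0 := by
  have hc : (Fintype.card G : ℂ) ≠ 0 := by exact_mod_cast Fintype.card_ne_zero
  have h1 : ∀ i, X.χ i x ^ 2 / X.d i = (Fintype.card G : ℂ)⁻¹ *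
      ∑ g, X.χ i (g * x * g⁻¹ * x) := by
    intro i
    have h2 : X.d i * ∑ g, X.χ i (g * x * g⁻¹ * x) =
      Fintype.card G * (X.χ i x * X.χ i x) := X.sum_conj i x x
    rw [div_eq_iff (X.d_ne_zero i), mul_assoc, mul_comm _ (X.d i : ℂ), h2, pow_two,
      inv_mul_cancel_left₀ hc]
  simp only [h1, Finset.mul_sum]
  rw [Finset.sum_comm]
  refine Finset.sum_eq_zero fun g _ => ?_
  have h3 : X.form b (g * x * g⁻¹ * x) = 0 := by
    refine X.form_eq_zero_of_odd_orderOf hb (by rintro rfl; simp at hb2) ?_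
    rw [SemiconjBy.orderOf_eq x (y := x * (g * x * g⁻¹))
      (by simp only [SemiconjBy, mul_assoc])]
    exact h g
  calc _ = (Fintype.card G : ℂ)⁻¹ * X.form b (g * x * g⁻¹ * x) := by
        rw [form, Finset.mul_sum]
        exact Finset.sum_congr rfl fun i _ => by ring
    _ = 0 := by rw [h3, mul_zero]

include hxx

theorem sum_χ_mul_χ : ∑ i ∈ X.B, X.χ i b * X.χ i x = 0 := by
  refine X.form_eq_zero_of_two_elements (n := n + 1) (by rw [pow_succ, pow_mul, hb, one_pow])
    (by rw [pow_succ', pow_mul, pow_two, hxx, one_pow]) fun y hy => hb2 ?_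
  rw [← inv_inj, mul_inv_rev, ← hy, inv_one]
  calc y * x * y⁻¹ * (y * x * y⁻¹) = y * (x * x) * y⁻¹ := by group
    _ = 1 := by rw [hxx, mul_one, mul_inv_cancel]

end Orthogonality

end GroupChar.CharTable

end QuaternionData

theorem isIdempotentElem_average {A : Type*} [Ring A] [Algebra ℂ A] {y : A} {q : ℕ} (hq : q ≠ 0)
    (hy : y ^ q = 1) : ((q : ℂ)⁻¹ • ∑ j ∈ Finset.range q, y ^ j) *
      ((q : ℂ)⁻¹ • ∑ j ∈ Finset.range q, y ^ j) = (q : ℂ)⁻¹ • ∑ j ∈ Finset.range q, y ^ j := by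
  have hq' : (q : ℂ) ≠ 0 := by exact_mod_cast hq
  have h1 : y * ∑ j ∈ Finset.range q, y ^ j = ∑ j ∈ Finset.range q, y ^ j := by
    have := mul_geom_sum y q
    rw [hy, sub_self, sub_mul, one_mul, sub_eq_zero] at this
    exact this
  have h2 : ∀ k, y ^ k * ∑ j ∈ Finset.range q, y ^ j = ∑ j ∈ Finset.range q, y ^ j := by
    intro k
    induction k with
    | zero => rw [pow_zero, one_mul]
    | succ k ih => rw [pow_succ, mul_assoc, h1, ih]
  rw [smul_mul_smul_comm, Finset.sum_mul, Finset.sum_congr rfl fun k _ => h2 k, Finset.sum_const,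
    Finset.card_range, ← Nat.cast_smul_eq_nsmul ℂ, smul_smul, mul_assoc, inv_mul_cancel₀ hq',
    mul_one]

theorem eq_or_eq_of_sum_sq_le_three {ι : Type*} {s : Finset ι} {c : ι → ℤ}
    (h : ∑ i ∈ s, c i ^ 2 ≤ 3) : ∀ i ∈ s, c i = 0 ∨ c i = 1 ∨ c i = -1 := by
  intro i hi
  have h1 : c i ^ 2 ≤ 3 := (Finset.single_le_sum (fun j _ => sq_nonneg (c j)) hi).trans h
  have h2 : c i ≤ 1 := by nlinarith
  have h3 : -1 ≤ c i := by nlinarith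
  omega

theorem card_filter_ne_zero_of_sum_sq_le_three {ι : Type*} {s : Finset ι} {c : ι → ℤ}
    (h : ∑ i ∈ s, c i ^ 2 ≤ 3) : ((s.filter fun i => c i ≠ 0).card : ℤ) = ∑ i ∈ s, c i ^ 2 := by
  rw [Finset.card_filter]
  push_cast
  refine Finset.sum_congr rfl fun i hi => ?_
  rcases eq_or_eq_of_sum_sq_le_three h i hi with h | h | h <;> simp [h]

section QuaternionData

namespace GroupChar

open CharTable

variable {G : Type u} [Group G] [Fintype G]

namespace CharTable

variable (X : CharTable G)

theorem exists_nat_average (i : X.ι) {g : G} {q : ℕ} (hq : q ≠ 0) (hg : g ^ q = 1) {ζ : ℂ}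
    (hζ : ζ ^ q = 1) :
    ∃ k : ℕ, ∑ j ∈ Finset.range q, ζ ^ j * X.χ i (g ^ j) = q * (k : ℂ) := by
  have hq' : (q : ℂ) ≠ 0 := by exact_mod_cast hq
  obtain ⟨k, hk⟩ := X.T_idem i _ (isIdempotentElem_average (y := MonoidAlgebra.single g ζ) hq
    (by rw [MonoidAlgebra.single_pow, hg, hζ]; rfl))
  refine ⟨k, ?_⟩
  rw [← hk, map_smul, smul_eq_mul, mul_inv_cancel_left₀ hq', map_sum]
  refine Finset.sum_congr rfl fun j _ => ?_
  rw [MonoidAlgebra.single_pow, χ, ← smul_eq_mul, ← map_smul, MonoidAlgebra.smul_single,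
    smul_eq_mul, mul_one]

/-- The difference between the degree of a character and its value at `x`. -/
noncomputable def defect (x : G) (i : X.ι) : ℂ := X.d i - X.χ i x

theorem defect_principal (x : G) : X.defect x X.i₀ = 0 := by
  rw [defect, χ_principal, d_principal, Nat.cast_one, sub_self]

theorem defect_ne_zero {x : G} (hx : x * x = 1) (hcl : Subgroup.normalClosure {x} = ⊤) {i : X.ι}
    (hi : i ≠ X.i₀) : X.defect x i ≠ 0 := fun h =>
  hi (X.eq_principal i x hx hcl (sub_eq_zero.1 h).symm)

section Orthogonality

variable {x b : G} {n : ℕ} (hb : b ^ 2 ^ n = 1) (hb2 : b * b ≠ 1) (hxx : x * x = 1)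
include hb hb2 hxx

theorem sum_χ_mul_defect : ∑ i ∈ X.B, X.χ i b * X.defect x i = 0 := by
  simp only [defect, mul_sub, Finset.sum_sub_distrib, X.sum_χ_mul_d hb hb2,
    X.sum_χ_mul_χ hb hb2 hxx, sub_self]

theorem sum_χ_mul_defect_sq_div (h : IsOddlyIsolated x) :
    ∑ i ∈ X.B, X.χ i b * (X.defect x i ^ 2 / X.d i) = 0 := by
  have h1 : ∀ i, X.χ i b * (X.defect x i ^ 2 / X.d i) = X.χ i b * X.d i -
      2 * (X.χ i b * X.χ i x) + X.χ i b * (X.χ i x ^ 2 / X.d i) := by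
    intro i
    have := X.d_ne_zero i
    rw [defect]
    field_simp
    ring
  simp only [h1, Finset.sum_add_distrib, Finset.sum_sub_distrib, ← Finset.mul_sum,
    X.sum_χ_mul_d hb hb2, X.sum_χ_mul_χ hb hb2 hxx, X.sum_χ_mul_χ_sq_div hb hb2 h]
  simp

end Orthogonality

variable {x : G}

theorem not_norm_three (hx : x * x = 1) (hcl : Subgroup.normalClosure {x} = ⊤) {c : X.ι → ℤ}
    (hc : c X.i₀ = 1) (hc3 : ∑ i ∈ X.B, c i ^ 2 = 3) (h1 : ∑ i ∈ X.B, (c i : ℂ) * X.d i = 0)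
    (h2 : ∑ i ∈ X.B, (c i : ℂ) * X.defect x i = 0)
    (h3 : ∑ i ∈ X.B, (c i : ℂ) * (X.defect x i ^ 2 / X.d i) = 0) : False := by
  classical
  have hs : ∑ i ∈ X.B.erase X.i₀, c i ^ 2 = 2 := by
    have := Finset.add_sum_erase X.B (fun i => c i ^ 2) X.principal_mem
    simp only [hc, hc3] at this
    linarith
  have hcard := card_filter_ne_zero_of_sum_sq_le_three (hs.trans_le (by norm_num))
  rw [hs] at hcard
  obtain ⟨i, j, hij, hS⟩ := Finset.card_eq_two.1 (by exact_mod_cast hcard :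
    ((X.B.erase X.i₀).filter fun i => c i ≠ 0).card = 2)
  have hsum : ∀ L : X.ι → ℂ, ∑ i ∈ X.B, (c i : ℂ) * L i = L X.i₀ + (c i * L i + c j * L j) := by
    intro L
    rw [← Finset.add_sum_erase X.B _ X.principal_mem, hc, Int.cast_one, one_mul,
      ← Finset.sum_pair hij (f := fun i => (c i : ℂ) * L i), ← hS, Finset.sum_filter_of_ne]
    intro k _ hk hk0
    exact hk (by rw [hk0, Int.cast_zero, zero_mul])
  have hmem : ∀ k ∈ ({i, j} : Finset X.ι), X.defect x k ≠ 0 ∧ (c k : ℂ) ≠ 0 := by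
    intro k hk
    rw [← hS, Finset.mem_filter, Finset.mem_erase] at hk
    exact ⟨X.defect_ne_zero hx hcl hk.1.1, by exact_mod_cast hk.2⟩
  obtain ⟨hmi, hci⟩ := hmem i (by simp)
  obtain ⟨hmj, hcj⟩ := hmem j (by simp)
  rw [hsum, d_principal] at h1
  rw [hsum, defect_principal] at h2
  rw [hsum, defect_principal] at h3
  have hdi := X.d_ne_zero i
  have hdj := X.d_ne_zero j
  push_cast at h1
  field_simp at h3
  have h4 : X.defect x i * X.d j = X.defect x j * X.d i := by
    have : (c i * X.defect x i) * (X.defect x i * X.d j - X.defect x j * X.d i) = 0 := by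
      linear_combination h3 - X.defect x j * X.d i * h2
    exact sub_eq_zero.1 ((mul_eq_zero.1 this).resolve_left (mul_ne_zero hci hmi))
  apply hmj
  linear_combination X.defect x j * h1 - X.d j * h2 + c i * h4

end CharTable

theorem quaternionData_a_eq_zero {x : G} (hx : IsLoneInvolution x)
    (hcl : Subgroup.normalClosure {x} = ⊤)
    (h : IsOddlyIsolated x) {u : G} (hu : u * u = x) (D : QuaternionData x u) : D.a = 0 := by
  obtain ⟨X⟩ := nonempty_charTable G
  by_contra ha
  obtain ⟨a, ha'⟩ := Nat.exists_eq_succ_of_ne_zero ha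
  obtain ⟨q, hqdef⟩ : ∃ q, q = 4 * 2 ^ D.a := ⟨_, rfl⟩
  have hq0 : q ≠ 0 := by rw [hqdef]; positivity
  have hqC : (q : ℂ) ≠ 0 := by exact_mod_cast hq0
  have hq8 : 8 ∣ q := ⟨2 ^ a, by rw [hqdef, ha', Nat.succ_eq_add_one, pow_succ]; ring⟩
  have hq4 : 4 ∣ q := dvd_trans (by norm_num) hq8
  have hwq : D.w ^ q = 1 := by rw [hqdef, ← D.orderOf_w, pow_orderOf_eq_one]
  have hI4 : Complex.I ^ 4 = 1 := Complex.I_pow_four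
  have hpow4 : ∀ {z : ℂ} {m : ℕ}, z ^ 4 = 1 → 4 ∣ m → z ^ m = 1 := by
    rintro z _ hz ⟨m, rfl⟩
    rw [pow_mul, hz, one_pow]
  let f : ℕ → ℂ := fun j => 1 - Complex.I ^ j
  have hspec : ∀ j, f j ≠ 0 → D.w ^ j * D.w ^ j ≠ 1 := by
    intro j hj hww
    refine hj ?_
    rw [← pow_add] at hww
    have h1 := hq8.trans (hqdef ▸ D.orderOf_w ▸ orderOf_dvd_of_pow_eq_one hww)
    change 1 - Complex.I ^ j = 0
    rw [hpow4 hI4 (by omega), sub_self]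
  have hmem : ∀ j : ℕ, D.w ^ j ∈ Subgroup.zpowers D.w := fun j =>
    pow_mem (Subgroup.mem_zpowers _) j
  let v : X.ι → ℂ := fun i => ∑ j ∈ Finset.range q, f j * X.χ i (D.w ^ j)
  have hv : ∀ L : X.ι → ℂ, (∀ j, f j ≠ 0 → ∑ i ∈ X.B, X.χ i (D.w ^ j) * L i = 0) →
      ∑ i ∈ X.B, v i * L i = 0 := by
    intro L hL
    simp only [v, Finset.sum_mul]
    rw [Finset.sum_comm]
    refine Finset.sum_eq_zero fun j _ => ?_
    by_cases hj : f j = 0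
    · simp [hj]
    · rw [← mul_zero (f j), ← hL j hj, Finset.mul_sum]
      exact Finset.sum_congr rfl fun i _ => mul_assoc _ _ _
  have hinner : ∀ j ∈ Finset.range q, f j ≠ 0 →
      ∑ i ∈ X.B, X.χ i (D.w ^ j) * v i = q * (f j + f (q - j)) := by
    intro j hjq hj
    rw [Finset.mem_range] at hjq
    have hw2 := hspec j hj
    have hinv : D.w ^ (q - j) = (D.w ^ j)⁻¹ :=
      eq_inv_of_mul_eq_one_left (by rw [← pow_add, Nat.sub_add_cancel hjq.le, hwq])
    have hj0 : j ≠ 0 := by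
      rintro rfl
      simp [f] at hj
    have hne : j ≠ q - j := by
      intro hh
      rw [← hh] at hinv
      exact hw2 (by nth_rw 2 [hinv]; exact mul_inv_cancel _)
    have hself : X.form (D.w ^ j) (D.w ^ j) = q := by
      rw [X.form_self hx hu D (hmem j) hw2, hqdef]
      push_cast
      ring
    have h1 : ∑ i ∈ X.B, X.χ i (D.w ^ j) * v i =
        ∑ k ∈ Finset.range q, f k * X.form (D.w ^ j) (D.w ^ k) := by
      simp only [v, form, Finset.mul_sum]
      rw [Finset.sum_comm]
      exact Finset.sum_congr rfl fun k _ => Finset.sum_congr rfl fun i _ => by ring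
    rw [h1, Finset.sum_eq_add j (q - j) hne]
    · rw [hinv, X.form_inv_right D (hmem j), hself]
      ring
    · rintro k hk ⟨hk1, hk2⟩
      have hinj : ∀ m < q, D.w ^ k = D.w ^ m → k = m := fun m hm hkm =>
        pow_injOn_Iio_orderOf (by simpa [D.orderOf_w, ← hqdef] using hk)
          (by simpa [D.orderOf_w, ← hqdef] using hm) hkm
      rw [X.form_eq_zero hx hu D (hmem j) (hmem k) hw2 (fun hh => hk1 (hinj j hjq hh))
        (fun hh => hk2 (hinj (q - j) (by omega) (by rw [hh, hinv]))), mul_zero]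
    · exact fun hh => (hh (Finset.mem_range.2 hjq)).elim
    · exact fun hh => (hh (Finset.mem_range.2 (by omega))).elim
  have hgeom : ∀ z : ℂ, z ^ 4 = 1 → z ≠ 1 → ∑ j ∈ Finset.range q, z ^ j = 0 := by
    intro z hz hz1
    rw [geom_sum_eq hz1, hpow4 hz hq4, sub_self, zero_div]
  have hI1 : Complex.I ≠ 1 := fun hh => by simpa using congrArg Complex.re hh
  have hnI1 : -Complex.I ≠ 1 := fun hh => by simpa using congrArg Complex.re hh
  have hnorm : ∑ i ∈ X.B, v i * v i = 3 * (q : ℂ) ^ 2 := by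
    have h1 : ∑ i ∈ X.B, v i * v i = ∑ j ∈ Finset.range q, q * (3 - 3 * Complex.I ^ j -
        (-Complex.I) ^ j + (-1) ^ j) := by
      have h2 : ∑ i ∈ X.B, v i * v i =
          ∑ j ∈ Finset.range q, f j * ∑ i ∈ X.B, X.χ i (D.w ^ j) * v i := by
        simp only [Finset.mul_sum]
        rw [Finset.sum_comm]
        refine Finset.sum_congr rfl fun i _ => ?_
        conv_lhs => rw [show v i * v i = (∑ j ∈ Finset.range q, f j * X.χ i (D.w ^ j)) * v i from rfl]
        rw [Finset.sum_mul]
        exact Finset.sum_congr rfl fun j _ => mul_assoc _ _ _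
      rw [h2]
      refine Finset.sum_congr rfl fun j hj => ?_
      have e1 : Complex.I ^ (q - j) = (-Complex.I) ^ j := by
        have hjq := Finset.mem_range.1 hj
        have e2 : Complex.I ^ (q - j) * Complex.I ^ j = 1 := by
          rw [← pow_add, Nat.sub_add_cancel hjq.le, hpow4 hI4 hq4]
        have e3 : (-Complex.I) ^ j * Complex.I ^ j = 1 := by
          rw [← mul_pow, neg_mul, Complex.I_mul_I, neg_neg, one_pow]
        exact mul_right_cancel₀ (pow_ne_zero j Complex.I_ne_zero) (e2.trans e3.symm)
      have e4 : Complex.I ^ j * (-Complex.I) ^ j = 1 := by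
        rw [← mul_pow, mul_neg, Complex.I_mul_I, neg_neg, one_pow]
      have e5 : Complex.I ^ j * Complex.I ^ j = (-1) ^ j := by
        rw [← mul_pow, Complex.I_mul_I]
      have e6 : f j * (q * (f j + f (q - j))) = q * (3 - 3 * Complex.I ^ j -
          (-Complex.I) ^ j + (-1) ^ j) := by
        change (1 - Complex.I ^ j) * (q * (1 - Complex.I ^ j + (1 - Complex.I ^ (q - j)))) = _
        rw [e1]
        linear_combination (q : ℂ) * e4 + (q : ℂ) * e5
      by_cases hf : f j = 0
      · rw [← e6, hf, zero_mul, zero_mul]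
      · rw [hinner j hj hf, e6]
    rw [h1, ← Finset.mul_sum, Finset.sum_add_distrib, Finset.sum_sub_distrib,
      Finset.sum_sub_distrib, ← Finset.mul_sum, hgeom _ hI4 hI1,
      hgeom _ (by rw [neg_pow, hI4]; norm_num) hnI1, hgeom (-1) (by norm_num) (by norm_num)]
    simp only [Finset.sum_const, Finset.card_range, nsmul_eq_mul]
    ring
  have hcoef : ∀ i, ∃ c : ℤ, v i = q * c := by
    intro i
    obtain ⟨k, hk⟩ := X.exists_nat_average i hq0 hwq (ζ := 1) (one_pow _)
    obtain ⟨l, hl⟩ := X.exists_nat_average i hq0 hwq (hpow4 hI4 hq4)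
    refine ⟨k - l, ?_⟩
    push_cast
    rw [mul_sub, ← hk, ← hl, ← Finset.sum_sub_distrib]
    exact Finset.sum_congr rfl fun j _ => by simp only [f]; rw [one_pow]; ring
  choose c hc using hcoef
  have hcsum : ∀ L : X.ι → ℂ, (∀ j, f j ≠ 0 → ∑ i ∈ X.B, X.χ i (D.w ^ j) * L i = 0) →
      ∑ i ∈ X.B, (c i : ℂ) * L i = 0 := by
    intro L hL
    refine (mul_eq_zero.1 ?_).resolve_left hqC
    rw [Finset.mul_sum, ← hv L hL]
    exact Finset.sum_congr rfl fun i _ => by rw [hc]; ring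
  refine X.not_norm_three hx.sq hcl (c := c) ?_ ?_
    (hcsum _ fun j hj => X.sum_χ_mul_d (D.pow_two_pow_eq_one (hmem j)) (hspec j hj))
    (hcsum _ fun j hj => X.sum_χ_mul_defect (D.pow_two_pow_eq_one (hmem j)) (hspec j hj) hx.sq)
    (hcsum _ fun j hj => X.sum_χ_mul_defect_sq_div (D.pow_two_pow_eq_one (hmem j)) (hspec j hj)
      hx.sq h)
  · have h1 := hc X.i₀
    simp only [v, f, χ_principal, mul_one, Finset.sum_sub_distrib] at h1
    rw [hgeom _ hI4 hI1] at h1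
    simp only [Finset.sum_const, Finset.card_range, nsmul_eq_mul, mul_one, sub_zero] at h1
    have h2 := mul_left_cancel₀ hqC ((mul_one (q : ℂ)).trans h1)
    exact_mod_cast h2.symm
  · have h1 : (q : ℂ) ^ 2 * ∑ i ∈ X.B, (c i : ℂ) ^ 2 = q ^ 2 * 3 := by
      rw [mul_comm _ (3 : ℂ), ← hnorm, Finset.mul_sum]
      exact Finset.sum_congr rfl fun i _ => by rw [hc]; ring
    exact_mod_cast mul_left_cancel₀ (pow_ne_zero 2 hqC) h1

end GroupChar

end QuaternionData

section Descent

theorem not_odd_odd_even {a b c l m n : ℤ} (hsum : a + b + c = -1) (hl : Odd l) (hm : Odd m)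
    (hn : Even n) (hc : Even n → c % 4 = 1)
    (h : l ^ 2 * (b * c) + m ^ 2 * (a * c) + n ^ 2 * (a * b) = 0) : False := by
  obtain ⟨k, hk⟩ : ∃ k, c = 4 * k + 1 := ⟨c / 4, by have := hc hn; omega⟩
  obtain ⟨r, rfl⟩ := hl
  obtain ⟨s, rfl⟩ := hm
  obtain ⟨t, rfl⟩ := hn
  obtain rfl : a = -2 - 4 * k - b := by linarith
  subst hk
  have : 4 * ((r ^ 2 + r) * (b * (4 * k + 1)) + (s ^ 2 + s) * ((-2 - 4 * k - b) * (4 * k + 1)) +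
      t ^ 2 * ((-2 - 4 * k - b) * b) - 4 * k ^ 2 - 3 * k) = 2 := by linear_combination h
  omega

theorem eq_zero_of_descent {a b c l m n : ℤ} (hsum : a + b + c = -1) (hlmn : l + m + n = 0)
    (ha : Even l → a % 4 = 1) (hb : Even m → b % 4 = 1) (hc : Even n → c % 4 = 1)
    (h : l ^ 2 * (b * c) + m ^ 2 * (a * c) + n ^ 2 * (a * b) = 0) : l = 0 := by
  induction hN : l.natAbs using Nat.strong_induction_on generalizing l m n with
  | _ N ih =>
    by_contra hl0
    rcases Int.even_or_odd l with hl | hl <;> rcases Int.even_or_odd m with hm | hm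
    · have hn : Even n := by
        rw [show n = -(l + m) by linarith]
        exact (hl.add hm).neg
      obtain ⟨l', rfl⟩ := hl
      obtain ⟨m', rfl⟩ := hm
      obtain ⟨n', rfl⟩ := hn
      have := @ih l'.natAbs (by omega) l' m' n' (by linarith)
        (fun _ => ha ⟨l', rfl⟩) (fun _ => hb ⟨m', rfl⟩) (fun _ => hc ⟨n', rfl⟩)
        (by linarith) rfl
      omega
    · have hn : Odd n := by
        rw [show n = -(l + m) by linarith]
        exact (hl.add_odd hm).neg
      exact not_odd_odd_even (a := c) (b := b) (c := a) (l := n) (m := m) (n := l)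
        (by linarith) hn hm hl ha (by linear_combination h)
    · have hn : Odd n := by
        rw [show n = -(l + m) by linarith]
        exact (hl.add_even hm).neg
      exact not_odd_odd_even (a := a) (b := c) (c := b) (l := l) (m := n) (n := m)
        (by linarith) hl hn hm hb (by linear_combination h)
    · have hn : Even n := by
        rw [show n = -(l + m) by linarith]
        exact (hl.add_odd hm).neg
      exact not_odd_odd_even hsum hl hm hn hc h

end Descent

section QuaternionGroup

/-- The average over a quaternion group of order eight is idempotent. -/
theorem isIdempotentElem_quaternion {A : Type*} [Ring A] [Algebra ℂ A] {u t : A}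
    (hu : u ^ 4 = 1) (ht : t * t = u * u) (htu : t * u = u * u * u * t) {p : A}
    (hp : p = (8 : ℂ)⁻¹ • ((1 + u + u * u + u * u * u) * (1 + t))) : p * p = p := by
  obtain ⟨s, hs⟩ : ∃ s, s = 1 + u + u * u + u * u * u := ⟨_, rfl⟩
  rw [← hs] at hp
  have hu' : u * u * u * u = 1 := by rw [← hu]; noncomm_ring
  have hus : u * s = s := by
    rw [hs]
    simp only [mul_add, mul_one, ← mul_assoc, hu']
    abel
  have huus : u * u * s = s := by rw [mul_assoc, hus, hus]
  have huuus : u * u * u * s = s := by rw [mul_assoc, hus, huus]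
  have hss : s * s = (4 : ℂ) • s := by
    nth_rw 1 [hs]
    rw [add_mul, add_mul, add_mul, one_mul, hus, huus, huuus, ← two_smul ℂ s, ← one_smul ℂ s,
      smul_smul, ← add_smul, ← add_smul]
    norm_num
  have htuu : t * (u * u) = u * u * t := by
    calc t * (u * u) = t * u * u := (mul_assoc _ _ _).symm
      _ = u * u * u * (t * u) := (congrArg (· * u) htu).trans (mul_assoc _ _ _)
      _ = u * u * u * u * (u * u) * t := by rw [htu]; noncomm_ring
      _ = u * u * t := by rw [hu', one_mul]
  have htuuu : t * (u * u * u) = u * t := by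
    calc t * (u * u * u) = t * (u * u) * u := (mul_assoc _ _ _).symm
      _ = u * u * (t * u) := by rw [htuu, mul_assoc]
      _ = u * u * u * u * u * t := by rw [htu]; noncomm_ring
      _ = u * t := by rw [hu', one_mul]
  have hts : t * s = s * t := by
    rw [hs]
    simp only [mul_add, add_mul, htu, htuu, htuuu, mul_one, one_mul]
    abel
  have hst : (1 + t) * s = s * (1 + t) := by rw [add_mul, mul_add, hts, one_mul, mul_one]
  have hsuu : s * (u * u) = s := by
    rw [hs]
    simp only [add_mul, one_mul, ← mul_assoc, hu']
    abel
  have h1 : s * ((1 + t) * (1 + t)) = (2 : ℂ) • (s * (1 + t)) := by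
    have : (1 + t) * (1 + t) = 1 + (2 : ℂ) • t + u * u := by
      rw [← ht, two_smul]
      noncomm_ring
    rw [this, mul_add, mul_add, hsuu, mul_one, mul_smul_comm, mul_add, mul_one, smul_add, two_smul ℂ s]
    abel
  rw [hp, smul_mul_smul_comm, mul_assoc, ← mul_assoc (1 + t), hst, mul_assoc s (1 + t), h1,
    mul_smul_comm, ← mul_assoc, hss, smul_mul_assoc, smul_smul, smul_smul]
  norm_num

namespace GroupChar

open CharTable

variable {G : Type u} [Group G] [Fintype G]

namespace CharTable

variable (X : CharTable G) {x : G}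

theorem exists_nat_quaternion (i : X.ι) {u t : G} (hu : u ^ 4 = 1) (ht : t * t = u * u)
    (htu : t * u = u * u * u * t) :
    ∃ k : ℕ, X.χ i 1 + X.χ i u + X.χ i (u * u) + X.χ i (u * u * u) +
      (X.χ i t + X.χ i (u * t) + X.χ i (u * u * t) + X.χ i (u * u * u * t)) = 8 * (k : ℂ) := by
  obtain ⟨k, hk⟩ := X.T_idem i _ (isIdempotentElem_quaternion
    (u := (MonoidAlgebra.single u 1 : MonoidAlgebra ℂ G)) (t := MonoidAlgebra.single t 1)
    (by rw [MonoidAlgebra.single_pow, hu, one_pow]; rfl)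
    (by simp only [MonoidAlgebra.single_mul_single, ht])
    (by simp only [MonoidAlgebra.single_mul_single, htu, mul_one]) rfl)
  refine ⟨k, ?_⟩
  rw [← hk, map_smul, smul_eq_mul, mul_inv_cancel_left₀ (by norm_num)]
  rw [show (1 : MonoidAlgebra ℂ G) = MonoidAlgebra.single 1 1 from rfl]
  simp only [mul_add, add_mul, MonoidAlgebra.single_mul_single, map_add, mul_one, one_mul, χ]

/-- Character values on square roots of `x` and defects of `x` are integers. -/
theorem exists_int_of_sq_eq (hxx : x * x = 1) (i : X.ι) {v : G} (hv : v * v = x)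
    (hinv : X.χ i v⁻¹ = X.χ i v) :
    ∃ (α m : ℤ), X.χ i v = α ∧ X.defect x i = 4 * m ∧ (Even α ↔ Even (X.d i)) := by
  have hv4 : v ^ 4 = 1 := by rw [show 4 = 2 * 2 by rfl, pow_mul, pow_two v, hv, pow_two, hxx]
  have hv3 : v ^ 3 = v⁻¹ := eq_inv_of_mul_eq_one_left (by rw [← pow_succ, hv4])
  have hv2 : v ^ 2 = x := by rw [pow_two, hv]
  obtain ⟨k, hk⟩ := X.exists_nat_average i (q := 4) (by norm_num) hv4 (ζ := 1) (one_pow _)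
  obtain ⟨l, hl⟩ := X.exists_nat_average i (q := 4) (by norm_num) hv4 Complex.I_pow_four
  simp only [Finset.sum_range_succ, Finset.sum_range_zero, pow_zero, pow_one, hv2, hv3, hinv,
    one_pow, one_mul, zero_add, Complex.I_sq, Complex.I_pow_three, χ_one] at hk hl
  push_cast at hk hl
  refine ⟨2 * k - X.d i + 2 * l, l, ?_, ?_, ?_⟩
  · push_cast
    linear_combination hk / 2 + hl / 2
  · rw [defect]
    push_cast
    linear_combination hl
  · rw [← Int.even_coe_nat]
    simp [Int.even_add, Int.even_sub]

end CharTable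

end GroupChar

end QuaternionGroup

namespace GroupChar

open CharTable

variable {G : Type u} [Group G] [Fintype G]

namespace CharTable

variable (X : CharTable G) {x : G}

/-- The nonprincipal characters in `B` of odd degree. -/
noncomputable def oddPart : Finset X.ι :=
  open scoped Classical in (X.B.erase X.i₀).filter fun i => Odd (X.d i)

theorem exists_signs (hxx : x * x = 1) {v : G} (hv : v * v = x)
    (hinv : ∀ i, X.χ i v⁻¹ = X.χ i v) (hform : X.form v v = 4) :
    X.oddPart.card = 3 ∧ ∃ α : X.ι → ℤ, (∀ i, X.χ i v = α i) ∧
      (∀ i ∈ X.oddPart, α i = 1 ∨ α i = -1) ∧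
      ∀ L : X.ι → ℂ, ∑ i ∈ X.B, X.χ i v * L i = L X.i₀ + ∑ i ∈ X.oddPart, (α i : ℂ) * L i := by
  classical
  choose α m hα _ hpar using fun i => X.exists_int_of_sq_eq hxx i hv (hinv i)
  have hα0 : α X.i₀ = 1 := by
    have := hα X.i₀
    rw [χ_principal] at this
    exact_mod_cast this.symm
  have hsum : ∑ i ∈ X.B, α i ^ 2 = 4 := by
    have h1 : X.form v v = ((∑ i ∈ X.B, α i ^ 2 : ℤ) : ℂ) := by
      push_cast
      exact Finset.sum_congr rfl fun i _ => by rw [hα, pow_two]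
    rw [hform] at h1
    exact_mod_cast h1.symm
  have hs : ∑ i ∈ X.B.erase X.i₀, α i ^ 2 = 3 := by
    have := Finset.add_sum_erase X.B (fun i => α i ^ 2) X.principal_mem
    simp only [hα0, hsum] at this
    linarith
  have hval := eq_or_eq_of_sum_sq_le_three hs.le
  have hne : ∀ i ∈ X.B.erase X.i₀, α i ≠ 0 ↔ Odd (X.d i) := by
    intro i hi
    rw [← Nat.not_even_iff_odd, ← hpar i]
    rcases hval i hi with h | h | h <;> simp [h]
  have hS : X.oddPart = (X.B.erase X.i₀).filter fun i => α i ≠ 0 := by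
    rw [oddPart]
    exact (Finset.filter_congr hne).symm
  have hcard := card_filter_ne_zero_of_sum_sq_le_three hs.le
  rw [hs, ← hS] at hcard
  refine ⟨by exact_mod_cast hcard, α, hα, fun i hi => ?_, fun L => ?_⟩
  · rw [hS, Finset.mem_filter] at hi
    exact (hval i hi.1).resolve_left hi.2
  · simp only [hα]
    rw [← Finset.add_sum_erase X.B _ X.principal_mem, hα0, Int.cast_one, one_mul, hS,
      Finset.sum_filter_of_ne]
    intro k _ hk hk0
    exact hk (by rw [hk0, Int.cast_zero, zero_mul])

end CharTable

/-- If every square root `v` of the involution `x` is real for `X` and satisfies `X.form v v = 4`, then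
`x` is not the square of `u` and `t` generating a quaternion group of order eight. -/
theorem not_quaternion {x : G} (hxx : x * x = 1) (hx1 : x ≠ 1)
    (hcl : Subgroup.normalClosure {x} = ⊤)
    (h : IsOddlyIsolated x) (X : CharTable G)
    (hroot : ∀ v : G, v * v = x → (∀ i, X.χ i v⁻¹ = X.χ i v) ∧ X.form v v = 4)
    {u t : G} (hu : u * u = x) (ht : t * t = x) (htu : t * u * t⁻¹ = u⁻¹) : False := by
  classical
  have hinv : ∀ v : G, v * v = x → v * v * v = v⁻¹ := fun v hv =>
    eq_inv_of_mul_eq_one_left (by rw [mul_assoc, hv, hxx])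
  have hpow : ∀ v : G, v * v = x → v ^ 2 ^ 2 = 1 := fun v hv => by
    rw [pow_two 2, pow_mul, pow_two v, hv, pow_two, hxx]
  have hne : ∀ v : G, v * v = x → v * v ≠ 1 := fun v hv => by rwa [hv]
  have htu' : t * u = u⁻¹ * t := by rw [← htu, inv_mul_cancel_right]
  have hut : u * t * (u * t) = x := by
    rw [mul_assoc, ← mul_assoc t, htu', mul_assoc, ht, mul_inv_cancel_left]
  obtain ⟨hcard, α, hα, hα1, hαL⟩ := X.exists_signs hxx hu (hroot u hu).1 (hroot u hu).2
  obtain ⟨j, k, l, hjk, hjl, hkl, hS⟩ := Finset.card_eq_three.1 hcard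
  choose _ m _ hm _ using fun i => X.exists_int_of_sq_eq hxx i hu ((hroot u hu).1 i)
  have hm0 : ∀ i ∈ X.oddPart, m i ≠ 0 := by
    intro i hi hmi
    rw [oddPart, Finset.mem_filter, Finset.mem_erase] at hi
    exact X.defect_ne_zero hxx hcl hi.1.1 (by rw [hm, hmi, Int.cast_zero, mul_zero])
  have hsum : ∀ f : X.ι → ℂ, ∑ i ∈ X.oddPart, f i = f j + f k + f l := by
    intro f
    rw [hS, Finset.sum_insert (by simp [hjk, hjl]), Finset.sum_pair hkl, add_assoc]
  have hj : j ∈ X.oddPart := by simp [hS]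
  have hk : k ∈ X.oddPart := by simp [hS]
  have hl : l ∈ X.oddPart := by simp [hS]
  have hlin : ∀ v : G, v * v = x → ∀ c : X.ι → ℤ,
      (∀ L : X.ι → ℂ, ∑ i ∈ X.B, X.χ i v * L i = L X.i₀ + ∑ i ∈ X.oddPart, (c i : ℂ) * L i) →
      c j * m j + c k * m k + c l * m l = 0 := by
    intro v hv c hc
    have h1 := X.sum_χ_mul_defect (hpow v hv) (hne v hv) hxx
    rw [hc, hsum, defect_principal, hm, hm, hm] at h1
    have h2 : (c j * m j + c k * m k + c l * m l : ℂ) = 0 := by linear_combination h1 / 4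
    exact_mod_cast h2
  have hm_j := hm0 j hj
  have hm_k := hm0 k hk
  have hm_l := hm0 l hl
  have hlα := hlin u hu α hαL
  by_cases hfus : ∀ y, y * t * y⁻¹ ≠ u⁻¹
  · obtain ⟨-, β, hβ, hβ1, hβL⟩ := X.exists_signs hxx ht (hroot t ht).1 (hroot t ht).2
    have hlβ := hlin t ht β hβL
    have hαβ : 1 + (α j * β j + α k * β k + α l * β l) = 0 := by
      have h1 := X.form_eq_zero_of_two_elements (hpow u hu) (hpow t ht) hfus
      rw [form, hαL, χ_principal, hsum, hβ, hβ, hβ] at h1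
      exact_mod_cast h1
    rcases hα1 j hj with h1 | h1 <;> rcases hα1 k hk with h2 | h2 <;>
      rcases hα1 l hl with h3 | h3 <;> rcases hβ1 j hj with h4 | h4 <;>
      rcases hβ1 k hk with h5 | h5 <;> rcases hβ1 l hl with h6 | h6 <;>
      rw [h1, h2, h3] at hlα hαβ <;> rw [h4, h5, h6] at hlβ hαβ <;> omega
  · push Not at hfus
    obtain ⟨y, hy⟩ := hfus
    obtain ⟨-, γ, hγ, hγ1, hγL⟩ := X.exists_signs hxx hut (hroot _ hut).1 (hroot _ hut).2
    have hlγ := hlin _ hut γ hγL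
    have hβ : ∀ i, X.χ i t = α i := fun i => by
      rw [← X.χ_conj i y t, hy, (hroot u hu).1, hα]
    have hd : γ j * X.d j + γ k * X.d k + γ l * X.d l = -1 := by
      have h1 := X.sum_χ_mul_d (hpow _ hut) (hne _ hut)
      rw [hγL, hsum, d_principal] at h1
      have h2 : (γ j * X.d j + γ k * X.d k + γ l * X.d l : ℂ) = -1 := by
        push_cast at h1
        linear_combination h1
      exact_mod_cast h2
    have hq : γ j * m j ^ 2 * (X.d k * X.d l) + γ k * m k ^ 2 * (X.d j * X.d l) +
        γ l * m l ^ 2 * (X.d j * X.d k) = 0 := by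
      have h1 := X.sum_χ_mul_defect_sq_div (hpow _ hut) (hne _ hut) hxx h
      rw [hγL, hsum, defect_principal, hm, hm, hm] at h1
      have hdj := X.d_ne_zero j
      have hdk := X.d_ne_zero k
      have hdl := X.d_ne_zero l
      field_simp at h1
      have h2 : (γ j * m j ^ 2 * (X.d k * X.d l) + γ k * m k ^ 2 * (X.d j * X.d l) +
        γ l * m l ^ 2 * (X.d j * X.d k) : ℂ) = 0 := by linear_combination h1 / 16
      exact_mod_cast h2
    have hmod : ∀ i, ∃ n : ℤ, X.d i - 2 * m i + 2 * α i + γ i = 4 * n := by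
      intro i
      obtain ⟨n, hn⟩ := X.exists_nat_quaternion i (u := u) (t := t) (hpow u hu) (ht.trans hu.symm)
        (by rw [hinv u hu, htu'])
      have h1 : X.χ i (u * u * t) = α i := by
        rw [hu, ← ht, hinv t ht, (hroot t ht).1, hβ]
      have h2 : X.χ i (u * u * u * t) = γ i := by
        rw [← hγ, ← (hroot _ hut).1, ← hinv _ hut, hut, hu, mul_assoc]
      have h3 := hm i
      rw [defect] at h3
      rw [h1, h2, hinv u hu, (hroot u hu).1, hβ, hγ, hα, χ_one, hu] at hn
      refine ⟨n, ?_⟩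
      have h4 : (X.d i - 2 * m i + 2 * α i + γ i : ℂ) = 4 * n := by
        linear_combination hn / 2 + h3 / 2
      exact_mod_cast h4
    have hpar : ∀ i ∈ X.oddPart, Even (γ i * m i) → γ i * X.d i % 4 = 1 := by
      intro i hi he
      obtain ⟨n, hn⟩ := hmod i
      rw [Int.even_iff] at he
      rcases hα1 i hi with h1 | h1 <;> rcases hγ1 i hi with h2 | h2 <;>
        rw [h2] at he ⊢ <;> rw [h1, h2] at hn <;> omega
    have h0 := eq_zero_of_descent hd hlγ (hpar j hj) (hpar k hk) (hpar l hl)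
      (by linear_combination γ j * γ k * γ l * hq)
    rcases mul_eq_zero.1 h0 with h1 | h1
    · rcases hγ1 j hj with h2 | h2 <;> omega
    · exact hm_j h1

end GroupChar

open GroupChar in
theorem isCentralModOdd_of_normalClosure_eq_top {G : Type u} [Group G] [Finite G] {x : G}
    (hx : x * x = 1) (hx1 : x ≠ 1) (h : IsOddlyIsolated x)
    (hcl : Subgroup.normalClosure {x} = ⊤)
    (hz : ∀ z : G, z * z = 1 → z ≠ 1 → ∃ g : G, g * z ≠ z * g)
    (hsub : ∀ (H : Subgroup G) (y : G) (hy : y ∈ H), H ≠ ⊤ → y * y = 1 → IsOddlyIsolated y →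
        IsCentralModOdd (⟨y, hy⟩ : H)) : IsCentralModOdd x := by
  cases nonempty_fintype G
  have hlone : IsLoneInvolution x := ⟨hx, hx1, fun y hy hy1 hxy =>
    eq_of_commute_involution hx h hcl hz hsub hy hy1 hxy.eq⟩
  by_contra hcon
  have hdata : ∀ v : G, v * v = x → ∃ D : QuaternionData x v, D.a = 0 := fun v hv =>
    let ⟨D⟩ := (hlone.isCentralModOdd_or_quaternionData hv).resolve_left hcon
    ⟨D, quaternionData_a_eq_zero hlone hcl h hv D⟩
  by_cases hsq : ∃ u, u * u = x
  · obtain ⟨u, hu⟩ := hsq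
    obtain ⟨D, hD⟩ := hdata u hu
    obtain ⟨X⟩ := nonempty_charTable G
    refine not_quaternion hx hx1 hcl h X (fun v hv => ?_) hu D.t_sq (D.conj_t D.mem_zpowers_w)
    obtain ⟨E, hE⟩ := hdata v hv
    refine ⟨fun i => X.χ_inv_eq E i E.mem_zpowers_w, ?_⟩
    rw [X.form_self hlone hv E E.mem_zpowers_w (by rwa [hv]), hE]
    norm_num
  · exact hcon (hlone.isCentralModOdd_of_forall_sq_ne (not_exists.1 hsq))

/-- The `Z*`-theorem for involutions. -/
theorem zstar {G : Type*} [Group G] [Finite G] (x : G) (hx : x * x = 1)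
    (h : ∀ g : G, Odd (orderOf (x * (g * x * g⁻¹)))) :
    ∃ N : Subgroup G, N.Normal ∧ Odd (Nat.card N) ∧ ∀ g : G, x * (g * x * g⁻¹) ∈ N :=
  isCentralModOdd_of_forall (fun _ _ _ _ hx hx1 h hcl hz hsub =>
    isCentralModOdd_of_normalClosure_eq_top hx hx1 h hcl hz hsub) G x hx h

section Involution

variable {Γ : Type*} [Group Γ]

/-- The involution of the semidirect product of `Γ` with the group generated by `τ`. -/
def semidirectInvolution (τ : MulAut Γ) :
    Γ ⋊[(Subgroup.zpowers τ).subtype] (Subgroup.zpowers τ) :=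
  SemidirectProduct.inr ⟨τ, Subgroup.mem_zpowers τ⟩

theorem semidirectInvolution_mul_self (τ : MulAut Γ) (hτ : τ * τ = 1) :
    semidirectInvolution τ * semidirectInvolution τ = 1 := by
  rw [semidirectInvolution, ← map_mul]
  have : (⟨τ, Subgroup.mem_zpowers τ⟩ * ⟨τ, Subgroup.mem_zpowers τ⟩ : Subgroup.zpowers τ) = 1 :=
    Subtype.ext hτ
  rw [this, map_one]

theorem semidirectInvolution_mul_conj (τ : MulAut Γ) (hτ : τ * τ = 1)
    (g : Γ ⋊[(Subgroup.zpowers τ).subtype] (Subgroup.zpowers τ)) :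
    semidirectInvolution τ * (g * semidirectInvolution τ * g⁻¹) =
      SemidirectProduct.inl (τ g.left * g.left⁻¹) := by
  have hg : g = SemidirectProduct.inl g.left * SemidirectProduct.inr g.right := by simp
  have hc : SemidirectProduct.inr g.right * semidirectInvolution τ =
      semidirectInvolution τ * SemidirectProduct.inr g.right := by
    rw [semidirectInvolution, ← map_mul, ← map_mul]
    obtain ⟨k, hk⟩ := g.right.2
    congr 1
    refine Subtype.ext ?_
    change (g.right : MulAut Γ) * τ = τ * g.right
    rw [← hk]
    exact ((Commute.refl τ).zpow_left k).eq
  have h1 : g * semidirectInvolution τ * g⁻¹ =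
      SemidirectProduct.inl g.left * semidirectInvolution τ * SemidirectProduct.inl g.left⁻¹ := by
    conv_lhs => rw [hg]
    rw [mul_inv_rev, mul_assoc _ (SemidirectProduct.inr g.right), hc, map_inv]
    group
  have h2 : semidirectInvolution τ * SemidirectProduct.inl g.left =
      SemidirectProduct.inl (τ g.left) * semidirectInvolution τ := by
    have := SemidirectProduct.inl_aut (φ := (Subgroup.zpowers τ).subtype)
      ⟨τ, Subgroup.mem_zpowers τ⟩ g.left
    simp only [Subgroup.subtype_apply] at this
    rw [this, semidirectInvolution]
    simp [mul_assoc]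
  rw [h1, ← mul_assoc, ← mul_assoc, h2, mul_assoc (SemidirectProduct.inl (τ g.left)),
    semidirectInvolution_mul_self τ hτ, mul_one, ← map_mul]

instance [Finite Γ] (τ : MulAut Γ) :
    Finite (Γ ⋊[(Subgroup.zpowers τ).subtype] (Subgroup.zpowers τ)) :=
  Finite.of_equiv _ SemidirectProduct.equivProd.symm

theorem aut_mul_inv_eq (τ : MulAut Γ) (g : Γ) : τ g * g⁻¹ = (g⁻¹⁻¹ * τ g⁻¹)⁻¹ := by
  simp

/-- The Z*-theorem for an automorphism of order two. -/
theorem exists_normal_odd_of_aut [Finite Γ] (τ : MulAut Γ) (hτ : τ * τ = 1)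
    (h : ∀ g : Γ, Odd (orderOf (g⁻¹ * τ g))) :
    ∃ N : Subgroup Γ, N.Normal ∧ Odd (Nat.card N) ∧ ∀ g : Γ, g⁻¹ * τ g ∈ N := by
  have hinj := SemidirectProduct.inl_injective (φ := (Subgroup.zpowers τ).subtype)
  obtain ⟨N, hN, hodd, hmem⟩ := zstar (semidirectInvolution τ) (semidirectInvolution_mul_self τ hτ)
    (fun g => by
      rw [semidirectInvolution_mul_conj τ hτ, orderOf_injective _ hinj, aut_mul_inv_eq,
        orderOf_inv]
      exact h _)
  refine ⟨N.comap SemidirectProduct.inl, inferInstance, ?_, fun g => ?_⟩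
  · exact hodd.of_dvd_nat (Subgroup.card_comap_dvd_of_injective N _ hinj)
  · have := hmem (SemidirectProduct.inl g⁻¹)
    rw [semidirectInvolution_mul_conj τ hτ, SemidirectProduct.left_inl, aut_mul_inv_eq] at this
    rw [Subgroup.mem_comap, ← inv_mem_iff, ← map_inv]
    simpa using this

/-- The Baer–Suzuki theorem for an automorphism of order two. -/
theorem exists_normal_two_subgroup_of_aut [Finite Γ] (τ : MulAut Γ) (hτ : τ * τ = 1)
    (h : ∀ g : Γ, ∃ n : ℕ, (g⁻¹ * τ g) ^ 2 ^ n = 1) :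
    ∃ N : Subgroup Γ, N.Normal ∧ IsPGroup 2 N ∧ ∀ g : Γ, g⁻¹ * τ g ∈ N := by
  have hinj := SemidirectProduct.inl_injective (φ := (Subgroup.zpowers τ).subtype)
  obtain ⟨N, hN, hp, hmem⟩ := exists_normal_two_subgroup_of_conj (semidirectInvolution τ)
    (semidirectInvolution_mul_self τ hτ) (fun g => by
      obtain ⟨n, hn⟩ := h g.left⁻¹
      refine ⟨n, ?_⟩
      rw [semidirectInvolution_mul_conj τ hτ, ← map_pow, aut_mul_inv_eq, inv_pow, hn]
      simp)
  refine ⟨N.comap SemidirectProduct.inl, inferInstance, hp.comap_of_injective _ hinj, fun g => ?_⟩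
  have := mul_mem hmem (hN.conj_mem _ hmem (SemidirectProduct.inl g⁻¹))
  rw [semidirectInvolution_mul_conj τ hτ, SemidirectProduct.left_inl, aut_mul_inv_eq] at this
  rw [Subgroup.mem_comap, ← inv_mem_iff, ← map_inv]
  simpa using this

end Involution

section TwistedSubset

variable {G : Type*} [Group G] {K : Set G}

theorem pow_mem_of_twisted (h1 : 1 ∈ K) (hK : ∀ k ∈ K, ∀ l ∈ K, k * l * k ∈ K) (k : G)
    (hk : k ∈ K) (n : ℕ) : k ^ n ∈ K := by
  induction n using Nat.twoStepInduction with
  | zero => simpa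
  | one => simpa
  | more n ih _ =>
    have := hK k hk _ ih
    rwa [← pow_succ', ← pow_succ] at this

theorem inv_mul_aut_mem_of_twisted (h1 : 1 ∈ K) (hK : ∀ k ∈ K, ∀ l ∈ K, k * l * k ∈ K)
    (hinv : ∀ k ∈ K, k⁻¹ ∈ K) (hgen : Subgroup.closure K = ⊤) (τ : MulAut G)
    (hτK : ∀ k ∈ K, τ k = k⁻¹) (g : G) : g⁻¹ * τ g ∈ K := by
  have key : (∀ c ∈ K, g⁻¹ * c * τ g ∈ K) ∧ ∀ c ∈ K, g * c * (τ g)⁻¹ ∈ K := by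
    have hg : g ∈ Subgroup.closure K := hgen ▸ Subgroup.mem_top g
    induction hg using Subgroup.closure_induction with
    | mem k hk =>
      rw [hτK k hk, inv_inv]
      exact ⟨fun c hc => hK _ (hinv k hk) c hc, fun c hc => hK _ hk c hc⟩
    | one => simp
    | mul a b _ _ iha ihb =>
      refine ⟨fun c hc => ?_, fun c hc => ?_⟩
      · simpa [mul_assoc] using ihb.1 _ (iha.1 c hc)
      · simpa [mul_assoc] using iha.2 _ (ihb.2 c hc)
    | inv a _ iha => simpa using iha.symm
  simpa using key.1 1 h1

theorem conj_mem_closure_of_conj_mem {S : Set G} (hS : ∀ g, ∀ s ∈ S, g * s * g⁻¹ ∈ S) :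
    (Subgroup.closure S).Normal := by
  refine ⟨fun n hn g => ?_⟩
  have : Subgroup.closure S ≤ (Subgroup.closure S).comap (MulAut.conj g).toMonoidHom := by
    rw [Subgroup.closure_le]
    intro s hs
    exact Subgroup.subset_closure (hS g s hs)
  exact this hn

theorem normal_of_commute_of_sup_eq_top (A B : Subgroup G) (hAB : A ⊔ B = ⊤)
    (hc : ∀ a ∈ A, ∀ b ∈ B, Commute a b) : A.Normal := by
  rw [← Subgroup.normalizer_eq_top_iff, eq_top_iff, ← hAB, sup_le_iff]
  refine ⟨Subgroup.le_normalizer, fun b hb => ?_⟩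
  rw [Subgroup.mem_normalizer_iff]
  have hfix : ∀ a ∈ A, b * a * b⁻¹ = a := fun a ha => by rw [← (hc a ha b hb).eq]; simp
  have hfix' : ∀ a ∈ A, b⁻¹ * a * b = a := fun a ha => by rw [mul_assoc, (hc a ha b hb).eq]; simp
  intro a
  refine ⟨fun ha => by rwa [hfix a ha], fun ha => ?_⟩
  have := hfix' _ ha
  rw [show b⁻¹ * (b * a * b⁻¹) * b = a by group] at this
  rwa [this]

theorem commute_closure {S T : Set G} (h : ∀ s ∈ S, ∀ t ∈ T, Commute s t) :
    ∀ a ∈ Subgroup.closure S, ∀ b ∈ Subgroup.closure T, Commute a b := by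
  intro a ha b hb
  have h1 : Subgroup.closure S ≤ Subgroup.centralizer T := by
    rw [Subgroup.closure_le]
    intro s hs
    rw [SetLike.mem_coe, Subgroup.mem_centralizer_iff]
    exact fun t ht => (h s hs t ht).eq.symm
  have h2 : Subgroup.closure T ≤ Subgroup.centralizer {a} := by
    rw [Subgroup.closure_le]
    intro t ht
    rw [SetLike.mem_coe, Subgroup.mem_centralizer_singleton_iff]
    exact Subgroup.mem_centralizer_iff.1 (h1 ha) t ht
  exact (Subgroup.mem_centralizer_singleton_iff.1 (h2 hb)).symm

theorem map_aut_eq_of_twisted {S : Set G} (τ : MulAut G) (hτ : τ * τ = 1)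
    (h : ∀ s ∈ S, τ s = s⁻¹) :
    (Subgroup.closure S).map (τ : G →* G) = Subgroup.closure S := by
  have hle : (Subgroup.closure S).map (τ : G →* G) ≤ Subgroup.closure S := by
    rw [Subgroup.map_le_iff_le_comap, Subgroup.closure_le]
    intro s hs
    change τ s ∈ Subgroup.closure S
    rw [h s hs]
    exact inv_mem (Subgroup.subset_closure hs)
  refine le_antisymm hle fun x hx => ⟨τ x, hle ⟨x, hx, rfl⟩, ?_⟩
  change (τ * τ) x = x
  rw [hτ, MulAut.one_apply]

theorem exists_sq_of_odd_orderOf (b : G) (hb : Odd (orderOf b)) : ∃ n : ℕ, b ^ n * b ^ n = b := by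
  obtain ⟨m, hm⟩ := hb
  refine ⟨m + 1, ?_⟩
  rw [← pow_add, show m + 1 + (m + 1) = orderOf b + 1 by omega, pow_succ, pow_orderOf_eq_one,
    one_mul]

variable [Finite G]

/-- Let `G` be generated by a twisted subset `K` inverted by an involutory automorphism `τ`, such
that elements of `K` of `2`-power order commute with those of odd order. Then `G` is generated by
`O(G)` and `O^{2'}(G)`, and `τ` acts trivially on their intersection. -/
theorem oddCore_sup_oddResidual_of_twisted (h1 : 1 ∈ K) (hK : ∀ k ∈ K, ∀ l ∈ K, k * l * k ∈ K)
    (hinv : ∀ k ∈ K, k⁻¹ ∈ K) (hgen : Subgroup.closure K = ⊤) (τ : MulAut G) (hτ : τ * τ = 1)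
    (hτK : ∀ k ∈ K, τ k = k⁻¹)
    (hcomm : ∀ a ∈ K, ∀ b ∈ K, (∃ n : ℕ, a ^ 2 ^ n = 1) → Odd (orderOf b) → Commute a b) :
    oddCore G ⊔ oddResidual G = ⊤ ∧ ∀ n ∈ oddCore G ⊓ oddResidual G, τ n = n := by
  have hpow := pow_mem_of_twisted h1 hK
  have hmemK := inv_mul_aut_mem_of_twisted h1 hK hinv hgen τ hτK
  set S : Set G := {a | a ∈ K ∧ ∃ n : ℕ, a ^ 2 ^ n = 1} with hS
  set T : Set G := {b | b ∈ K ∧ Odd (orderOf b)} with hT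
  set A := Subgroup.closure S with hA
  set B := Subgroup.closure T with hB
  have hdecomp : ∀ k ∈ K, ∃ a ∈ S, ∃ b ∈ T, a * b = k := by
    intro k hk
    obtain ⟨i, j, hij, hi, hj⟩ := exists_two_part_odd_part k
    exact ⟨k ^ i, ⟨hpow k hk i, hi⟩, k ^ j, ⟨hpow k hk j, hj⟩, hij⟩
  have hABc : ∀ a ∈ A, ∀ b ∈ B, Commute a b :=
    commute_closure fun s hs t ht => hcomm s hs.1 t ht.1 hs.2 ht.2
  have hAB : A ⊔ B = ⊤ := by
    rw [eq_top_iff, ← hgen, Subgroup.closure_le]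
    intro k hk
    obtain ⟨a, ha, b, hb, rfl⟩ := hdecomp k hk
    exact mul_mem ((le_sup_left : A ≤ A ⊔ B) (Subgroup.subset_closure ha))
      ((le_sup_right : B ≤ A ⊔ B) (Subgroup.subset_closure hb))
  have hAn : A.Normal := normal_of_commute_of_sup_eq_top A B hAB hABc
  have hBn : B.Normal := normal_of_commute_of_sup_eq_top B A (by rw [sup_comm, hAB])
    fun b hb a ha => (hABc a ha b hb).symm
  have hAτ : A.map (τ : G →* G) = A := map_aut_eq_of_twisted τ hτ fun s hs => hτK s hs.1
  have hBτ : B.map (τ : G →* G) = B := map_aut_eq_of_twisted τ hτ fun s hs => hτK s hs.1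
  have hAodd : Odd A.index := by
    let τA : MulAut (G ⧸ A) := QuotientGroup.congr A A τ hAτ
    have hτA : ∀ g : G, τA (g : G ⧸ A) = (τ g : G) := fun g => rfl
    have hτA2 : τA * τA = 1 := by
      ext x
      obtain ⟨g, rfl⟩ := QuotientGroup.mk_surjective x
      change τA (τA g) = g
      rw [hτA, hτA, show τ (τ g) = (τ * τ) g from rfl, hτ, MulAut.one_apply]
    have him : ∀ g : G, (g : G ⧸ A)⁻¹ * τA g = ((g⁻¹ * τ g : G) : G ⧸ A) := fun g => rfl
    have hk : ∀ k ∈ K, ∃ b ∈ T, (k : G ⧸ A) = b := by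
      intro k hk
      obtain ⟨a, ha, b, hb, rfl⟩ := hdecomp k hk
      refine ⟨b, hb, ?_⟩
      rw [QuotientGroup.mk_mul, (QuotientGroup.eq_one_iff a).2 (Subgroup.subset_closure ha),
        one_mul]
    obtain ⟨N, hN, hNodd, hNmem⟩ := exists_normal_odd_of_aut τA hτA2 (fun x => by
      obtain ⟨g, rfl⟩ := QuotientGroup.mk_surjective x
      rw [him]
      obtain ⟨b, hb, hbe⟩ := hk _ (hmemK g)
      rw [hbe]
      exact hb.2.of_dvd_nat (orderOf_map_dvd (QuotientGroup.mk' A) b))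
    have hNtop : N = ⊤ := by
      have : Subgroup.closure K ≤ N.comap (QuotientGroup.mk' A) := by
        rw [Subgroup.closure_le]
        intro k hk'
        obtain ⟨b, hb, hbe⟩ := hk k hk'
        change (k : G ⧸ A) ∈ N
        rw [hbe]
        obtain ⟨n, hn⟩ := exists_sq_of_odd_orderOf b hb.2
        have := hNmem (b ^ n : G)
        rw [him, hτK _ (hpow b hb.1 n), ← mul_inv_rev, hn, QuotientGroup.mk_inv] at this
        exact inv_mem_iff.1 this
      rw [hgen] at this
      rw [eq_top_iff]
      intro x _
      obtain ⟨g, rfl⟩ := QuotientGroup.mk_surjective x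
      exact this (Subgroup.mem_top g)
    rw [Subgroup.index_eq_card]
    rwa [hNtop, Subgroup.card_top] at hNodd
  have hA2 : ∀ (a : G) (n : ℕ), a ^ 2 ^ n = 1 → a ∈ A := mem_of_odd_index A hAodd
  have hAle : A ≤ oddResidual G := by
    refine le_iInf fun N => ?_
    have := N.2.1
    rw [hA, Subgroup.closure_le]
    rintro a ⟨-, n, ha⟩
    exact mem_of_odd_index _ N.2.2 a n ha
  have hleA : oddResidual G ≤ A := oddResidual_le A hAn hAodd
  have hBodd : Odd (Nat.card B) := by
    rw [← Nat.not_even_iff_odd, even_iff_two_dvd]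
    refine not_dvd_card_closure Nat.prime_two T A
      (fun a ha t ht => hABc a ha t (Subgroup.subset_closure ht)) ?_ fun t ht => ?_
    · intro h
      exact Nat.not_even_iff_odd.2 hAodd
        (even_iff_two_dvd.2 (h.trans (Subgroup.relIndex_dvd_index_of_normal A _)))
    · rw [← even_iff_two_dvd, Nat.not_even_iff_odd]; exact ht.2
  have htop : oddCore G ⊔ oddResidual G = ⊤ := by
    rw [eq_top_iff, ← hAB, sup_comm A B]
    exact sup_le_sup (le_oddCore B hBn hBodd) hAle
  refine ⟨htop, ?_⟩
  obtain ⟨Q, hQn, hQp, hQ⟩ : ∃ Q : Subgroup G, Q.Normal ∧ IsPGroup 2 Q ∧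
      ∀ s ∈ S, s⁻¹ * τ s ∈ Q := by
    let τB : MulAut (G ⧸ B) := QuotientGroup.congr B B τ hBτ
    have hτB : ∀ g : G, τB (g : G ⧸ B) = (τ g : G) := fun g => rfl
    have hτB2 : τB * τB = 1 := by
      ext x
      obtain ⟨g, rfl⟩ := QuotientGroup.mk_surjective x
      change τB (τB g) = g
      rw [hτB, hτB, show τ (τ g) = (τ * τ) g from rfl, hτ, MulAut.one_apply]
    have him : ∀ g : G, (g : G ⧸ B)⁻¹ * τB g = ((g⁻¹ * τ g : G) : G ⧸ B) := fun g => rfl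
    have hk : ∀ k ∈ K, ∃ a ∈ S, (k : G ⧸ B) = a := by
      intro k hk
      obtain ⟨a, ha, b, hb, rfl⟩ := hdecomp k hk
      refine ⟨a, ha, ?_⟩
      rw [QuotientGroup.mk_mul, (QuotientGroup.eq_one_iff b).2 (Subgroup.subset_closure hb),
        mul_one]
    obtain ⟨R, hR, hRp, hRmem⟩ := exists_normal_two_subgroup_of_aut τB hτB2 (fun x => by
      obtain ⟨g, rfl⟩ := QuotientGroup.mk_surjective x
      rw [him]
      obtain ⟨a, ⟨-, n, han⟩, hae⟩ := hk _ (hmemK g)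
      refine ⟨n, ?_⟩
      rw [hae, ← QuotientGroup.mk_pow, han, QuotientGroup.mk_one])
    set U : Set G := {r | (r : G ⧸ B) ∈ R ∧ ∃ n : ℕ, r ^ 2 ^ n = 1} with hU
    refine ⟨Subgroup.closure U, conj_mem_closure_of_conj_mem ?_, ?_, ?_⟩
    · rintro g r ⟨hr, n, hrn⟩
      refine ⟨?_, n, by rw [conj_pow, hrn]; simp⟩
      exact hR.conj_mem _ hr g
    · have hcard : Nat.card (Subgroup.closure U) =
          2 ^ (Nat.card (Subgroup.closure U)).primeFactorsList.length := by
        refine Nat.eq_prime_pow_of_unique_prime_dvd Nat.card_pos.ne' fun {p} hp hpd => ?_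
        by_contra hp2
        have hp2' : p.Coprime 2 := (Nat.coprime_primes hp Nat.prime_two).2 hp2
        refine not_dvd_card_closure hp U B ?_ ?_ ?_ hpd
        · rintro b hb u ⟨-, n, hun⟩
          exact (hABc u (hA2 u n hun) b hb).symm.eq
        · have : B.relIndex (Subgroup.closure U) =
              Nat.card ((Subgroup.closure U).map (QuotientGroup.mk' B)) := by
            rw [← Subgroup.relIndex_ker, QuotientGroup.ker_mk']
          rw [this]
          have hle : (Subgroup.closure U).map (QuotientGroup.mk' B) ≤ R := by
            rw [Subgroup.map_le_iff_le_comap, Subgroup.closure_le]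
            exact fun u hu => hu.1
          obtain ⟨n, hn⟩ := IsPGroup.iff_card.1 (hRp.to_le hle)
          rw [hn]
          intro h
          exact hp2 ((Nat.prime_dvd_prime_iff_eq hp Nat.prime_two).1 (hp.dvd_of_dvd_pow h))
        · rintro u ⟨-, n, hun⟩ h
          have := h.trans (orderOf_dvd_of_pow_eq_one hun)
          exact hp2 ((Nat.prime_dvd_prime_iff_eq hp Nat.prime_two).1 (hp.dvd_of_dvd_pow this))
      exact IsPGroup.of_card hcard
    · rintro s ⟨hsK, n, hsn⟩
      refine Subgroup.subset_closure ⟨?_, n, ?_⟩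
      · rw [← him]
        exact hRmem _
      · rw [hτK s hsK, ← pow_two, ← pow_mul, mul_comm, pow_mul, inv_pow, hsn]; simp
  have hQA : ∀ g ∈ A, g⁻¹ * τ g ∈ Q := by
    intro g hg
    induction hg using Subgroup.closure_induction with
    | mem s hs => exact hQ s hs
    | one => simp
    | mul a b _ _ iha ihb =>
      have := mul_mem (hQn.conj_mem _ iha b⁻¹) ihb
      simpa [mul_assoc] using this
    | inv a _ iha =>
      have := hQn.conj_mem _ (inv_mem iha) a
      simpa [mul_assoc] using this
  obtain ⟨hcn, hcodd⟩ := odd_card_oddCore G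
  rintro n ⟨hn1, hn2⟩
  have hτn : τ n ∈ oddCore G := by
    have hcard : Nat.card ((oddCore G).map (τ : G →* G)) = Nat.card (oddCore G) :=
      (Nat.card_congr ((oddCore G).equivMapOfInjective (τ : G →* G) τ.injective).toEquiv).symm
    exact le_oddCore _ (hcn.map _ τ.surjective) (by rwa [hcard]) ⟨n, hn1, rfl⟩
  have hx : n⁻¹ * τ n ∈ oddCore G := mul_mem (inv_mem hn1) hτn
  obtain ⟨m, hm⟩ := hQp ⟨_, hQA n (hleA hn2)⟩
  have hm' : (n⁻¹ * τ n) ^ 2 ^ m = 1 := congrArg Subtype.val hm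
  have e : n⁻¹ * τ n = 1 := by
    have h3 : (2 ^ m).Coprime (Nat.card (oddCore G)) := (Nat.coprime_two_left.2 hcodd).pow_left m
    exact orderOf_eq_one_iff.1 (Nat.eq_one_of_dvd_coprimes h3 (orderOf_dvd_of_pow_eq_one hm')
      (Subgroup.orderOf_dvd_natCard _ hx))
  exact (inv_mul_eq_one.1 e).symm

end TwistedSubset

namespace BruckLoop

variable {X : Type*} (L : BruckLoop X)

theorem rho_apply (x y : X) : L.rho x y = L.mul y x := rfl

theorem rho_one : L.rho L.one = 1 := Equiv.ext fun y => L.mul_one y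

theorem rho_mul_rho_mul_rho (y z : X) :
    L.rho y * L.rho z * L.rho y = L.rho (L.mul (L.mul y z) y) :=
  Equiv.ext fun x => L.rightBol x y z

theorem rho_mul_self (y : X) : L.rho y * L.rho y = L.rho (L.mul y y) := by
  have := L.rho_mul_rho_mul_rho y L.one
  rwa [rho_one, _root_.mul_one, L.mul_one] at this

theorem mul_mul_inv (x y : X) : L.mul (L.mul x y) (L.inv y) = x := by
  apply (L.mulRight_bijective y).1
  change L.mul (L.mul (L.mul x y) (L.inv y)) y = L.mul x y
  rw [L.rightBol, L.mul_inv, L.one_mul]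

theorem inv_inv (x : X) : L.inv (L.inv x) = x := by
  apply (L.mulLeft_bijective (L.inv x)).1
  rw [L.mul_inv, L.inv_mul]

theorem mul_inv_mul (x y : X) : L.mul (L.mul x (L.inv y)) y = x := by
  have := L.mul_mul_inv x (L.inv y)
  rwa [L.inv_inv] at this

theorem inv_one : L.inv L.one = L.one := by
  rw [← L.one_mul (L.inv L.one), L.mul_inv]

theorem rho_inv (x : X) : L.rho (L.inv x) = (L.rho x)⁻¹ :=
  eq_inv_of_mul_eq_one_left (Equiv.ext fun y => L.mul_mul_inv y x)

theorem inv_mul_sq (x : X) : L.mul (L.inv x) (L.mul x x) = x := by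
  have := L.rightBol (L.inv x) x L.one
  rw [L.inv_mul, L.one_mul, L.mul_one, L.one_mul] at this
  exact this.symm

theorem sq_mul (a x : X) :
    L.mul (L.mul a x) (L.mul a x) = L.mul (L.mul x (L.mul a a)) x := by
  apply (L.mulLeft_bijective (L.inv (L.mul a x))).1
  rw [L.inv_mul_sq, ← L.rightBol, L.aip, L.mul_inv_mul, L.inv_mul_sq]

theorem rho_sq_mul (a x : X) :
    L.rho (L.mul a x) * L.rho (L.mul a x) = L.rho x * (L.rho a * L.rho a) * L.rho x := by
  rw [L.rho_mul_self, L.rho_mul_self, L.rho_mul_rho_mul_rho, L.sq_mul]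

theorem rho_pow_mem_range (x : X) (n : ℕ) : L.rho x ^ n ∈ Set.range L.rho :=
  pow_mem_of_twisted (K := Set.range L.rho) ⟨L.one, L.rho_one⟩
    (by rintro _ ⟨y, rfl⟩ _ ⟨z, rfl⟩; exact ⟨_, (L.rho_mul_rho_mul_rho y z).symm⟩) _ ⟨x, rfl⟩ n

/-- In a Bruck loop, right translations of `2`-power order commute with those of odd order. -/
theorem commute_rho_rho (n : ℕ) (a x : X) (ha : L.rho a ^ 2 ^ n = 1)
    (hx : Odd (orderOf (L.rho x))) : Commute (L.rho a) (L.rho x) := by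
  induction n generalizing a with
  | zero =>
    rw [pow_zero, pow_one] at ha
    rw [ha]
    exact Commute.one_left _
  | succ n ih =>
    have ha2 : L.rho (L.mul a a) ^ 2 ^ n = 1 := by
      rw [← L.rho_mul_self, ← pow_two, ← pow_mul, ← pow_succ', ha]
    have hc := ih (L.mul a a) ha2
    set z := L.mul a x with hz
    set o := orderOf (L.rho x) with ho
    have hsq : L.rho z ^ 2 = L.rho (L.mul a a) * L.rho x ^ 2 := by
      rw [pow_two, L.rho_sq_mul, L.rho_mul_self, ← hc.eq, mul_assoc, ← pow_two]
    obtain ⟨M, hM⟩ : ∃ M, 2 ^ (n + 1) * M ≡ 1 [MOD o] := by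
      obtain ⟨M, h0, h1⟩ := Nat.chineseRemainder
        ((Nat.coprime_two_left.2 hx).pow_left (n + 1)) 0 1
      obtain ⟨c, rfl⟩ := (Nat.modEq_zero_iff_dvd).1 h0
      exact ⟨c, h1⟩
    have hxz : L.rho x = L.rho z ^ (2 ^ (n + 1) * M) := by
      rw [pow_succ', mul_assoc, pow_mul, hsq, (hc.pow_right 2).mul_pow, pow_mul, ha2, one_pow,
        _root_.one_mul, ← pow_mul, ← mul_assoc, ← pow_succ']
      conv_lhs => rw [← pow_one (L.rho x)]
      exact (pow_inj_mod).2 hM.symm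
    have hcz : Commute (L.rho x) (L.rho z) := by
      rw [hxz]; exact Commute.pow_self _ _
    have hk : (L.rho x)⁻¹ * L.rho z = L.rho z ^ (2 ^ (n + 1) * M * (o - 1) + 1) := by
      rw [pow_succ, pow_mul, ← hxz]
      congr 1
      rw [inv_eq_iff_mul_eq_one, ← pow_succ', Nat.sub_add_cancel hx.pos, ho, pow_orderOf_eq_one]
    obtain ⟨t, ht⟩ := L.rho_pow_mem_range z (2 ^ (n + 1) * M * (o - 1) + 1)
    rw [← hk] at ht
    have hta : t = a := by
      have := congrArg (fun f : Equiv.Perm X => f L.one) ht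
      simp only [Equiv.Perm.coe_mul, Function.comp_apply, rho_apply, L.one_mul,
        ← L.rho_inv] at this
      rw [this, hz, L.mul_mul_inv]
    rw [← hta, ht]
    exact ((Commute.refl _).inv_left).mul_left hcz.symm

/-- The inversion map of a Bruck loop. -/
def invPerm : Equiv.Perm X := Function.Involutive.toPerm L.inv L.inv_inv

theorem invPerm_mul_self : L.invPerm * L.invPerm = 1 := Equiv.ext L.inv_inv

theorem invPerm_mul_rho_mul (x : X) : L.invPerm * L.rho x * L.invPerm = (L.rho x)⁻¹ := by
  rw [← L.rho_inv]
  ext y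
  change L.inv (L.mul (L.inv y) x) = L.mul y (L.inv x)
  rw [L.aip, L.inv_inv]

theorem invPerm_conj_mem (g : Equiv.Perm X) (hg : g ∈ L.envGroup) :
    L.invPerm * g * L.invPerm ∈ L.envGroup := by
  have hJ : L.invPerm⁻¹ = L.invPerm := inv_eq_of_mul_eq_one_left L.invPerm_mul_self
  have : L.envGroup ≤ L.envGroup.comap (MulAut.conj L.invPerm).toMonoidHom := by
    conv_lhs => rw [envGroup]
    rw [Subgroup.closure_le]
    rintro _ ⟨x, rfl⟩
    change L.invPerm * L.rho x * L.invPerm⁻¹ ∈ L.envGroup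
    rw [hJ, invPerm_mul_rho_mul]
    exact inv_mem (Subgroup.subset_closure ⟨x, rfl⟩)
  have := this hg
  rw [← hJ]
  rwa [hJ]

/-- Conjugation by inversion, as an automorphism of the enveloping group. -/
def invAut : MulAut L.envGroup where
  toFun g := ⟨L.invPerm * g * L.invPerm, L.invPerm_conj_mem g g.2⟩
  invFun g := ⟨L.invPerm * g * L.invPerm, L.invPerm_conj_mem g g.2⟩
  left_inv g := Subtype.ext (by
    simp only [← mul_assoc, invPerm_mul_self, _root_.one_mul]
    rw [mul_assoc, invPerm_mul_self, _root_.mul_one])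
  right_inv g := Subtype.ext (by
    simp only [← mul_assoc, invPerm_mul_self, _root_.one_mul]
    rw [mul_assoc, invPerm_mul_self, _root_.mul_one])
  map_mul' g h := Subtype.ext (by
    simp only [Subgroup.coe_mul]
    rw [show L.invPerm * g * L.invPerm * (L.invPerm * h * L.invPerm) =
      L.invPerm * g * (L.invPerm * L.invPerm) * h * L.invPerm by group, invPerm_mul_self,
      _root_.mul_one]
    group)

theorem coe_invAut (g : L.envGroup) :
    (L.invAut g : Equiv.Perm X) = L.invPerm * g * L.invPerm := rfl

theorem rho_mem_envGroup (x : X) : L.rho x ∈ L.envGroup := Subgroup.subset_closure ⟨x, rfl⟩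

/-- A normal odd order subgroup of the enveloping group centralized by inversion is trivial. -/
theorem eq_bot_of_invAut_eq [Finite X] (N : Subgroup L.envGroup) (hN : N.Normal)
    (hodd : Odd (Nat.card N)) (h : ∀ n ∈ N, L.invAut n = n) : N = ⊥ := by
  have hfix : ∀ n ∈ N, (n : Equiv.Perm X) L.one = L.one := by
    intro n hn
    set y := (n : Equiv.Perm X) L.one with hy
    by_contra hy1
    have hinv : L.inv y = y := by
      have h2 := congrArg Subtype.val (h n hn)
      rw [coe_invAut] at h2
      have h3 := congrArg (fun f : Equiv.Perm X => f L.one) h2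
      change L.inv ((n : Equiv.Perm X) (L.inv L.one)) = y at h3
      rwa [L.inv_one] at h3
    let O := MulAction.orbit N L.one
    have hO : Odd (Nat.card O) := by
      refine hodd.of_dvd_nat ?_
      have := MulAction.index_stabilizer N L.one
      rw [← Nat.card_coe_set_eq] at this
      rw [← this]
      exact Subgroup.index_dvd_card _
    have hmaps : ∀ z ∈ O, L.mul z y ∈ O := by
      rintro _ ⟨m, rfl⟩
      let r : L.envGroup := ⟨L.rho y, L.rho_mem_envGroup y⟩
      refine ⟨⟨r * m * r⁻¹, hN.conj_mem _ m.2 r⟩ * ⟨n, hn⟩, ?_⟩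
      change L.rho y ((m : L.envGroup).1 ((L.rho y)⁻¹ (n.1 L.one))) = L.rho y (m.1.1 L.one)
      rw [← hy, ← L.rho_inv, rho_apply L (L.inv y), L.mul_inv]
    let f : O → O := fun z => ⟨L.mul z y, hmaps z z.2⟩
    have hf : Function.Involutive f := by
      rintro ⟨z, hz⟩
      refine Subtype.ext ?_
      change L.mul (L.mul z y) y = z
      have := L.mul_mul_inv z y
      rwa [hinv] at this
    have := Fintype.ofFinite O
    have hnd : ¬ 2 ∣ Fintype.card O := by
      rwa [← even_iff_two_dvd, Nat.not_even_iff_odd, ← Nat.card_eq_fintype_card]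
    obtain ⟨z, hz⟩ := Equiv.Perm.exists_fixed_point_of_prime (n := 1) (σ := hf.toPerm) hnd
      (Equiv.ext fun z => by rw [pow_one, pow_two]; exact hf z)
    have h4 : L.mul z y = z := congrArg Subtype.val hz
    exact hy1 ((L.mulLeft_bijective z).1 (h4.trans (L.mul_one z).symm))
  rw [Subgroup.eq_bot_iff_forall]
  intro n hn
  refine Subtype.ext (Equiv.ext fun x => ?_)
  let r : L.envGroup := ⟨L.rho x, L.rho_mem_envGroup x⟩
  have := hfix _ (hN.conj_mem n hn r⁻¹)
  have h2 : (L.rho x)⁻¹ (n.1 (L.rho x L.one)) = L.one := by simpa [r] using this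
  rw [Equiv.Perm.inv_eq_iff_eq, rho_apply, L.one_mul] at h2
  simpa using h2

end BruckLoop

/-- The enveloping group `G` of a finite Bruck loop is the direct product
`O(G) × O^{2'}(G)`: these two normal subgroups intersect trivially and generate `G`. -/
theorem BruckLoop.envGroup_eq_oddCore_prod_oddResidual {X : Type*} [Fintype X]
    (L : BruckLoop X) :
    oddCore ↥L.envGroup ⊓ oddResidual ↥L.envGroup = ⊥ ∧
      oddCore ↥L.envGroup ⊔ oddResidual ↥L.envGroup = ⊤ := by
  obtain ⟨htop, hfix⟩ := oddCore_sup_oddResidual_of_twisted (G := L.envGroup)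
    (K := {g | ∃ x, L.rho x = g}) ⟨L.one, L.rho_one⟩
    (by
      rintro k ⟨y, hy⟩ l ⟨z, hz⟩
      exact ⟨_, by rw [← L.rho_mul_rho_mul_rho y z, hy, hz]; rfl⟩)
    (by
      rintro k ⟨y, hy⟩
      exact ⟨_, by rw [L.rho_inv, hy]; rfl⟩)
    (by
      rw [eq_top_iff]
      rintro ⟨g, hg⟩ -
      induction hg using Subgroup.closure_induction with
      | mem g hg =>
        obtain ⟨x, rfl⟩ := hg
        exact Subgroup.subset_closure ⟨x, rfl⟩
      | one => exact one_mem _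
      | mul a b _ _ iha ihb => exact mul_mem iha ihb
      | inv a _ iha => exact inv_mem iha)
    L.invAut
    (by
      ext g : 1
      exact L.invAut.left_inv g)
    (by
      rintro k ⟨y, hy⟩
      refine Subtype.ext ?_
      rw [coe_invAut, ← hy, invPerm_mul_rho_mul, hy]
      rfl)
    (by
      rintro a ⟨y, hy⟩ b ⟨z, hz⟩ ⟨n, hn⟩ hb
      refine Subtype.ext ?_
      change (a : Equiv.Perm X) * b = b * a
      rw [← hy, ← hz]
      refine L.commute_rho_rho n y z ?_ ?_
      · rw [hy]; exact congrArg Subtype.val hn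
      · rw [hz]; rwa [Subgroup.orderOf_coe])
  refine ⟨L.eq_bot_of_invAut_eq _ ?_ ?_ hfix, htop⟩
  · have := (odd_card_oddCore L.envGroup).1
    infer_instance
  · exact (odd_card_oddCore L.envGroup).2.of_dvd_nat (Subgroup.card_dvd_of_le inf_le_left)
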